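/- Tame C^k estimate for the Dirichlet problem (Proposition 7.1): Let x : Ω → ℝⁿ be smooth with invertible Jacobian satisfying the coordinate condition with constant c₁, with metric g and Laplacian Δ as induced by x. Let q : Ω → ℝ be smooth with q = 0 on ∂Ω. Then for every r ≥ 1 there is a constant K depending only on n, r, c₁ and an upper bound for ‖x‖_{3,∞} such that ‖q‖_{r,∞} ≤ K (‖Δq‖_{r−1,∞} + ‖g‖_{r,∞} ‖Δq‖_{0,∞}). -/

import Mathlib

open scoped BigOperators
open Set Matrix

noncomputable section

abbrev E' (n : ℕ) := EuclideanSpace ℝ (Fin n)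

def Ball (n : ℕ) : Set (E' n) := Metric.closedBall 0 1

def Sphere' (n : ℕ) : Set (E' n) := Metric.sphere 0 1

variable {n : ℕ} {F : Type*} [NormedAddCommGroup F] [NormedSpace ℝ F]

/-- Partial derivative `∂u/∂y^a`. -/
def pd (a : Fin n) (u : E' n → ℝ) (y : E' n) : ℝ :=
  fderiv ℝ u y (EuclideanSpace.single a 1)

/-- Jacobian matrix `∂x^i/∂y^a`. -/
def jacM (x : E' n → E' n) (y : E' n) : Matrix (Fin n) (Fin n) ℝ :=
  Matrix.of fun i a => pd a (fun z => x z i) y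

/-- Metric `g_{ab} = Σ_i (∂x^i/∂y^a)(∂x^i/∂y^b)`. -/
def gMet (x : E' n → E' n) (y : E' n) : Matrix (Fin n) (Fin n) ℝ :=
  (jacM x y)ᵀ * jacM x y

def kappa (x : E' n → E' n) (y : E' n) : ℝ := (jacM x y).det

/-- Eulerian derivative `∂_i u = (∂y^a/∂x^i) ∂_a u`. -/
def epd (x : E' n → E' n) (i : Fin n) (u : E' n → ℝ) (y : E' n) : ℝ :=
  ∑ a, (jacM x y)⁻¹ a i * pd a u y

/-- Laplace–Beltrami operator `Δq = κ⁻¹ ∂_a (κ g^{ab} ∂_b q)`. -/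
def lapl (x : E' n → E' n) (q : E' n → ℝ) (y : E' n) : ℝ :=
  (kappa x y)⁻¹ *
    ∑ a, pd a (fun z => kappa x z * ∑ b, (gMet x z)⁻¹ a b * pd b q z) y

/-- Lagrangian divergence `div W = κ⁻¹ ∂_a (κ W^a)`. -/
def divL (x : E' n → E' n) (W : E' n → Fin n → ℝ) (y : E' n) : ℝ :=
  (kappa x y)⁻¹ * ∑ a, pd a (fun z => kappa x z * W z a) y

/-- Eulerian divergence `div u = ∂_k u^k`. -/
def divE (x : E' n → E' n) (u : E' n → Fin n → ℝ) (y : E' n) : ℝ :=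
  ∑ k, epd x k (fun z => u z k) y

/-- Eulerian curl `curl u_{ij} = ∂_i u_j − ∂_j u_i`. -/
def curlE (x : E' n → E' n) (u : E' n → Fin n → ℝ) (i j : Fin n) (y : E' n) : ℝ :=
  epd x i (fun z => u z j) y - epd x j (fun z => u z i) y

/-- Exterior unit (with respect to `g`) normal derivative on the unit sphere. -/
def gradN (x : E' n → E' n) (p : E' n → ℝ) (y : E' n) : ℝ :=
  (∑ a, ∑ b, (gMet x y)⁻¹ a b * y b * pd a p y) /
    Real.sqrt (∑ a, ∑ b, (gMet x y)⁻¹ a b * y a * y b)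

/-- Coordinate condition `|∂x/∂y|² + |∂y/∂x|² ≤ c₁²`. -/
def coordCond (x : E' n → E' n) (c₁ : ℝ) (y : E' n) : Prop :=
  (∑ i, ∑ a, (jacM x y i a) ^ 2) + (∑ i, ∑ a, ((jacM x y)⁻¹ i a) ^ 2) ≤ c₁ ^ 2

/-- Physical condition `∇_N p ≤ −c₀` on the boundary. -/
def physCond (x : E' n → E' n) (p : E' n → ℝ) (c₀ : ℝ) : Prop :=
  ∀ y ∈ Sphere' n, gradN x p y ≤ -c₀

/-- Material (time) derivative at fixed `y`. -/
def Dt (u : ℝ → E' n → F) : ℝ → E' n → F := fun t y => deriv (fun s => u s y) t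

/-- Iterated time derivative. -/
def Dts (k : ℕ) (u : ℝ → E' n → F) : ℝ → E' n → F := Dt^[k] u

/-- Joint space-time smoothness. -/
def SmoothST (u : ℝ → E' n → F) : Prop :=
  ContDiff ℝ (⊤ : ℕ∞) fun p : ℝ × E' n => u p.1 p.2

/-- `L²` Sobolev norm of order `r` on the unit ball. -/
def sobNorm (r : ℕ) (u : E' n → F) : ℝ :=
  ∑ j ∈ Finset.range (r + 1), (∫ y in Ball n, ‖iteratedFDeriv ℝ j u y‖ ^ 2) ^ ((1:ℝ)/2)

/-- `C^k` supremum norm on the unit ball. -/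
def ckNorm (k : ℕ) (u : E' n → F) : ℝ :=
  ∑ j ∈ Finset.range (k + 1), ⨆ y ∈ Ball n, ‖iteratedFDeriv ℝ j u y‖

/-- Hölder norm of order `a` on the set `s`. -/
def holderNormOn (s : Set (E' n)) (a : ℝ) (u : E' n → F) : ℝ :=
  if a ≤ 0 then ⨆ y ∈ s, ‖u y‖
  else
    (⨆ z ∈ s, ⨆ w ∈ s,
        ‖iteratedFDeriv ℝ (⌈a⌉₊ - 1) u z - iteratedFDeriv ℝ (⌈a⌉₊ - 1) u w‖ /
          ‖z - w‖ ^ (a - ((⌈a⌉₊ : ℝ) - 1))) +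
      ⨆ y ∈ s, ‖u y‖

/-- Hölder norm of order `a` on the unit ball. -/
def holderNorm (a : ℝ) (u : E' n → F) : ℝ := holderNormOn (Ball n) a u

/-- Space-time norm `|||u|||_{a,k}`. -/
def stNorm (T : ℝ) (a : ℝ) (k : ℕ) (u : ℝ → E' n → F) : ℝ :=
  ⨆ t ∈ Icc (0:ℝ) T, ∑ j ∈ Finset.range (k + 1), holderNorm a fun y => Dts j u t y

/-- The defining property of the pressure `p = Ψ(x)`:
`Δp = −(∂_i V^k)(∂_k V^i)` in `Ω`, `p = 0` on `∂Ω`. -/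
def IsPressure (x v : E' n → E' n) (p : E' n → ℝ) : Prop :=
  ContDiff ℝ (⊤ : ℕ∞) p ∧ (∀ y ∈ Sphere' n, p y = 0) ∧
    ∀ y ∈ Ball n,
      lapl x p y = -∑ i, ∑ k, epd x i (fun z => v z k) y * epd x k (fun z => v z i) y

/-- The pressure, selected by choice. -/
def pressureFn (x v : E' n → E' n) : E' n → ℝ := Classical.epsilon (IsPressure x v)

/-- The Euler map `Φ(x)_i = D_t² x_i + ∂_i p`. -/
def eulerMap (x : ℝ → E' n → E' n) : ℝ → E' n → Fin n → ℝ := fun t y i =>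
  Dts 2 x t y i + epd (x t) i (pressureFn (x t) (Dt x t)) y

/-- First variational derivative `Φ'(x)δx`. -/
def eulerMap' (x δx : ℝ → E' n → E' n) : ℝ → E' n → Fin n → ℝ := fun t y i =>
  deriv (fun r : ℝ => eulerMap (fun s z => x s z + r • δx s z) t y i) 0

/-- Second variational derivative `Φ''(x)(δx, εx)`. -/
def eulerMap'' (x δx εx : ℝ → E' n → E' n) : ℝ → E' n → Fin n → ℝ := fun t y i =>
  deriv (fun r : ℝ =>
    deriv (fun s : ℝ => eulerMap (fun τ z => x τ z + r • δx τ z + s • εx τ z) t y i) 0) 0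

/-- Modified linearized operator `L₁ δx = Φ'(x)δx − δx^k ∂_k Φ^i + δx^i div Φ`. -/
def modLin (x δx : ℝ → E' n → E' n) : ℝ → E' n → Fin n → ℝ := fun t y i =>
  eulerMap' x δx t y i
    - (∑ k, δx t y k * epd (x t) k (fun z => eulerMap x t z i) y)
    + δx t y i * ∑ k, epd (x t) k (fun z => eulerMap x t z k) y

section TameCalculus

open scoped ContDiff Topology

lemma ball_subset_unitBall : Metric.ball (0 : E' n) 1 ⊆ Ball n := Metric.ball_subset_closedBall

lemma isCompact_unitBall : IsCompact (Ball n) := isCompact_closedBall 0 1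

lemma zero_mem_unitBall : (0 : E' n) ∈ Ball n := by simp [Ball]

lemma bddAbove_range_biSup {G : E' n → ℝ} {c : ℝ} (h : ∀ y ∈ Ball n, G y ≤ c) :
    BddAbove (range fun y => ⨆ _ : y ∈ Ball n, G y) := by
  refine ⟨max c 0, ?_⟩
  rintro _ ⟨y, rfl⟩
  by_cases hy : y ∈ Ball n
  · simp only [hy, ciSup_unique]
    exact le_max_of_le_left (h y hy)
  · simp [hy]

lemma le_biSup_unitBall {G : E' n → ℝ} (hG : ContinuousOn G (Ball n)) {y : E' n} (hy : y ∈ Ball n) :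
    G y ≤ ⨆ y ∈ Ball n, G y := by
  obtain ⟨c, hc⟩ := isCompact_unitBall.bddAbove_image hG
  have h := le_ciSup (bddAbove_range_biSup (G := G) (c := c)
    fun y hy => hc (mem_image_of_mem _ hy)) y
  simpa only [hy, ciSup_unique] using h

lemma biSup_unitBall_le {G : E' n → ℝ} {c : ℝ} (hc : 0 ≤ c) (h : ∀ y ∈ Ball n, G y ≤ c) :
    ⨆ y ∈ Ball n, G y ≤ c := by
  refine ciSup_le fun y => ?_
  by_cases hy : y ∈ Ball n
  · simpa only [hy, ciSup_unique] using h y hy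
  · simpa [hy] using hc

/-- Smoothness on a neighbourhood of the closed unit ball. -/
def SmoothNear (u : E' n → F) : Prop := ∀ y ∈ Ball n, ContDiffAt ℝ ∞ u y

lemma ContDiff.smoothNear {u : E' n → F} (hu : ContDiff ℝ ∞ u) : SmoothNear u :=
  fun _ _ => hu.contDiffAt

lemma SmoothNear.continuousOn_norm_iteratedFDeriv {u : E' n → F} (hu : SmoothNear u) (j : ℕ) :
    ContinuousOn (fun y => ‖iteratedFDeriv ℝ j u y‖) (Ball n) := fun y hy =>
  (((hu y hy).iteratedFDeriv_right (m := 0) (i := j) (by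
    simp; exact_mod_cast le_top)).continuousAt.norm).continuousWithinAt

lemma SmoothNear.norm_iteratedFDeriv_le {u : E' n → F} (hu : SmoothNear u) {j k : ℕ} (hjk : j ≤ k)
    {y : E' n} (hy : y ∈ Ball n) : ‖iteratedFDeriv ℝ j u y‖ ≤ ckNorm k u := by
  refine (le_biSup_unitBall (hu.continuousOn_norm_iteratedFDeriv j) hy).trans ?_
  unfold ckNorm
  refine Finset.single_le_sum (f := fun j => ⨆ y ∈ Ball n, ‖iteratedFDeriv ℝ j u y‖)
    (fun i _ => ?_) (by simpa using Nat.lt_succ_of_le hjk)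
  exact Real.iSup_nonneg fun y => Real.iSup_nonneg fun _ => norm_nonneg _

lemma ckNorm_nonneg (k : ℕ) (u : E' n → F) : 0 ≤ ckNorm k u :=
  Finset.sum_nonneg fun _ _ => Real.iSup_nonneg fun _ => Real.iSup_nonneg fun _ => norm_nonneg _

lemma ckNorm_mono {j k : ℕ} (hjk : j ≤ k) (u : E' n → F) : ckNorm j u ≤ ckNorm k u :=
  Finset.sum_le_sum_of_subset_of_nonneg (Finset.range_mono (by lia))
    fun _ _ _ => Real.iSup_nonneg fun _ => Real.iSup_nonneg fun _ => norm_nonneg _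

lemma ckNorm_le_of_forall {k : ℕ} {u : E' n → F} {c : ℝ} (hc : 0 ≤ c)
    (h : ∀ j ≤ k, ∀ y ∈ Ball n, ‖iteratedFDeriv ℝ j u y‖ ≤ c) : ckNorm k u ≤ (k + 1) * c := by
  unfold ckNorm
  calc _ ≤ ∑ j ∈ Finset.range (k + 1), c := Finset.sum_le_sum fun j hj =>
        biSup_unitBall_le hc (h j (by simpa [Nat.lt_succ_iff] using hj))
    _ = _ := by simp

lemma ckNorm_zero_le {u : E' n → F} {c : ℝ} (hc : 0 ≤ c) (h : ∀ y ∈ Ball n, ‖u y‖ ≤ c) :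
    ckNorm 0 u ≤ c := by
  simpa using ckNorm_le_of_forall (k := 0) (u := u) hc (by simpa using h)

lemma SmoothNear.norm_le {u : E' n → F} (hu : SmoothNear u) {y : E' n} (hy : y ∈ Ball n) :
    ‖u y‖ ≤ ckNorm 0 u := by
  simpa using hu.norm_iteratedFDeriv_le (le_refl 0) hy

lemma SmoothNear.abs_le_ckNorm {u : E' n → ℝ} (hu : SmoothNear u) (k : ℕ) {y : E' n} (hy : y ∈ Ball n) :
    |u y| ≤ ckNorm k u :=
  (hu.norm_le hy).trans (ckNorm_mono (Nat.zero_le k) u)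

lemma ckNorm_congr {u v : E' n → F} (h : ∀ y ∈ Ball n, u =ᶠ[𝓝 y] v) (k : ℕ) :
    ckNorm k u = ckNorm k v := by
  unfold ckNorm
  refine Finset.sum_congr rfl fun j _ => ?_
  congr 1; ext y; congr 1; ext hy
  rw [((h y hy).iteratedFDeriv ℝ j).eq_of_nhds]

lemma SmoothNear.congr {u v : E' n → F} (hu : SmoothNear u) (h : ∀ y ∈ Ball n, u =ᶠ[𝓝 y] v) :
    SmoothNear v := fun y hy => (hu y hy).congr_of_eventuallyEq (h y hy).symm

lemma ContDiffAt.pderiv {u : E' n → ℝ} {y : E' n} (hu : ContDiffAt ℝ ∞ u y) (a : Fin n) :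
    ContDiffAt ℝ ∞ (pd a u) y :=
  (hu.fderiv_right (m := ∞) (by simp)).clm_apply contDiffAt_const

lemma SmoothNear.pderiv {u : E' n → ℝ} (hu : SmoothNear u) (a : Fin n) :
    SmoothNear (pd a u) := fun y hy => (hu y hy).pderiv a

lemma SmoothNear.add {u v : E' n → ℝ} (hu : SmoothNear u) (hv : SmoothNear v) :
    SmoothNear fun y => u y + v y := fun y hy => (hu y hy).add (hv y hy)

lemma SmoothNear.mul {u v : E' n → ℝ} (hu : SmoothNear u) (hv : SmoothNear v) :
    SmoothNear fun y => u y * v y := fun y hy => (hu y hy).mul (hv y hy)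

lemma smoothNear_const (c : ℝ) : SmoothNear fun _ : E' n => c := fun _ _ => contDiffAt_const

lemma SmoothNear.sum {ι : Type*} {s : Finset ι} {u : ι → E' n → ℝ}
    (hu : ∀ i ∈ s, SmoothNear (u i)) : SmoothNear fun y => ∑ i ∈ s, u i y :=
  fun y hy => ContDiffAt.sum fun i hi => hu i hi y hy

lemma fderiv_eq_sum_pd (u : E' n → ℝ) (y : E' n) :
    fderiv ℝ u y = ∑ a, pd a u y • (EuclideanSpace.proj a : E' n →L[ℝ] ℝ) := by
  ext w
  have hw : w = ∑ a, w a • EuclideanSpace.single a (1 : ℝ) := by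
    ext i; simp [Finset.sum_apply, Pi.single_apply]
  conv_lhs => rw [hw]
  simp [pd, mul_comm]

lemma fderiv_apply_eq_sum_pd (u : E' n → ℝ) (y w : E' n) :
    fderiv ℝ u y w = ∑ a, w a * pd a u y := by
  rw [fderiv_eq_sum_pd]; simp [mul_comm]

lemma norm_proj_le_one (a : Fin n) : ‖(EuclideanSpace.proj a : E' n →L[ℝ] ℝ)‖ ≤ 1 :=
  ContinuousLinearMap.opNorm_le_bound _ zero_le_one fun w => by
    simpa using EuclideanSpace.norm_eq w ▸ Real.le_sqrt_of_sq_le (by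
      simpa using Finset.single_le_sum (f := fun i => ‖w i‖ ^ 2) (fun i _ => sq_nonneg _)
        (Finset.mem_univ a))

lemma ContDiffAt.norm_iteratedFDeriv_pd_le {u : E' n → ℝ} {y : E' n} (hu : ContDiffAt ℝ ∞ u y)
    (a : Fin n) (j : ℕ) :
    ‖iteratedFDeriv ℝ j (pd a u) y‖ ≤ ‖iteratedFDeriv ℝ (j + 1) u y‖ := by
  rw [← norm_iteratedFDeriv_fderiv]
  have h := (ContinuousLinearMap.apply ℝ ℝ
    (EuclideanSpace.single a (1 : ℝ) : E' n)).norm_iteratedFDeriv_comp_left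
    (f := fderiv ℝ u) (x := y) (N := ∞) (n := j) (hu.fderiv_right (by simp)) (by exact_mod_cast le_top)
  refine (show _ ≤ _ from h).trans (mul_le_of_le_one_left (norm_nonneg _) ?_)
  refine ContinuousLinearMap.opNorm_le_bound _ zero_le_one fun L => ?_
  simpa using L.le_opNorm (EuclideanSpace.single a (1 : ℝ))

lemma ContDiffAt.norm_iteratedFDeriv_succ_le {u : E' n → ℝ} {y : E' n} (hu : ContDiffAt ℝ ∞ u y)
    (j : ℕ) :
    ‖iteratedFDeriv ℝ (j + 1) u y‖ ≤ ∑ a, ‖iteratedFDeriv ℝ j (pd a u) y‖ := by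
  rw [← norm_iteratedFDeriv_fderiv]
  have h1 : fderiv ℝ u = fun z => ∑ a, (ContinuousLinearMap.toSpanSingleton ℝ
      (EuclideanSpace.proj a : E' n →L[ℝ] ℝ)) (pd a u z) := by
    ext1 z; simpa using fderiv_eq_sum_pd u z
  have hc : ∀ a, ContDiffAt ℝ j (fun z => (ContinuousLinearMap.toSpanSingleton ℝ
      (EuclideanSpace.proj a : E' n →L[ℝ] ℝ)) (pd a u z)) y := fun a =>
    ((ContinuousLinearMap.contDiff _).contDiffAt.comp y (hu.pderiv a)).of_le (by exact_mod_cast le_top)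
  rw [h1, iteratedFDeriv_fun_sum_apply fun a _ => hc a]
  refine (norm_sum_le _ _).trans (Finset.sum_le_sum fun a _ => ?_)
  have h := (ContinuousLinearMap.toSpanSingleton ℝ
      (EuclideanSpace.proj a : E' n →L[ℝ] ℝ)).norm_iteratedFDeriv_comp_left
    (f := pd a u) (x := y) (N := ∞) (n := j) (hu.pderiv a) (by exact_mod_cast le_top)
  refine (show _ ≤ _ from h).trans (mul_le_of_le_one_left (norm_nonneg _) ?_)
  simpa using norm_proj_le_one a

lemma SmoothNear.ckNorm_pd_le {u : E' n → ℝ} (hu : SmoothNear u) (a : Fin n) (k : ℕ) :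
    ckNorm k (pd a u) ≤ ckNorm (k + 1) u := by
  unfold ckNorm
  rw [Finset.sum_range_succ' _ (k + 1)]
  refine le_add_of_le_of_nonneg (Finset.sum_le_sum fun j _ => ?_)
    (Real.iSup_nonneg fun _ => Real.iSup_nonneg fun _ => norm_nonneg _)
  refine biSup_unitBall_le (Real.iSup_nonneg fun _ => Real.iSup_nonneg fun _ => norm_nonneg _)
    fun y hy => ?_
  exact ((hu y hy).norm_iteratedFDeriv_pd_le a j).trans
    (le_biSup_unitBall (hu.continuousOn_norm_iteratedFDeriv (j + 1)) hy)

lemma SmoothNear.ckNorm_succ_le {u : E' n → ℝ} (hu : SmoothNear u) (k : ℕ) :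
    ckNorm (k + 1) u ≤ ckNorm 0 u + ∑ a, ckNorm k (pd a u) := by
  unfold ckNorm
  rw [Finset.sum_range_succ' _ (k + 1), add_comm, Finset.sum_comm]
  refine add_le_add (by simp) (Finset.sum_le_sum fun j _ => ?_)
  refine biSup_unitBall_le (Finset.sum_nonneg fun _ _ =>
    Real.iSup_nonneg fun _ => Real.iSup_nonneg fun _ => norm_nonneg _)
    fun y hy => ?_
  refine ((hu y hy).norm_iteratedFDeriv_succ_le j).trans (Finset.sum_le_sum fun a _ => ?_)
  exact le_biSup_unitBall ((hu.pderiv a).continuousOn_norm_iteratedFDeriv j) hy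

lemma ContDiffAt.norm_iteratedFDeriv_mul_le {u v : E' n → ℝ} {y : E' n} (hu : ContDiffAt ℝ ∞ u y)
    (hv : ContDiffAt ℝ ∞ v y) (k : ℕ) :
    ‖iteratedFDeriv ℝ k (fun y => u y * v y) y‖ ≤ ∑ i ∈ Finset.range (k + 1),
      (k.choose i : ℝ) * ‖iteratedFDeriv ℝ i u y‖ * ‖iteratedFDeriv ℝ (k - i) v y‖ := by
  obtain ⟨s, hs, hsu⟩ := (hu.of_le (m := k) (by exact_mod_cast le_top)).contDiffOn (m := k) le_rfl (by simp)
  obtain ⟨t, ht, htv⟩ := (hv.of_le (m := k) (by exact_mod_cast le_top)).contDiffOn (m := k) le_rfl (by simp)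
  obtain ⟨w, hw, hwo, hyw⟩ := mem_nhds_iff.1 (Filter.inter_mem hs ht)
  have h := norm_iteratedFDerivWithin_mul_le (𝕜 := ℝ) (N := k) (n := k)
    (hsu.mono (hw.trans inter_subset_left)) (htv.mono (hw.trans inter_subset_right))
    hwo.uniqueDiffOn hyw le_rfl
  simpa only [iteratedFDerivWithin_of_isOpen _ hwo hyw] using h

lemma SmoothNear.ckNorm_mul_le {u v : E' n → ℝ} (hu : SmoothNear u) (hv : SmoothNear v) (k : ℕ) :
    ckNorm k (fun y => u y * v y) ≤ (k + 1) * 2 ^ k *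
      ∑ p ∈ Finset.HasAntidiagonal.antidiagonal k, ckNorm p.1 u * ckNorm p.2 v := by
  have hpos : ∀ p : ℕ × ℕ, 0 ≤ ckNorm p.1 u * ckNorm p.2 v := fun p =>
    mul_nonneg (ckNorm_nonneg _ _) (ckNorm_nonneg _ _)
  rw [mul_assoc]
  refine ckNorm_le_of_forall (mul_nonneg (by positivity) (Finset.sum_nonneg fun p _ => hpos p))
    fun j hj y hy => ?_
  refine ((hu y hy).norm_iteratedFDeriv_mul_le (hv y hy) j).trans ?_
  rw [Finset.mul_sum, Finset.Nat.sum_antidiagonal_eq_sum_range_succ_mk]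
  refine (Finset.sum_le_sum (g := fun i => 2 ^ k * (ckNorm i u * ckNorm (k - i) v))
    fun i hi => ?_).trans
    (Finset.sum_le_sum_of_subset_of_nonneg (Finset.range_mono (by lia)) fun i _ _ =>
      mul_nonneg (by positivity) (hpos (i, k - i)))
  rw [mul_assoc]
  refine mul_le_mul ?_ (mul_le_mul (hu.norm_iteratedFDeriv_le le_rfl hy)
    (hv.norm_iteratedFDeriv_le (by lia) hy) (norm_nonneg _) (ckNorm_nonneg _ _))
    (mul_nonneg (norm_nonneg _) (norm_nonneg _)) (by positivity)
  calc (j.choose i : ℝ) ≤ 2 ^ j := by exact_mod_cast Nat.choose_le_two_pow j i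
    _ ≤ 2 ^ k := pow_le_pow_right₀ one_le_two hj

lemma SmoothNear.ckNorm_add_le {u v : E' n → ℝ} (hu : SmoothNear u) (hv : SmoothNear v) (k : ℕ) :
    ckNorm k (fun y => u y + v y) ≤ ckNorm k u + ckNorm k v := by
  unfold ckNorm
  rw [← Finset.sum_add_distrib]
  refine Finset.sum_le_sum fun j _ => ?_
  refine biSup_unitBall_le (add_nonneg (Real.iSup_nonneg fun _ => Real.iSup_nonneg fun _ =>
    norm_nonneg _) (Real.iSup_nonneg fun _ => Real.iSup_nonneg fun _ => norm_nonneg _))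
    fun y hy => ?_
  have h := iteratedFDeriv_add_apply (i := j) ((hu y hy).of_le (m := j) (by exact_mod_cast le_top))
    ((hv y hy).of_le (m := j) (by exact_mod_cast le_top))
  rw [show (fun y => u y + v y) = u + v from rfl, h]
  exact (norm_add_le _ _).trans (add_le_add
    (le_biSup_unitBall (hu.continuousOn_norm_iteratedFDeriv j) hy)
    (le_biSup_unitBall (hv.continuousOn_norm_iteratedFDeriv j) hy))

end TameCalculus

section Interpolation

open scoped ContDiff Topology

lemma convex_unitBall : Convex ℝ (Ball n) := convex_closedBall 0 1

lemma SmoothNear.norm_fderiv_sub_le {u : E' n → F} (hu : SmoothNear u) {y w : E' n}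
    (hy : y ∈ Ball n) (hw : w ∈ Ball n) :
    ‖fderiv ℝ u w - fderiv ℝ u y‖ ≤ ckNorm 2 u * ‖w - y‖ := by
  refine convex_unitBall.norm_image_sub_le_of_norm_fderiv_le (𝕜 := ℝ) (fun z hz => ?_)
    (fun z hz => ?_) hy hw
  · exact ((hu z hz).fderiv_right (m := ∞) (by simp)).differentiableAt (by simp)
  · rw [← norm_iteratedFDeriv_zero (𝕜 := ℝ) (f := fderiv ℝ (fderiv ℝ u)),
      norm_iteratedFDeriv_fderiv, norm_iteratedFDeriv_fderiv]
    exact hu.norm_iteratedFDeriv_le (by norm_num) hz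

lemma SmoothNear.norm_taylor_le {u : E' n → F} (hu : SmoothNear u) {y w : E' n}
    (hy : y ∈ Ball n) (hw : w ∈ Ball n) :
    ‖u w - u y - fderiv ℝ u y (w - y)‖ ≤ ckNorm 2 u * ‖w - y‖ ^ 2 := by
  have hs : Convex ℝ (Ball n ∩ Metric.closedBall y ‖w - y‖) :=
    convex_unitBall.inter (convex_closedBall _ _)
  have h := hs.norm_image_sub_le_of_norm_hasFDerivWithin_le' (𝕜 := ℝ) (f := u)
    (f' := fderiv ℝ u) (φ := fderiv ℝ u y) (C := ckNorm 2 u * ‖w - y‖) (x := y) (y := w)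
    (fun z hz => (((hu z hz.1).differentiableAt (by simp)).hasFDerivAt).hasFDerivWithinAt)
    (fun z hz => (hu.norm_fderiv_sub_le hy hz.1).trans
      (mul_le_mul_of_nonneg_left (by simpa [dist_eq_norm] using hz.2) (ckNorm_nonneg _ _)))
    ⟨hy, by simp⟩ ⟨hw, by simp [dist_eq_norm]⟩
  linarith [h]

lemma single_mem_unitBall (a : Fin n) {c : ℝ} (hc : |c| ≤ 1) :
    (EuclideanSpace.single a c : E' n) ∈ Ball n := by
  simpa [Ball] using hc

lemma SmoothNear.abs_pd_le {u : E' n → ℝ} (hu : SmoothNear u) (a : Fin n) {y : E' n}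
    (hy : y ∈ Ball n) {h : ℝ} (h0 : 0 < h) (h1 : h ≤ 1) :
    |pd a u y| ≤ 2 * ckNorm 0 u / h + 4 * h * ckNorm 2 u := by
  have key : ∀ z ∈ Ball n, |fderiv ℝ u y (z - y)| ≤ 2 * ckNorm 0 u / h + 4 * h * ckNorm 2 u := by
    intro z hz
    have hw : y + h • (z - y) ∈ Ball n :=
      convex_unitBall.add_smul_sub_mem hy hz ⟨h0.le, h1⟩
    have ht := hu.norm_taylor_le hy hw
    have hd : ‖z - y‖ ≤ 2 := by
      have h1 : ‖z‖ ≤ 1 := by simpa [Ball] using hz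
      have h2 : ‖y‖ ≤ 1 := by simpa [Ball] using hy
      linarith [norm_sub_le z y]
    simp only [add_sub_cancel_left, map_smul, norm_smul, Real.norm_eq_abs, abs_of_pos h0,
      smul_eq_mul] at ht
    have hd2 : (h * ‖z - y‖) ^ 2 ≤ 4 * h ^ 2 := by
      have : h * ‖z - y‖ ≤ h * 2 := by gcongr
      have h0' : 0 ≤ h * ‖z - y‖ := by positivity
      nlinarith
    have ha := hu.abs_le_ckNorm 0 hw
    have hb := hu.abs_le_ckNorm 0 hy
    have hc : ckNorm 2 u * (h * ‖z - y‖) ^ 2 ≤ ckNorm 2 u * (4 * h ^ 2) :=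
      mul_le_mul_of_nonneg_left hd2 (ckNorm_nonneg _ _)
    have hmain : |h * fderiv ℝ u y (z - y)| ≤ 2 * ckNorm 0 u + ckNorm 2 u * (4 * h ^ 2) := by
      have ht := abs_le.1 ht
      have ha := abs_le.1 ha
      have hb := abs_le.1 hb
      exact abs_le.2 ⟨by linarith [ht.2, ha.1, hb.2], by linarith [ht.1, ha.2, hb.1]⟩
    rw [abs_mul, abs_of_pos h0] at hmain
    have : h * |fderiv ℝ u y (z - y)| ≤ h * (2 * ckNorm 0 u / h + 4 * h * ckNorm 2 u) := by
      refine hmain.trans (le_of_eq ?_)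
      field_simp
    exact le_of_mul_le_mul_left this h0
  have hp := key _ (single_mem_unitBall a (c := 1) (by simp))
  have hm := key _ (single_mem_unitBall a (c := -1) (by simp))
  have hs : (EuclideanSpace.single a (-1) : E' n) = -EuclideanSpace.single a 1 := by
    ext i; by_cases h : i = a <;> simp [h]
  rw [hs] at hm
  simp only [map_sub, map_neg] at hp hm
  change |fderiv ℝ u y (EuclideanSpace.single a 1)| ≤ _
  have hp := abs_le.1 hp
  have hm := abs_le.1 hm
  exact abs_le.2 ⟨by linarith [hp.1, hm.2], by linarith [hp.2, hm.1]⟩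

lemma sq_le_of_forall_interp {a b p : ℝ} (hab : a ≤ b) (ha : 0 ≤ a) (hp : 0 ≤ p)
    (h : ∀ t, 0 < t → t ≤ 1 → p ≤ 2 * a / t + 4 * t * b) : p ^ 2 ≤ 36 * (a * b) := by
  rcases hp.eq_or_lt with rfl | hp
  · have := mul_nonneg ha (ha.trans hab); simpa using this
  have h1 := h 1 one_pos le_rfl
  have hb : 0 < b := by linarith
  have h2 := h (p / (6 * b)) (by positivity) (by rw [div_le_one (by positivity)]; linarith)
  have e1 : 2 * a / (p / (6 * b)) = 12 * (a * b) / p := by field_simp; ring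
  have e2 : 4 * (p / (6 * b)) * b = 2 / 3 * p := by field_simp; ring
  rw [e1, e2] at h2
  have h3 : p / 3 ≤ 12 * (a * b) / p := by linarith
  rw [le_div_iff₀ hp] at h3
  nlinarith

lemma exists_ckNorm_succ_le_sqrt (n k : ℕ) : ∃ C, 0 ≤ C ∧ ∀ u : E' n → ℝ, SmoothNear u →
    ckNorm (k + 1) u ≤ C * √(ckNorm k u * ckNorm (k + 2) u) := by
  induction k with
  | zero =>
    refine ⟨1 + n * 6, by positivity, fun u hu => ?_⟩
    set s := √(ckNorm 0 u * ckNorm 2 u)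
    have h02 : ckNorm 0 u ≤ ckNorm 2 u := ckNorm_mono (by norm_num) u
    have h0 : ckNorm 0 u ≤ s := Real.le_sqrt_of_sq_le (by
      nlinarith [ckNorm_nonneg 0 u])
    have h1 : ∀ a, ckNorm 0 (pd a u) ≤ 6 * s := fun a => by
      refine ckNorm_zero_le (by positivity) fun y hy => ?_
      have h := sq_le_of_forall_interp h02 (ckNorm_nonneg 0 u) (abs_nonneg (pd a u y))
        fun t ht ht1 => hu.abs_pd_le a hy ht ht1
      rw [Real.norm_eq_abs]
      refine (sq_le_sq₀ (abs_nonneg _) (by positivity)).1 ?_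
      rw [mul_pow, Real.sq_sqrt (mul_nonneg (ckNorm_nonneg _ _) (ckNorm_nonneg _ _))]
      linarith
    calc ckNorm 1 u ≤ ckNorm 0 u + ∑ a, ckNorm 0 (pd a u) := hu.ckNorm_succ_le 0
      _ ≤ s + ∑ _a : Fin n, 6 * s := add_le_add h0 (Finset.sum_le_sum fun a _ => h1 a)
      _ = _ := by simp; ring
  | succ k ih =>
    obtain ⟨C, hC, h⟩ := ih
    refine ⟨1 + n * C, by positivity, fun u hu => ?_⟩
    set s := √(ckNorm (k + 1) u * ckNorm (k + 3) u)
    have h0 : ckNorm 0 u ≤ s := Real.le_sqrt_of_sq_le (by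
      rw [sq]
      exact mul_le_mul (ckNorm_mono (by lia) u) (ckNorm_mono (by lia) u) (ckNorm_nonneg _ _)
        (ckNorm_nonneg _ _))
    have h1 : ∀ a, ckNorm (k + 1) (pd a u) ≤ C * s := fun a => by
      refine (h _ (hu.pderiv a)).trans (mul_le_mul_of_nonneg_left (Real.sqrt_le_sqrt ?_) hC)
      exact mul_le_mul (hu.ckNorm_pd_le a k) (hu.ckNorm_pd_le a (k + 2)) (ckNorm_nonneg _ _)
        (ckNorm_nonneg _ _)
    calc ckNorm (k + 1 + 1) u ≤ ckNorm 0 u + ∑ a, ckNorm (k + 1) (pd a u) := hu.ckNorm_succ_le _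
      _ ≤ s + ∑ _a : Fin n, C * s := add_le_add h0 (Finset.sum_le_sum fun a _ => h1 a)
      _ = _ := by simp; ring

lemma le_max_of_sq_le {c : ℕ → ℝ} (hc : ∀ j, 0 ≤ c j) (m : ℕ)
    (h : ∀ j, j + 2 ≤ m → c (j + 1) ^ 2 ≤ c j * c (j + 2)) (j : ℕ) (hj : j ≤ m) :
    c j ≤ max (c 0) (c m) := by
  induction m generalizing j with
  | zero => simp [Nat.le_zero.1 hj]
  | succ m ih =>
    have ih' := ih fun j hj => h j (by lia)
    rcases hj.eq_or_lt with rfl | hj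
    · exact le_max_right _ _
    have hm : c m ≤ max (c 0) (c (m + 1)) := by
      rcases m with _ | m
      · exact le_max_left _ _
      by_contra! hlt
      obtain ⟨h0, h1⟩ := max_lt_iff.1 hlt
      have h2 := h m le_rfl
      have h3 : c m ≤ c (m + 1) := (ih' m (by lia)).trans (max_le h0.le le_rfl)
      have h4 : c m * c (m + 2) ≤ c (m + 1) * c (m + 2) :=
        mul_le_mul_of_nonneg_right h3 (hc _)
      nlinarith [hc 0, hc (m + 2)]
    exact (ih' j (by lia)).trans (max_le (le_max_left _ _) hm)

/-- A sequence that is logarithmically convex up to the factors `C`. -/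
def LogConvexUpTo (C a : ℕ → ℝ) : Prop := (∀ k, 0 ≤ a k) ∧
  ∀ k, a (k + 1) ^ 2 ≤ C k * (a k * a (k + 2))

lemma exists_interp_mul_le (C D : ℕ → ℝ) (j l : ℕ) : ∃ E, 0 ≤ E ∧ ∀ a b : ℕ → ℝ,
    LogConvexUpTo C a → LogConvexUpTo D b →
    a j * b l ≤ E * (a 0 * b (j + l) + a (j + l) * b 0) := by
  set m := j + l
  set E : ℝ := 1 + ∑ p ∈ Finset.range m, ∑ q ∈ Finset.range m, |C p| * |D q|
  have hE : 1 ≤ E := le_add_of_nonneg_right (by positivity)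
  have hCD : ∀ p < m, ∀ q < m, |C p| * |D q| ≤ E := fun p hp q hq => by
    have h1 := Finset.single_le_sum (f := fun q => |C p| * |D q|) (fun _ _ => by positivity)
      (Finset.mem_range.2 hq)
    have h2 := Finset.single_le_sum (f := fun p => ∑ q ∈ Finset.range m, |C p| * |D q|)
      (fun _ _ => by positivity) (Finset.mem_range.2 hp)
    linarith
  refine ⟨E ^ (m ^ 2), by positivity, fun a b ha hb => ?_⟩
  have hE0 : 0 < E := by linarith
  set c : ℕ → ℝ := fun i => E ^ (i ^ 2) * (a i * b (m - i)) with hcdef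
  have hc : ∀ i, 0 ≤ c i := fun i => mul_nonneg (by positivity) (mul_nonneg (ha.1 _) (hb.1 _))
  have hconv : ∀ i, i + 2 ≤ m → c (i + 1) ^ 2 ≤ c i * c (i + 2) := by
    intro i hi
    obtain ⟨t, ht⟩ := Nat.exists_eq_add_of_le hi
    have e0 : m - i = t + 2 := by lia
    have e1 : m - (i + 1) = t + 1 := by lia
    have e2 : m - (i + 2) = t := by lia
    simp only [hcdef, e0, e1, e2]
    have h1 := ha.2 i
    have h2 := hb.2 t
    have hP : 0 ≤ a i * a (i + 2) := mul_nonneg (ha.1 _) (ha.1 _)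
    have hQ : 0 ≤ b t * b (t + 2) := mul_nonneg (hb.1 _) (hb.1 _)
    have h1' : a (i + 1) ^ 2 ≤ |C i| * (a i * a (i + 2)) :=
      h1.trans (mul_le_mul_of_nonneg_right (le_abs_self _) hP)
    have h2' : b (t + 1) ^ 2 ≤ |D t| * (b t * b (t + 2)) :=
      h2.trans (mul_le_mul_of_nonneg_right (le_abs_self _) hQ)
    have h3 : a (i + 1) ^ 2 * b (t + 1) ^ 2 ≤
        E * ((a i * a (i + 2)) * (b t * b (t + 2))) := by
      calc _ ≤ (|C i| * (a i * a (i + 2))) * (|D t| * (b t * b (t + 2))) :=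
            mul_le_mul h1' h2' (sq_nonneg _) (by positivity)
        _ = (|C i| * |D t|) * ((a i * a (i + 2)) * (b t * b (t + 2))) := by ring
        _ ≤ _ := mul_le_mul_of_nonneg_right (hCD i (by lia) t (by lia)) (mul_nonneg hP hQ)
    have h4 : E * ((a i * a (i + 2)) * (b t * b (t + 2))) ≤
        E ^ 2 * ((a i * a (i + 2)) * (b t * b (t + 2))) :=
      mul_le_mul_of_nonneg_right (by nlinarith) (mul_nonneg hP hQ)
    calc (E ^ ((i + 1) ^ 2) * (a (i + 1) * b (t + 1))) ^ 2
        = (E ^ ((i + 1) ^ 2)) ^ 2 * (a (i + 1) ^ 2 * b (t + 1) ^ 2) := by ring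
      _ ≤ (E ^ ((i + 1) ^ 2)) ^ 2 * (E ^ 2 * ((a i * a (i + 2)) * (b t * b (t + 2)))) :=
          mul_le_mul_of_nonneg_left (h3.trans h4) (by positivity)
      _ = E ^ (i ^ 2) * (a i * b (t + 2)) * (E ^ ((i + 2) ^ 2) * (a (i + 2) * b t)) := by ring
  have hmax := le_max_of_sq_le hc m hconv j (Nat.le_add_right _ _)
  have h0 : c 0 ≤ E ^ (m ^ 2) * (a 0 * b m) := by
    simp only [hcdef, Nat.sub_zero]
    exact mul_le_mul_of_nonneg_right (pow_le_pow_right₀ hE (by simp))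
      (mul_nonneg (ha.1 _) (hb.1 _))
  have hm : c m = E ^ (m ^ 2) * (a m * b 0) := by simp [hcdef]
  have hj : a j * b l ≤ c j := by
    have : m - j = l := by lia
    simp only [hcdef, this]
    exact le_mul_of_one_le_left (mul_nonneg (ha.1 _) (hb.1 _)) (one_le_pow₀ hE)
  calc a j * b l ≤ max (c 0) (c m) := hj.trans hmax
    _ ≤ c 0 + c m := max_le_add_of_nonneg (hc _) (hc _)
    _ ≤ _ := by rw [hm]; linarith

end Interpolation

section TameFamilies

open scoped ContDiff Topology

lemma pd_congr {u v : E' n → ℝ} {y : E' n} (h : u =ᶠ[𝓝 y] v) (a : Fin n) : pd a u y = pd a v y := by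
  rw [pd, pd, h.fderiv_eq]

lemma pd_add {u v : E' n → ℝ} {y : E' n} (hu : DifferentiableAt ℝ u y) (hv : DifferentiableAt ℝ v y)
    (a : Fin n) : pd a (fun z => u z + v z) y = pd a u y + pd a v y := by
  simp [pd, fderiv_fun_add hu hv]

lemma pd_mul {u v : E' n → ℝ} {y : E' n} (hu : DifferentiableAt ℝ u y) (hv : DifferentiableAt ℝ v y)
    (a : Fin n) : pd a (fun z => u z * v z) y = pd a u y * v y + u y * pd a v y := by
  simp [pd, fderiv_fun_mul hu hv]; ring

lemma pd_sum {ι : Type*} {s : Finset ι} {u : ι → E' n → ℝ} {y : E' n}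
    (hu : ∀ j ∈ s, DifferentiableAt ℝ (u j) y) (a : Fin n) :
    pd a (fun z => ∑ j ∈ s, u j z) y = ∑ j ∈ s, pd a (u j) y := by
  simp [pd, fderiv_fun_sum hu]

lemma pd_const (c : ℝ) (y : E' n) (a : Fin n) : pd a (fun _ => c) y = 0 := by
  simp [pd]

lemma pd_coord (a b : Fin n) (y : E' n) : pd a (fun z => z b) y = if b = a then 1 else 0 := by
  have : HasFDerivAt (fun z : E' n => z b) (EuclideanSpace.proj b : E' n →L[ℝ] ℝ) y :=
    (EuclideanSpace.proj b : E' n →L[ℝ] ℝ).hasFDerivAt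
  simp [pd, this.fderiv]

lemma differentiableAt_coord (b : Fin n) (y : E' n) : DifferentiableAt ℝ (fun z : E' n => z b) y :=
  (EuclideanSpace.proj b : E' n →L[ℝ] ℝ).differentiableAt

lemma smoothNear_coord (b : Fin n) : SmoothNear fun z : E' n => z b :=
  ContDiff.smoothNear (EuclideanSpace.proj b : E' n →L[ℝ] ℝ).contDiff

lemma pd_comm {u : E' n → ℝ} {y : E' n} (hu : ContDiffAt ℝ 2 u y) (a b : Fin n) :
    pd a (pd b u) y = pd b (pd a u) y := by
  have hd : DifferentiableAt ℝ (fderiv ℝ u) y :=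
    (hu.fderiv_right (m := 1) (by norm_num)).differentiableAt (by simp)
  have h : ∀ c d : Fin n, pd c (pd d u) y =
      fderiv ℝ (fderiv ℝ u) y (EuclideanSpace.single c 1) (EuclideanSpace.single d 1) := by
    intro c d
    have : pd c (pd d u) y = fderiv ℝ (fun z => fderiv ℝ u z (EuclideanSpace.single d 1)) y
      (EuclideanSpace.single c 1) := rfl
    rw [this, fderiv_clm_apply hd (differentiableAt_const _)]
    simp
  rw [h, h]
  exact (hu.isSymmSndFDerivAt (by simp)).eq _ _

lemma SmoothNear.eventually_contDiffAt {u : E' n → F} (hu : SmoothNear u) (m : ℕ) {y : E' n}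
    (hy : y ∈ Ball n) : ∀ᶠ z in 𝓝 y, ContDiffAt ℝ m u z :=
  ((hu y hy).of_le (by exact_mod_cast le_top)).eventually (by simp)

lemma SmoothNear.eventually_differentiableAt {u : E' n → F} (hu : SmoothNear u) {y : E' n}
    (hy : y ∈ Ball n) : ∀ᶠ z in 𝓝 y, DifferentiableAt ℝ u z :=
  (hu.eventually_contDiffAt 1 hy).mono fun _ h => h.differentiableAt (by simp)

/-- Two functions agree in a neighbourhood of the closed unit ball. -/
def EqNear (u v : E' n → ℝ) : Prop := ∀ y ∈ Ball n, u =ᶠ[𝓝 y] v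

lemma EqNear.symm {u v : E' n → ℝ} (h : EqNear u v) : EqNear v u := fun y hy => (h y hy).symm

variable {I : Type*}

/-- The functions `h i` are smooth near the closed unit ball and their `C^k` norms, `k ≤ N`, are
bounded by the weights `w i k`, up to constants not depending on `i`. -/
def Tame (N : ℕ∞) (w : I → ℕ → ℝ) (h : I → E' n → ℝ) : Prop :=
  (∀ i, SmoothNear (h i)) ∧
    ∀ k : ℕ, (k : ℕ∞) ≤ N → ∃ C, 0 ≤ C ∧ ∀ i, ckNorm k (h i) ≤ C * w i k

/-- The weight `w` is bounded by the weight `w'`. -/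
def WeightLE (w w' : I → ℕ → ℝ) : Prop := ∀ k, ∃ C, 0 ≤ C ∧ ∀ i, w i k ≤ C * w' i k

/-- Products of functions of weights `w` and `w'` have weight `w''`. -/
def WeightMul (w w' w'' : I → ℕ → ℝ) : Prop :=
  ∀ j l, ∃ C, 0 ≤ C ∧ ∀ i, w i j * w' i l ≤ C * w'' i (j + l)

/-- The weight obtained by raising the order by `m`. -/
def raise (m : ℕ) (w : I → ℕ → ℝ) : I → ℕ → ℝ := fun i k => w i (k + m)

variable {N : ℕ∞} {w w' w'' : I → ℕ → ℝ} {h h' : I → E' n → ℝ}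

lemma WeightLE.of_le (hw : ∀ i k, w i k ≤ w' i k) : WeightLE w w' :=
  fun k => ⟨1, zero_le_one, fun i => by simpa using hw i k⟩

lemma Tame.mono (hh : Tame N w h) (hw : WeightLE w w') : Tame N w' h := by
  refine ⟨hh.1, fun k hk => ?_⟩
  obtain ⟨C, hC, hb⟩ := hh.2 k hk
  obtain ⟨D, hD, hd⟩ := hw k
  exact ⟨C * D, by positivity, fun i => (hb i).trans
    ((mul_le_mul_of_nonneg_left (hd i) hC).trans_eq (mul_assoc _ _ _).symm)⟩

lemma Tame.of_le {N' : ℕ∞} (hh : Tame N w h) (hN : N' ≤ N) : Tame N' w h :=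
  ⟨hh.1, fun k hk => hh.2 k (hk.trans hN)⟩

lemma Tame.congr (hh : Tame N w h) (he : ∀ i, EqNear (h i) (h' i)) : Tame N w h' := by
  refine ⟨fun i => (hh.1 i).congr (he i), fun k hk => ?_⟩
  obtain ⟨C, hC, hb⟩ := hh.2 k hk
  exact ⟨C, hC, fun i => by rw [← ckNorm_congr (he i)]; exact hb i⟩

lemma Tame.add (hh : Tame N w h) (hh' : Tame N w h') : Tame N w fun i y => h i y + h' i y := by
  refine ⟨fun i => (hh.1 i).add (hh'.1 i), fun k hk => ?_⟩
  obtain ⟨C, hC, hb⟩ := hh.2 k hk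
  obtain ⟨D, hD, hd⟩ := hh'.2 k hk
  exact ⟨C + D, by positivity, fun i => ((hh.1 i).ckNorm_add_le (hh'.1 i) k).trans (by
    linarith [hb i, hd i])⟩

lemma Tame.mul (hh : Tame N w h) (hh' : Tame N w' h') (hw : WeightMul w w' w'') :
    Tame N w'' fun i y => h i y * h' i y := by
  refine ⟨fun i => (hh.1 i).mul (hh'.1 i), fun k hk => ?_⟩
  have key : ∀ p ∈ Finset.HasAntidiagonal.antidiagonal k, ∃ C, 0 ≤ C ∧ ∀ i,
      ckNorm p.1 (h i) * ckNorm p.2 (h' i) ≤ C * w'' i k := by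
    intro p hp
    have hp' := Finset.HasAntidiagonal.mem_antidiagonal.1 hp
    obtain ⟨C, hC, hb⟩ := hh.2 p.1 (le_trans (by exact_mod_cast (by lia : p.1 ≤ k)) hk)
    obtain ⟨D, hD, hd⟩ := hh'.2 p.2 (le_trans (by exact_mod_cast (by lia : p.2 ≤ k)) hk)
    obtain ⟨E, hE, he⟩ := hw p.1 p.2
    refine ⟨C * D * E, by positivity, fun i => ?_⟩
    calc _ ≤ (C * w i p.1) * (D * w' i p.2) :=
          mul_le_mul (hb i) (hd i) (ckNorm_nonneg _ _) ((ckNorm_nonneg _ _).trans (hb i))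
      _ = C * D * (w i p.1 * w' i p.2) := by ring
      _ ≤ C * D * (E * w'' i (p.1 + p.2)) := mul_le_mul_of_nonneg_left (he i) (by positivity)
      _ = _ := by rw [hp']; ring
  choose! C hC hb using key
  refine ⟨(k + 1) * 2 ^ k * ∑ p ∈ Finset.HasAntidiagonal.antidiagonal k, C p,
    mul_nonneg (by positivity) (Finset.sum_nonneg hC), fun i => ?_⟩
  refine ((hh.1 i).ckNorm_mul_le (hh'.1 i) k).trans ?_
  rw [mul_assoc _ (Finset.sum _ _), Finset.sum_mul]
  exact mul_le_mul_of_nonneg_left (Finset.sum_le_sum fun p hp => hb p hp i) (by positivity)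

lemma tame_of_forall_ckNorm_le {φ : E' n → ℝ} (hφ : SmoothNear φ) (hw : ∀ i k, 1 ≤ w i k) :
    Tame N w fun _ => φ := by
  refine ⟨fun _ => hφ, fun k _ => ⟨ckNorm k φ, ckNorm_nonneg _ _, fun i => ?_⟩⟩
  exact le_mul_of_one_le_right (ckNorm_nonneg _ _) (hw i k)

lemma Tame.fixed_mul {φ : E' n → ℝ} (hφ : SmoothNear φ) (hh : Tame N w h)
    (hw : ∀ i, Monotone (w i)) : Tame N w fun i y => φ y * h i y := by
  refine Tame.mul (w := fun _ _ => 1) (w' := w) (tame_of_forall_ckNorm_le hφ fun _ _ => le_rfl) hh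
    fun j l => ⟨1, zero_le_one, fun i => ?_⟩
  simpa using hw i (Nat.le_add_left _ _)

lemma Tame.const_mul (c : ℝ) (hh : Tame N w h) (hw : ∀ i, Monotone (w i)) :
    Tame N w fun i y => c * h i y :=
  hh.fixed_mul (smoothNear_const c) hw

lemma Tame.sub (hh : Tame N w h) (hh' : Tame N w h') (hw : ∀ i, Monotone (w i)) :
    Tame N w fun i y => h i y - h' i y := by
  simpa [sub_eq_add_neg] using hh.add (hh'.const_mul (-1) hw)

lemma tame_zero (hw : ∀ i k, 0 ≤ w i k) : Tame N w fun _ (_ : E' n) => 0 := by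
  refine ⟨fun _ => smoothNear_const 0, fun k _ => ⟨1, zero_le_one, fun i => ?_⟩⟩
  refine (ckNorm_le_of_forall (c := 0) le_rfl fun j _ y _ => ?_).trans (by simpa using hw i k)
  simp [iteratedFDeriv_fun_zero]

lemma Tame.sum {ι : Type*} {s : Finset ι} {h : ι → I → E' n → ℝ} (hw : ∀ i k, 0 ≤ w i k)
    (hh : ∀ j ∈ s, Tame N w (h j)) : Tame N w fun i y => ∑ j ∈ s, h j i y := by
  classical
  induction s using Finset.induction_on with
  | empty => simpa using tame_zero hw
  | insert j s hj ih =>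
    simp only [Finset.sum_insert hj]
    exact (hh j (by simp)).add (ih fun j' hj' => hh j' (by simp [hj']))

lemma Tame.pderiv (hh : Tame ⊤ w h) (a : Fin n) : Tame ⊤ (raise 1 w) fun i => pd a (h i) := by
  refine ⟨fun i => (hh.1 i).pderiv a, fun k _ => ?_⟩
  obtain ⟨C, hC, hb⟩ := hh.2 (k + 1) le_top
  exact ⟨C, hC, fun i => ((hh.1 i).ckNorm_pd_le a k).trans (hb i)⟩

lemma tame_of_forall_nat (hh : ∀ r : ℕ, Tame r w h) : Tame ⊤ w h :=
  ⟨(hh 0).1, fun k _ => (hh k).2 k le_rfl⟩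

lemma Tame.succ_of_pderiv {r : ℕ} (hw : ∀ i, Monotone (w i)) (hh : Tame 0 w h)
    (hd : ∀ a, Tame r (raise 1 w) fun i => pd a (h i)) : Tame (r + 1 : ℕ) w h := by
  refine ⟨hh.1, fun k hk => ?_⟩
  have hk : k ≤ r + 1 := by exact_mod_cast hk
  obtain ⟨C, hC, hb⟩ := hh.2 0 le_rfl
  rcases k with _ | k
  · exact ⟨C, hC, hb⟩
  have hd' := fun a => (hd a).2 k (by exact_mod_cast (by lia : k ≤ r))
  choose D hD hb' using hd'
  refine ⟨C + ∑ a, D a, add_nonneg hC (Finset.sum_nonneg fun a _ => hD a), fun i => ?_⟩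
  refine ((hh.1 i).ckNorm_succ_le k).trans ?_
  rw [add_mul, Finset.sum_mul]
  exact add_le_add ((hb i).trans (mul_le_mul_of_nonneg_left (hw i (Nat.zero_le _)) hC))
    (Finset.sum_le_sum fun a _ => hb' a i)

/-- A finite family closed under differentiation, in the tame sense, is tame. -/
lemma tame_of_pderiv_closed {ι : Type*} {h : ι → I → E' n → ℝ} (hw : ∀ i, Monotone (w i))
    (h0 : ∀ j, Tame 0 w (h j))
    (hd : ∀ r : ℕ, (∀ j, Tame r w (h j)) → ∀ j a, Tame r (raise 1 w) fun i => pd a (h j i)) (j : ι) :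
    Tame ⊤ w (h j) := by
  refine tame_of_forall_nat fun r => ?_
  induction r generalizing j with
  | zero => exact h0 j
  | succ r ih => exact Tame.succ_of_pderiv hw (h0 j) (hd r ih j)

end TameFamilies

section Geometry

open scoped ContDiff Topology

lemma ContDiffAt.matrix_det {m : ℕ} {k : WithTop ℕ∞} {A : E' n → Matrix (Fin m) (Fin m) ℝ} {y : E' n}
    (h : ∀ i j, ContDiffAt ℝ k (fun z => A z i j) y) : ContDiffAt ℝ k (fun z => (A z).det) y := by
  simp only [Matrix.det_apply']
  exact ContDiffAt.sum fun σ _ => contDiffAt_const.mul (contDiffAt_prod fun i _ => h _ _)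

lemma ContDiffAt.matrix_inv {m : ℕ} {k : WithTop ℕ∞} {A : E' n → Matrix (Fin m) (Fin m) ℝ}
    {y : E' n} (h : ∀ i j, ContDiffAt ℝ k (fun z => A z i j) y) (hA : (A y).det ≠ 0) (i j : Fin m) :
    ContDiffAt ℝ k (fun z => (A z)⁻¹ i j) y := by
  simp only [Matrix.inv_def, Matrix.smul_apply, Ring.inverse_eq_inv', smul_eq_mul,
    Matrix.adjugate_apply]
  refine ((ContDiffAt.matrix_det h).inv hA).mul (ContDiffAt.matrix_det fun i' j' => ?_)
  simp only [Matrix.updateRow_apply]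
  split_ifs
  · exact contDiffAt_const
  · exact h _ _

lemma pd_matrix_det {A : E' n → Matrix (Fin n) (Fin n) ℝ} {y : E' n}
    (h : ∀ i j, DifferentiableAt ℝ (fun z => A z i j) y) (a : Fin n) :
    pd a (fun z => (A z).det) y = ∑ i, ∑ j, (A y).adjugate i j * pd a (fun z => A z j i) y := by
  have hd : ∀ i j, HasFDerivAt (fun z => A z i j) (fderiv ℝ (fun z => A z i j) y) y :=
    fun i j => (h i j).hasFDerivAt
  have hdet : HasFDerivAt (fun z => (A z).det)
      (∑ σ : Equiv.Perm (Fin n), ((Equiv.Perm.sign σ : ℤ) : ℝ) • ∑ i,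
        (∏ j ∈ Finset.univ.erase i, A y (σ j) j) • fderiv ℝ (fun z => A z (σ i) i) y) y := by
    simp only [Matrix.det_apply']
    exact HasFDerivAt.fun_sum fun σ _ =>
      (HasFDerivAt.finsetProd fun i _ => hd (σ i) i).const_mul _
  rw [pd, hdet.fderiv]
  have key : ∀ i, ∑ j, (A y).adjugate i j * pd a (fun z => A z j i) y =
      ((A y).updateCol i fun j => pd a (fun z => A z j i) y).det := by
    intro i
    rw [← Matrix.cramer_apply, Matrix.cramer_eq_adjugate_mulVec]
    rfl
  simp only [key, Matrix.det_apply', _root_.sum_apply,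
    _root_.smul_apply, smul_eq_mul, Finset.mul_sum]
  rw [Finset.sum_comm]
  refine Finset.sum_congr rfl fun i _ => Finset.sum_congr rfl fun σ _ => ?_
  rw [← Finset.mul_prod_erase _ _ (Finset.mem_univ i)]
  simp only [Matrix.updateCol_self]
  have hprod : ∏ j ∈ Finset.univ.erase i,
      (A y).updateCol i (fun j => pd a (fun z => A z j i) y) (σ j) j =
      ∏ j ∈ Finset.univ.erase i, A y (σ j) j :=
    Finset.prod_congr rfl fun j hj => Matrix.updateCol_ne (Finset.ne_of_mem_erase hj)
  rw [hprod]
  simp only [pd]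
  ring

/-- The vector field `Σ_a c_a ∂_a`. -/
def vf (c : Fin n → E' n → ℝ) (v : E' n → ℝ) (y : E' n) : ℝ := ∑ a, c a y * pd a v y

/-- The entries of the Jacobian matrix. -/
def jac (x : E' n → E' n) (i a : Fin n) (y : E' n) : ℝ := jacM x y i a

/-- The entries of the inverse Jacobian matrix. -/
def invJac (x : E' n → E' n) (a i : Fin n) (y : E' n) : ℝ := (jacM x y)⁻¹ a i

/-- The entries of the metric. -/
def metric (x : E' n → E' n) (a b : Fin n) (y : E' n) : ℝ := gMet x y a b

/-- The Christoffel symbols of the metric. -/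
def christoffel (x : E' n → E' n) (c a b : Fin n) (y : E' n) : ℝ :=
  ∑ k, invJac x c k y * pd a (jac x k b) y

lemma epd_eq_vf (x : E' n → E' n) (i : Fin n) (u : E' n → ℝ) :
    epd x i u = vf (fun a => invJac x a i) u := rfl

variable {x : E' n → E' n}

lemma contDiff_comp_apply (hx : ContDiff ℝ ∞ x) (k : Fin n) : ContDiff ℝ ∞ fun z => x z k :=
  (EuclideanSpace.proj k : E' n →L[ℝ] ℝ).contDiff.comp hx

lemma contDiff_jac (hx : ContDiff ℝ ∞ x) (i a : Fin n) : ContDiff ℝ ∞ (jac x i a) :=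
  contDiff_iff_contDiffAt.2 fun _ => (contDiff_comp_apply hx i).contDiffAt.pderiv a

lemma metric_eq (x : E' n → E' n) (a b : Fin n) (y : E' n) :
    metric x a b y = ∑ k, jac x k a y * jac x k b y := by
  simp [metric, gMet, Matrix.mul_apply, jac]

lemma contDiff_metric (hx : ContDiff ℝ ∞ x) (a b : Fin n) : ContDiff ℝ ∞ (metric x a b) := by
  simp only [funext (metric_eq x a b)]
  exact ContDiff.sum fun k _ => (contDiff_jac hx k a).mul (contDiff_jac hx k b)

lemma sum_invJac_mul_jac {y : E' n} (h : (jacM x y).det ≠ 0) (a b : Fin n) :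
    ∑ k, invJac x a k y * jac x k b y = if a = b then 1 else 0 := by
  have := congrFun₂ (Matrix.nonsing_inv_mul _ (isUnit_iff_ne_zero.2 h)) a b
  simpa [Matrix.mul_apply, Matrix.one_apply, invJac, jac] using this

lemma sum_jac_mul_invJac {y : E' n} (h : (jacM x y).det ≠ 0) (i j : Fin n) :
    ∑ a, jac x i a y * invJac x a j y = if i = j then 1 else 0 := by
  have := congrFun₂ (Matrix.mul_nonsing_inv _ (isUnit_iff_ne_zero.2 h)) i j
  simpa [Matrix.mul_apply, Matrix.one_apply, invJac, jac] using this

lemma contDiffAt_invJac (hx : ContDiff ℝ ∞ x) {y : E' n} (h : (jacM x y).det ≠ 0) (a i : Fin n) :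
    ContDiffAt ℝ ∞ (invJac x a i) y :=
  ContDiffAt.matrix_inv (fun i j => (contDiff_jac hx i j).contDiffAt) h a i

lemma continuous_det_jacM (hx : ContDiff ℝ ∞ x) : Continuous fun z => (jacM x z).det :=
  (contDiff_iff_contDiffAt.2 fun _ =>
    ContDiffAt.matrix_det fun i j => (contDiff_jac hx i j).contDiffAt).continuous

lemma eventually_det_ne_zero (hx : ContDiff ℝ ∞ x) {y : E' n} (h : (jacM x y).det ≠ 0) :
    ∀ᶠ z in 𝓝 y, (jacM x z).det ≠ 0 :=
  (continuous_det_jacM hx).continuousAt.eventually_ne h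

lemma pd_jac_comm (hx : ContDiff ℝ ∞ x) (k a b : Fin n) (y : E' n) :
    pd a (jac x k b) y = pd b (jac x k a) y :=
  pd_comm ((contDiff_comp_apply hx k).contDiffAt.of_le
    (WithTop.coe_le_coe.2 le_top)) a b

lemma christoffel_comm (hx : ContDiff ℝ ∞ x) (c a b : Fin n) (y : E' n) :
    christoffel x c a b y = christoffel x c b a y := by
  simp only [christoffel, pd_jac_comm hx _ a b]

lemma christoffel_eq (hx : ContDiff ℝ ∞ x) {y : E' n} (h : (jacM x y).det ≠ 0) (c a b : Fin n) :
    christoffel x c a b y = ∑ d, ∑ i, invJac x c i y * invJac x d i y *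
      ((1 / 2 : ℝ) * (pd a (metric x b d) y + pd b (metric x a d) y - pd d (metric x a b) y)) := by
  have hdJ : ∀ k a, DifferentiableAt ℝ (jac x k a) y := fun k a =>
    (contDiff_jac hx k a).contDiffAt.differentiableAt (by simp)
  have hg : ∀ a b d, pd a (metric x b d) y =
      ∑ k, (pd a (jac x k b) y * jac x k d y + jac x k b y * pd a (jac x k d) y) := by
    intro a b d
    rw [funext (metric_eq x b d), pd_sum fun k _ => (hdJ k b).fun_mul (hdJ k d)]
    exact Finset.sum_congr rfl fun k _ => pd_mul (hdJ k b) (hdJ k d) a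
  have hbr : ∀ d, (1 / 2 : ℝ) *
      (pd a (metric x b d) y + pd b (metric x a d) y - pd d (metric x a b) y) =
      ∑ k, pd a (jac x k b) y * jac x k d y := by
    intro d
    simp only [hg, ← Finset.sum_add_distrib, ← Finset.sum_sub_distrib, Finset.mul_sum]
    refine Finset.sum_congr rfl fun k _ => ?_
    rw [pd_jac_comm hx k b a, pd_jac_comm hx k d a, pd_jac_comm hx k d b]
    ring
  simp only [hbr, Finset.mul_sum]
  calc christoffel x c a b y
      = ∑ i, ∑ k, invJac x c i y * pd a (jac x k b) y * ∑ d, jac x k d y * invJac x d i y := by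
        simp [sum_jac_mul_invJac h, christoffel]
    _ = ∑ i, ∑ k, ∑ d, invJac x c i y * invJac x d i y *
          (pd a (jac x k b) y * jac x k d y) := by
        simp only [Finset.mul_sum]
        refine Finset.sum_congr rfl fun i _ => Finset.sum_congr rfl fun k _ =>
          Finset.sum_congr rfl fun d _ => by ring
    _ = _ := by
        rw [Finset.sum_comm' (t' := Finset.univ) (s' := fun _ => Finset.univ) (by simp)]
        rw [Finset.sum_congr rfl fun k _ => Finset.sum_comm]
        rw [Finset.sum_comm]
        exact Finset.sum_congr rfl fun d _ => Finset.sum_comm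

lemma pd_invJac (hx : ContDiff ℝ ∞ x) {y : E' n} (h : (jacM x y).det ≠ 0) (a c i : Fin n) :
    pd a (invJac x c i) y = -∑ b, christoffel x c a b y * invJac x b i y := by
  have hdJ : ∀ k a, DifferentiableAt ℝ (jac x k a) y := fun k a =>
    (contDiff_jac hx k a).contDiffAt.differentiableAt (by simp)
  have hdK : ∀ k a, DifferentiableAt ℝ (invJac x k a) y := fun k a =>
    (contDiffAt_invJac hx h k a).differentiableAt (by simp)
  have h0 : ∀ b, ∑ k, (pd a (invJac x c k) y * jac x k b y + invJac x c k y * pd a (jac x k b) y)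
      = 0 := by
    intro b
    rw [← pd_const (if c = b then 1 else 0) y a, ← pd_congr (u := fun z =>
      ∑ k, invJac x c k z * jac x k b z) ((eventually_det_ne_zero hx h).mono fun z hz =>
      sum_invJac_mul_jac hz c b), pd_sum fun k _ => (hdK c k).fun_mul (hdJ k b)]
    exact Finset.sum_congr rfl fun k _ => (pd_mul (hdK c k) (hdJ k b) a).symm
  have h1 : ∀ b, christoffel x c a b y = -∑ k, pd a (invJac x c k) y * jac x k b y := by
    intro b
    have := h0 b
    rw [Finset.sum_add_distrib] at this
    rw [christoffel]
    linarith
  simp only [h1, neg_mul, Finset.sum_neg_distrib, neg_neg, Finset.sum_mul]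
  rw [Finset.sum_comm]
  simp only [mul_assoc, ← Finset.mul_sum, sum_jac_mul_invJac h]
  simp

lemma pd_kappa (hx : ContDiff ℝ ∞ x) {y : E' n} (h : (jacM x y).det ≠ 0) (a : Fin n) :
    pd a (kappa x) y = kappa x y * ∑ c, christoffel x c a c y := by
  have hdJ : ∀ k a, DifferentiableAt ℝ (jac x k a) y := fun k a =>
    (contDiff_jac hx k a).contDiffAt.differentiableAt (by simp)
  have := pd_matrix_det (A := jacM x) hdJ a
  rw [show kappa x = fun z => (jacM x z).det from rfl, this, Finset.mul_sum]
  refine Finset.sum_congr rfl fun c _ => ?_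
  rw [christoffel, Finset.mul_sum]
  refine Finset.sum_congr rfl fun k _ => ?_
  simp only [invJac, Matrix.inv_def, Matrix.smul_apply, Ring.inverse_eq_inv', smul_eq_mul]
  field_simp
  rfl

lemma gMet_inv_apply (x : E' n → E' n) (y : E' n) (a b : Fin n) :
    (gMet x y)⁻¹ a b = ∑ i, invJac x a i y * invJac x b i y := by
  rw [gMet, Matrix.mul_inv_rev, Matrix.mul_apply, ← Matrix.transpose_nonsing_inv]
  rfl

lemma contDiffAt_vf {c : Fin n → E' n → ℝ} {v : E' n → ℝ} {y : E' n}
    (hc : ∀ a, ContDiffAt ℝ ∞ (c a) y) (hv : ContDiffAt ℝ ∞ v y) : ContDiffAt ℝ ∞ (vf c v) y :=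
  ContDiffAt.sum fun a _ => (hc a).mul (hv.pderiv a)

lemma lapl_eq_sum_epd (hx : ContDiff ℝ ∞ x) {u : E' n → ℝ} {y : E' n} (h : (jacM x y).det ≠ 0)
    (hu : ContDiffAt ℝ ∞ u y) : lapl x u y = ∑ i, epd x i (epd x i u) y := by
  have hdK : ∀ k a, DifferentiableAt ℝ (invJac x k a) y := fun k a =>
    (contDiffAt_invJac hx h k a).differentiableAt (by simp)
  have hdE : ∀ i, DifferentiableAt ℝ (epd x i u) y := fun i =>
    (contDiffAt_vf (fun a => contDiffAt_invJac hx h a i) hu).differentiableAt (by simp)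
  have hdk : DifferentiableAt ℝ (kappa x) y :=
    (ContDiffAt.matrix_det (k := ∞) fun i j => (contDiff_jac hx i j).contDiffAt).differentiableAt
      (by simp)
  have h1 : ∀ a, (fun z => kappa x z * ∑ b, (gMet x z)⁻¹ a b * pd b u z) =
      fun z => ∑ i, kappa x z * (invJac x a i z * epd x i u z) := by
    intro a
    funext z
    simp only [gMet_inv_apply, epd_eq_vf, vf, Finset.mul_sum, Finset.sum_mul]
    rw [Finset.sum_comm]
    exact Finset.sum_congr rfl fun i _ => Finset.sum_congr rfl fun b _ => by ring
  have h2 : ∀ a, pd a (fun z => kappa x z * ∑ b, (gMet x z)⁻¹ a b * pd b u z) y =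
      ∑ i, (kappa x y * ((∑ c, christoffel x c a c y) * invJac x a i y * epd x i u y)
        - kappa x y * ((∑ b, christoffel x a a b y * invJac x b i y) * epd x i u y)
        + kappa x y * (invJac x a i y * pd a (epd x i u) y)) := by
    intro a
    rw [h1, pd_sum fun i _ => hdk.fun_mul ((hdK a i).fun_mul (hdE i))]
    refine Finset.sum_congr rfl fun i _ => ?_
    rw [pd_mul hdk ((hdK a i).fun_mul (hdE i)), pd_mul (hdK a i) (hdE i), pd_kappa hx h,
      pd_invJac hx h]
    ring
  have h3 : ∀ i, ∑ a, (∑ c, christoffel x c a c y) * invJac x a i y * epd x i u y =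
      ∑ a, (∑ b, christoffel x a a b y * invJac x b i y) * epd x i u y := by
    intro i
    simp only [← Finset.sum_mul]
    congr 1
    simp only [Finset.sum_mul]
    rw [Finset.sum_comm]
    exact Finset.sum_congr rfl fun a _ => Finset.sum_congr rfl fun b _ => by
      rw [christoffel_comm hx]
  have hk : kappa x y ≠ 0 := h
  rw [lapl]
  simp only [h2]
  rw [Finset.sum_comm]
  simp only [Finset.sum_add_distrib, Finset.sum_sub_distrib, ← Finset.mul_sum, h3, sub_self,
    zero_add]
  rw [inv_mul_cancel_left₀ hk]
  rfl

end Geometry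

section MaximumPrinciple

open scoped ContDiff Topology

lemma second_deriv_nonpos_of_isLocalMax {g g' : ℝ → ℝ} {c : ℝ}
    (h1 : ∀ᶠ t in 𝓝 0, HasDerivAt g (g' t) t) (h2 : HasDerivAt g' c 0) (hm : IsLocalMax g 0) :
    c ≤ 0 := by
  by_contra! hc
  have hd : deriv (fun t => g t - c / 4 * t ^ 2) =ᶠ[𝓝 0] fun t => g' t - c / 2 * t := by
    filter_upwards [h1] with t ht
    have := (ht.sub ((hasDerivAt_pow 2 t).const_mul (c / 4))).deriv
    refine this.trans ?_
    norm_num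
    ring
  have hg0 : g' 0 = 0 := hm.hasDerivAt_eq_zero h1.self_of_nhds
  have hmin : IsLocalMin (fun t => g t - c / 4 * t ^ 2) 0 := by
    refine isLocalMin_of_deriv_deriv_pos ?_ ?_ ?_
    · rw [hd.deriv_eq, (h2.fun_sub ((hasDerivAt_id' (0 : ℝ)).const_mul (c / 2))).deriv]
      linarith
    · simpa [hg0] using hd.self_of_nhds
    · exact h1.self_of_nhds.continuousAt.sub (by fun_prop)
  obtain ⟨t, ⟨ht1, ht2⟩, ht3⟩ :=
    ((((hmin.and hm).filter_mono nhdsWithin_le_nhds).and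
      (eventually_mem_nhdsWithin : ∀ᶠ t in 𝓝[≠] (0 : ℝ), t ∈ ({0} : Set ℝ)ᶜ))).exists
  have : 0 < t ^ 2 := by have : t ≠ 0 := ht3; positivity
  simp only [ne_eq, OfNat.ofNat_ne_zero, not_false_eq_true, zero_pow, mul_zero, sub_zero] at ht1
  nlinarith

variable {x : E' n → E' n}

lemma fderiv_apply_coord (hx : ContDiff ℝ ∞ x) (y w : E' n) (i : Fin n) :
    fderiv ℝ x y w i = ∑ a, jac x i a y * w a := by
  have hd : HasFDerivAt x (fderiv ℝ x y) y := (hx.differentiable (by simp) y).hasFDerivAt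
  have h := ((EuclideanSpace.proj i : E' n →L[ℝ] ℝ).hasFDerivAt.comp y hd).fderiv
  have h2 := fderiv_apply_eq_sum_pd (fun z => x z i) y w
  have h3 : fderiv ℝ (fun z => x z i) y w = fderiv ℝ x y w i := by
    have : (fun z => x z i) = (EuclideanSpace.proj i : E' n →L[ℝ] ℝ) ∘ x := rfl
    rw [this, h]
    rfl
  rw [← h3, h2]
  exact Finset.sum_congr rfl fun a _ => by simp [jac, jacM, mul_comm]

lemma exists_hasFDerivAt_equiv (hx : ContDiff ℝ ∞ x) {y : E' n} (h : (jacM x y).det ≠ 0) :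
    ∃ f' : E' n ≃L[ℝ] E' n, HasFDerivAt x (f' : E' n →L[ℝ] E' n) y := by
  have hd : HasFDerivAt x (fderiv ℝ x y) y := (hx.differentiable (by simp) y).hasFDerivAt
  let B : E' n →L[ℝ] E' n := Matrix.toEuclideanCLM (𝕜 := ℝ) (jacM x y)⁻¹
  have hB : ∀ w a, B w a = ∑ i, invJac x a i y * w i := fun w a => by
    simp only [B, Matrix.ofLp_toEuclideanCLM]
    rfl
  refine ⟨ContinuousLinearEquiv.equivOfInverse (fderiv ℝ x y) B (fun w => ?_) (fun w => ?_), hd⟩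
  · ext a
    simp only [hB, fderiv_apply_coord hx, Finset.mul_sum, ← mul_assoc]
    rw [Finset.sum_comm]
    simp [← Finset.sum_mul, sum_invJac_mul_jac h]
  · ext a
    simp only [hB, fderiv_apply_coord hx, Finset.mul_sum, ← mul_assoc]
    rw [Finset.sum_comm]
    simp [← Finset.sum_mul, sum_jac_mul_invJac h]

/-- Curves whose images under `x` are straight lines. -/
lemma exists_flat_curve (hx : ContDiff ℝ ∞ x) {y : E' n} (h : (jacM x y).det ≠ 0) (e : Fin n → ℝ) :
    ∃ γ : ℝ → E' n, γ 0 = y ∧ ∀ᶠ t in 𝓝 0, x (γ t) = x y + t • WithLp.toLp 2 e ∧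
      HasDerivAt γ (WithLp.toLp 2 fun a => ∑ i, invJac x a i (γ t) * e i) t := by
  obtain ⟨f', hf'⟩ := exists_hasFDerivAt_equiv hx h
  have hc : ContDiffAt ℝ 1 x y := hx.contDiffAt.of_le (by simp)
  have hs := hc.hasStrictFDerivAt' hf' one_ne_zero
  set σ := hs.localInverse x f' y with hσ
  have hσ0 : σ (x y) = y := hs.localInverse_apply_image
  have hσd : ∀ᶠ p in 𝓝 (x y), DifferentiableAt ℝ σ p :=
    ((hc.to_localInverse hf' one_ne_zero).eventually (by simp)).mono
      fun p hp => hp.differentiableAt (by simp)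
  set l : ℝ → E' n := fun t => x y + t • WithLp.toLp 2 e with hl
  have hlc : Continuous l := by fun_prop
  have hl0 : l 0 = x y := by simp [hl]
  have htend : Filter.Tendsto l (𝓝 0) (𝓝 (x y)) := hl0 ▸ hlc.continuousAt
  have hright : ∀ᶠ t in 𝓝 0, x (σ (l t)) = l t := htend.eventually hs.eventually_right_inverse
  have hdiff : ∀ᶠ t in 𝓝 0, DifferentiableAt ℝ σ (l t) := htend.eventually hσd
  have hγc : ContinuousAt (fun t => σ (l t)) 0 :=
    ContinuousAt.comp (g := σ) (f := l) (hdiff.self_of_nhds.continuousAt) hlc.continuousAt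
  have hdet : ∀ᶠ t in 𝓝 0, (jacM x (σ (l t))).det ≠ 0 := by
    refine hγc.eventually (p := fun z => (jacM x z).det ≠ 0) ?_
    simpa [hl0, hσ0] using eventually_det_ne_zero hx h
  refine ⟨fun t => σ (l t), by simp [hl0, hσ0], ?_⟩
  filter_upwards [hright.eventually_nhds, hdiff, hdet] with t ht1 ht2 ht3
  refine ⟨ht1.self_of_nhds, ?_⟩
  have hld : HasDerivAt l (WithLp.toLp 2 e) t := by
    exact (((hasDerivAt_id t).smul_const (WithLp.toLp 2 e : E' n)).const_add (x y)).congr_deriv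
      (one_smul _ _)
  have hγ : HasDerivAt (fun t => σ (l t)) (fderiv ℝ σ (l t) (WithLp.toLp 2 e)) t :=
    ht2.hasFDerivAt.comp_hasDerivAt t hld
  convert hγ using 1
  set w := fderiv ℝ σ (l t) (WithLp.toLp 2 e)
  have h1 : HasDerivAt (fun t => x (σ (l t))) (fderiv ℝ x (σ (l t)) w) t :=
    HasFDerivAt.comp_hasDerivAt t ((hx.differentiable (by simp) _).hasFDerivAt) hγ
  have h2 : fderiv ℝ x (σ (l t)) w = WithLp.toLp 2 e :=
    (h1.congr_of_eventuallyEq (ht1.mono fun s hs => hs.symm)).unique hld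
  have h3 : ∀ i, e i = ∑ a, jac x i a (σ (l t)) * w a := fun i => by
    rw [← fderiv_apply_coord hx, h2]
  ext a
  simp only [h3, Finset.mul_sum, ← mul_assoc]
  rw [Finset.sum_comm]
  simp [← Finset.sum_mul, sum_invJac_mul_jac ht3]

lemma exists_flat_curve_deriv (hx : ContDiff ℝ ∞ x) {y : E' n} (h : (jacM x y).det ≠ 0)
    (e : Fin n → ℝ) : ∃ γ : ℝ → E' n, γ 0 = y ∧ ContinuousAt γ 0 ∧
      (∀ᶠ t in 𝓝 0, x (γ t) = x y + t • WithLp.toLp 2 e) ∧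
      ∀ u : E' n → ℝ, ContDiffAt ℝ ∞ u y →
        (∀ᶠ t in 𝓝 0, HasDerivAt (fun t => u (γ t)) (∑ i, e i * epd x i u (γ t)) t) ∧
        HasDerivAt (fun t => ∑ i, e i * epd x i u (γ t))
          (∑ i, ∑ j, e i * e j * epd x j (epd x i u) y) 0 := by
  obtain ⟨γ, hγ0, hγ⟩ := exists_flat_curve hx h e
  have hc : ContinuousAt γ 0 := hγ.self_of_nhds.2.continuousAt
  have key : ∀ (u : E' n → ℝ) (t : ℝ), DifferentiableAt ℝ u (γ t) →
      HasDerivAt γ (WithLp.toLp 2 fun a => ∑ i, invJac x a i (γ t) * e i) t →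
      HasDerivAt (fun t => u (γ t)) (∑ i, e i * epd x i u (γ t)) t := by
    intro u t hu ht
    refine (hu.hasFDerivAt.comp_hasDerivAt t ht).congr_deriv ?_
    rw [fderiv_apply_eq_sum_pd]
    simp only [epd_eq_vf, vf, Finset.mul_sum, Finset.sum_mul]
    rw [Finset.sum_comm]
    exact Finset.sum_congr rfl fun i _ => Finset.sum_congr rfl fun b _ => by ring
  refine ⟨γ, hγ0, hc, hγ.mono fun t ht => ht.1, fun u hu => ⟨?_, ?_⟩⟩
  · have hev : ∀ᶠ z in 𝓝 y, DifferentiableAt ℝ u z :=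
      ((hu.of_le (m := 1) (by simp)).eventually (by simp)).mono
        fun z hz => hz.differentiableAt (by simp)
    filter_upwards [hγ, hc.eventually (hγ0.symm ▸ hev)] with t ht1 ht2
    exact key u t ht2 ht1.2
  · have hE : ∀ i, DifferentiableAt ℝ (epd x i u) (γ 0) := fun i => by
      rw [hγ0]
      exact (contDiffAt_vf (fun a => contDiffAt_invJac hx h a i) hu).differentiableAt (by simp)
    refine (HasDerivAt.fun_sum (u := Finset.univ) fun i _ =>
      (key _ 0 (hE i) hγ.self_of_nhds.2).const_mul (e i)).congr_deriv ?_
    simp only [Finset.mul_sum, hγ0, mul_assoc]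

end MaximumPrinciple

section MaximumPrincipleLaplacian

open scoped ContDiff Topology

variable {x : E' n → E' n}

lemma lapl_nonpos_of_isLocalMax (hx : ContDiff ℝ ∞ x) {y : E' n} (h : (jacM x y).det ≠ 0)
    {u : E' n → ℝ} (hu : ContDiffAt ℝ ∞ u y) (hm : IsLocalMax u y) : lapl x u y ≤ 0 := by
  rw [lapl_eq_sum_epd hx h hu]
  refine Finset.sum_nonpos fun k _ => ?_
  obtain ⟨γ, hγ0, hγc, -, hγ⟩ := exists_flat_curve_deriv hx h (Pi.single k 1)
  obtain ⟨h1, h2⟩ := hγ u hu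
  have hm' : IsLocalMax (fun t => u (γ t)) 0 := by
    have : Filter.Tendsto γ (𝓝 0) (𝓝 y) := hγ0 ▸ hγc
    filter_upwards [this.eventually hm] with t ht
    rwa [hγ0]
  simpa [Pi.single_apply] using second_deriv_nonpos_of_isLocalMax h1 h2 hm'

/-- The doubled maximum principle. -/
lemma lapl_sub_lapl_le (hx : ContDiff ℝ ∞ x) {y z : E' n} (hy : (jacM x y).det ≠ 0)
    (hz : (jacM x z).det ≠ 0) {u : E' n → ℝ} (huy : ContDiffAt ℝ ∞ u y) (huz : ContDiffAt ℝ ∞ u z)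
    (hne : x y ≠ x z) {L Λ : ℝ}
    (hm : ∀ᶠ p : E' n × E' n in 𝓝 (y, z),
      u p.1 - u p.2 - (L * ‖x p.1 - x p.2‖ - Λ * ‖x p.1 - x p.2‖ ^ 2) ≤
      u y - u z - (L * ‖x y - x z‖ - Λ * ‖x y - x z‖ ^ 2)) :
    lapl x u y - lapl x u z ≤ -8 * Λ := by
  set s := ‖x y - x z‖ with hs
  have hs0 : 0 < s := norm_pos_iff.2 (sub_ne_zero.2 hne)
  set a : Fin n → ℝ := fun i => (x y - x z) i / s with ha
  have hxa : x y - x z = s • WithLp.toLp 2 a := by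
    ext i
    simp only [ha, PiLp.smul_apply, smul_eq_mul]
    field_simp
  have hna : ‖(WithLp.toLp 2 a : E' n)‖ = 1 := by
    have := congrArg norm hxa
    rw [norm_smul, Real.norm_of_nonneg hs0.le, ← hs] at this
    exact (mul_eq_left₀ hs0.ne').1 this.symm
  have hsum : ∑ i, a i ^ 2 = 1 := by
    have := EuclideanSpace.norm_sq_eq (WithLp.toLp 2 a : E' n)
    simpa [hna] using this.symm
  set f : Fin n → Fin n → ℝ := fun k i => (if k = i then 1 else 0) - 2 * a k * a i with hf
  have hff : ∀ i j, ∑ k, f k i * f k j = if i = j then 1 else 0 := by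
    intro i j
    have : ∀ k, f k i * f k j = (if k = i then 1 else 0) * (if k = j then 1 else 0)
        - 2 * a i * (a k * if k = j then 1 else 0) - 2 * a j * (a k * if k = i then 1 else 0)
        + 4 * a i * a j * a k ^ 2 := fun k => by simp only [hf]; ring
    simp only [this, Finset.sum_add_distrib, Finset.sum_sub_distrib, ← Finset.mul_sum, hsum]
    simp only [mul_ite, mul_one, mul_zero, Finset.sum_ite_eq',
      Finset.mem_univ, ↓reduceIte, eq_comm (a := j) (b := i)]
    ring
  have key : ∀ k, epd x k (epd x k u) y
      - ∑ i, ∑ j, f k i * f k j * epd x j (epd x i u) z + 8 * Λ * a k ^ 2 ≤ 0 := by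
    intro k
    obtain ⟨γ, hγ0, hγc, hγx, hγ⟩ := exists_flat_curve_deriv hx hy (Pi.single k 1)
    obtain ⟨δ, hδ0, hδc, hδx, hδ⟩ := exists_flat_curve_deriv hx hz (f k)
    obtain ⟨h1, h2⟩ := hγ u huy
    obtain ⟨h3, h4⟩ := hδ u huz
    have h5 : ∀ t : ℝ, HasDerivAt (fun t => L * (s + 2 * a k * t) - Λ * (s + 2 * a k * t) ^ 2)
        (L * (2 * a k) - Λ * (2 * (s + 2 * a k * t) * (2 * a k))) t := by
      intro t
      have hl : HasDerivAt (fun t => s + 2 * a k * t) (2 * a k) t := by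
        simpa using ((hasDerivAt_id' t).const_mul (2 * a k)).const_add s
      have := (hl.const_mul L).fun_sub ((hl.fun_pow 2).const_mul Λ)
      simpa using this
    have h6 : HasDerivAt (fun t => L * (2 * a k) - Λ * (2 * (s + 2 * a k * t) * (2 * a k)))
        (-(8 * Λ * a k ^ 2)) 0 := by
      have hl : HasDerivAt (fun t => s + 2 * a k * t) (2 * a k) 0 := by
        simpa using ((hasDerivAt_id' (0 : ℝ)).const_mul (2 * a k)).const_add s
      refine (((hl.const_mul 2).mul_const (2 * a k)).const_mul Λ |>.const_sub _).congr_deriv ?_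
      ring
    have hmax : IsLocalMax (fun t => u (γ t) - u (δ t) -
        (L * (s + 2 * a k * t) - Λ * (s + 2 * a k * t) ^ 2)) 0 := by
      have ht : Filter.Tendsto (fun t => (γ t, δ t)) (𝓝 0) (𝓝 (y, z)) := by
        have h1 : Filter.Tendsto γ (𝓝 0) (𝓝 y) := hγ0 ▸ hγc
        have h2 : Filter.Tendsto δ (𝓝 0) (𝓝 z) := hδ0 ▸ hδc
        exact h1.prodMk_nhds h2
      have hpos : ∀ᶠ t in 𝓝 (0 : ℝ), 0 < s + 2 * a k * t := by
        have : ContinuousAt (fun t : ℝ => s + 2 * a k * t) 0 := by fun_prop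
        exact this.eventually (lt_mem_nhds (by simpa using hs0))
      filter_upwards [ht.eventually hm, hγx, hδx, hpos] with t h1 h2 h3 h4
      have hxx : x (γ t) - x (δ t) = (s + 2 * a k * t) • WithLp.toLp 2 a := by
        rw [h2, h3, add_sub_add_comm, hxa, add_smul, ← smul_sub]
        congr 1
        ext i
        by_cases hki : k = i
        · subst hki; simp [hf]; ring
        · have : i ≠ k := fun h => hki h.symm
          simp [hf, hki, this]; ring
      have hnn : ‖x (γ t) - x (δ t)‖ = s + 2 * a k * t := by
        rw [hxx, norm_smul, hna, mul_one, Real.norm_of_nonneg h4.le]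
      simp only [hnn] at h1
      simpa [hγ0, hδ0] using h1
    have := second_deriv_nonpos_of_isLocalMax
      (((h1.and h3).mono fun t ht => (ht.1.fun_sub ht.2).fun_sub (h5 t)))
      ((h2.fun_sub h4).fun_sub h6) hmax
    simp [Pi.single_apply] at this
    linarith
  have hz' : ∑ k, ∑ i, ∑ j, f k i * f k j * epd x j (epd x i u) z = lapl x u z := by
    rw [lapl_eq_sum_epd hx hz huz, Finset.sum_comm]
    refine Finset.sum_congr rfl fun i _ => ?_
    rw [Finset.sum_comm]
    simp [← Finset.sum_mul, hff]
  have := Finset.sum_nonpos fun k (_ : k ∈ Finset.univ) => key k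
  simp only [Finset.sum_add_distrib, Finset.sum_sub_distrib, hz', ← Finset.mul_sum, hsum,
    ← lapl_eq_sum_epd hx hy huy] at this
  linarith

end MaximumPrincipleLaplacian

section Coefficients

open scoped ContDiff Topology

/-- The data of the Dirichlet problem: coordinates `x` satisfying the coordinate condition with
constant `c₁` and a `C³` bound `M`, and a function `q` vanishing on the boundary. -/
structure DirichletData (n : ℕ) (c₁ M : ℝ) where
  x : E' n → E' n
  q : E' n → ℝ
  contDiff_x : ContDiff ℝ ∞ x
  contDiff_q : ContDiff ℝ ∞ q
  det_ne_zero : ∀ y ∈ Ball n, (jacM x y).det ≠ 0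
  coordCond : ∀ y ∈ Ball n, coordCond x c₁ y
  ckNorm_x_le : ckNorm 3 x ≤ M
  eq_zero : ∀ y ∈ Sphere' n, q y = 0

variable {c₁ M : ℝ}

lemma sq_le_sum_sum {f : Fin n → Fin n → ℝ} (i a : Fin n) :
    f i a ^ 2 ≤ ∑ i, ∑ a, f i a ^ 2 :=
  (Finset.single_le_sum (f := fun a => f i a ^ 2) (fun _ _ => sq_nonneg _)
    (Finset.mem_univ a)).trans (Finset.single_le_sum (f := fun i => ∑ a, f i a ^ 2)
      (fun _ _ => Finset.sum_nonneg fun _ _ => sq_nonneg _) (Finset.mem_univ i))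

lemma DirichletData.sum_jac_sq_le (d : DirichletData n c₁ M) {y : E' n} (hy : y ∈ Ball n) :
    ∑ i, ∑ a, jac d.x i a y ^ 2 ≤ c₁ ^ 2 := by
  refine le_trans ?_ (d.coordCond y hy)
  exact le_add_of_nonneg_right (Finset.sum_nonneg fun _ _ => Finset.sum_nonneg fun _ _ => sq_nonneg _)

lemma DirichletData.sum_invJac_sq_le (d : DirichletData n c₁ M) {y : E' n} (hy : y ∈ Ball n) :
    ∑ a, ∑ i, invJac d.x a i y ^ 2 ≤ c₁ ^ 2 := by
  refine le_trans ?_ (d.coordCond y hy)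
  exact le_add_of_nonneg_left (Finset.sum_nonneg fun _ _ => Finset.sum_nonneg fun _ _ => sq_nonneg _)

lemma DirichletData.abs_invJac_le (d : DirichletData n c₁ M) {y : E' n} (hy : y ∈ Ball n)
    (a i : Fin n) : |invJac d.x a i y| ≤ |c₁| :=
  sq_le_sq.1 ((sq_le_sum_sum (f := fun a i => invJac d.x a i y) a i).trans (d.sum_invJac_sq_le hy))

lemma DirichletData.smoothNear_invJac (d : DirichletData n c₁ M) (a i : Fin n) :
    SmoothNear (invJac d.x a i) := fun y hy => contDiffAt_invJac d.contDiff_x (d.det_ne_zero y hy) a i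

lemma ckNorm_comp_apply_le {x : E' n → E' n} (hx : ContDiff ℝ ∞ x) (k : ℕ) (i : Fin n) :
    ckNorm k (fun z => x z i) ≤ ckNorm k x := by
  unfold ckNorm
  refine Finset.sum_le_sum fun j _ => biSup_unitBall_le
    (Real.iSup_nonneg fun _ => Real.iSup_nonneg fun _ => norm_nonneg _) fun y hy => ?_
  refine le_trans ?_ (le_biSup_unitBall (hx.smoothNear.continuousOn_norm_iteratedFDeriv j) hy)
  have := (EuclideanSpace.proj i : E' n →L[ℝ] ℝ).norm_iteratedFDeriv_comp_left (f := x) (x := y)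
    (N := ∞) (n := j) hx.contDiffAt (by exact_mod_cast le_top)
  exact this.trans (mul_le_of_le_one_left (norm_nonneg _) (norm_proj_le_one i))

/-- The weight `1 + Σ_{ab} ‖g_{ab}‖_{k,∞}`. -/
def gW (d : DirichletData n c₁ M) (k : ℕ) : ℝ := 1 + ∑ a, ∑ b, ckNorm k (metric d.x a b)

lemma one_le_gW (d : DirichletData n c₁ M) (k : ℕ) : 1 ≤ gW d k :=
  le_add_of_nonneg_right (Finset.sum_nonneg fun _ _ => Finset.sum_nonneg fun _ _ => ckNorm_nonneg _ _)

lemma gW_nonneg (d : DirichletData n c₁ M) (k : ℕ) : 0 ≤ gW d k :=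
  zero_le_one.trans (one_le_gW d k)

lemma monotone_gW (d : DirichletData n c₁ M) : Monotone (gW d) := fun _ _ h =>
  add_le_add le_rfl (Finset.sum_le_sum fun _ _ => Finset.sum_le_sum fun _ _ => ckNorm_mono h _)

lemma monotone_raise {I : Type*} {w : I → ℕ → ℝ} {i : I} (hw : Monotone (w i)) (m : ℕ) :
    Monotone (raise m w i) := fun _ _ h => hw (Nat.add_le_add_right h m)

lemma smoothNear_metric (d : DirichletData n c₁ M) (a b : Fin n) : SmoothNear (metric d.x a b) :=
  (contDiff_metric d.contDiff_x a b).smoothNear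

lemma ckNorm_metric_le_gW (d : DirichletData n c₁ M) (a b : Fin n) (k : ℕ) :
    ckNorm k (metric d.x a b) ≤ gW d k := by
  have h1 := Finset.single_le_sum (f := fun b => ckNorm k (metric d.x a b))
    (fun _ _ => ckNorm_nonneg _ _) (Finset.mem_univ b)
  have h2 := Finset.single_le_sum (f := fun a => ∑ b, ckNorm k (metric d.x a b))
    (fun _ _ => Finset.sum_nonneg fun _ _ => ckNorm_nonneg _ _) (Finset.mem_univ a)
  unfold gW
  linarith

lemma tame_metric (a b : Fin n) :
    Tame ⊤ gW fun d : DirichletData n c₁ M => metric d.x a b :=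
  ⟨fun d => smoothNear_metric d a b, fun k _ => ⟨1, zero_le_one, fun d => by
    simpa using ckNorm_metric_le_gW d a b k⟩⟩

lemma exists_gW_two_le (n : ℕ) (c₁ M : ℝ) : ∃ C, 0 ≤ C ∧ ∀ d : DirichletData n c₁ M, gW d 2 ≤ C := by
  have hJ : ∀ i a, Tame (2 : ℕ) (fun _ _ => 1) fun d : DirichletData n c₁ M => jac d.x i a := by
    refine fun i a => ⟨fun d => (contDiff_jac d.contDiff_x i a).smoothNear, fun k hk =>
      ⟨|M|, abs_nonneg M, fun d => ?_⟩⟩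
    have hk : k ≤ 2 := by exact_mod_cast hk
    calc ckNorm k (jac d.x i a) ≤ ckNorm 2 (jac d.x i a) := ckNorm_mono hk _
      _ ≤ ckNorm 3 (fun z => d.x z i) :=
          (contDiff_comp_apply d.contDiff_x i).smoothNear.ckNorm_pd_le a 2
      _ ≤ ckNorm 3 d.x := ckNorm_comp_apply_le d.contDiff_x 3 i
      _ ≤ |M| * 1 := by simpa using d.ckNorm_x_le.trans (le_abs_self M)
  have hg : ∀ a b, Tame (2 : ℕ) (fun _ _ => 1) fun d : DirichletData n c₁ M => metric d.x a b := by
    intro a b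
    simp only [funext (metric_eq _ a b)]
    exact Tame.sum (fun _ _ => zero_le_one) fun k _ =>
      (hJ k a).mul (hJ k b) fun _ _ => ⟨1, zero_le_one, fun _ => by simp⟩
  have := fun a b => (hg a b).2 2 le_rfl
  choose C hC hb using this
  refine ⟨1 + ∑ a, ∑ b, C a b, add_nonneg zero_le_one
    (Finset.sum_nonneg fun _ _ => Finset.sum_nonneg fun _ _ => hC _ _), fun d => ?_⟩
  exact add_le_add le_rfl (Finset.sum_le_sum fun a _ => Finset.sum_le_sum fun b _ => by
    simpa using hb a b d)

lemma exists_logConvexUpTo_ckNorm (n : ℕ) : ∃ C : ℕ → ℝ, ∀ u : E' n → ℝ, SmoothNear u →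
    LogConvexUpTo C fun k => ckNorm k u := by
  choose C hC h using exists_ckNorm_succ_le_sqrt n
  refine ⟨fun k => C k ^ 2, fun u hu => ⟨fun k => ckNorm_nonneg k u, fun k => ?_⟩⟩
  refine (pow_le_pow_left₀ (ckNorm_nonneg _ _) (h k u hu) 2).trans (le_of_eq ?_)
  rw [mul_pow, Real.sq_sqrt (mul_nonneg (ckNorm_nonneg _ _) (ckNorm_nonneg _ _))]

lemma exists_logConvexUpTo_gW (n : ℕ) (c₁ M : ℝ) :
    ∃ C : ℕ → ℝ, ∀ d : DirichletData n c₁ M, LogConvexUpTo C (gW d) := by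
  choose C hC h using exists_ckNorm_succ_le_sqrt n
  refine ⟨fun k => (1 + ∑ _a : Fin n, ∑ _b : Fin n, C k) ^ 2, fun d => ⟨gW_nonneg d, fun k => ?_⟩⟩
  have hG : 0 ≤ gW d k * gW d (k + 2) := mul_nonneg (gW_nonneg d _) (gW_nonneg d _)
  have h1 : gW d (k + 1) ≤ (1 + ∑ _a : Fin n, ∑ _b : Fin n, C k) * √(gW d k * gW d (k + 2)) := by
    rw [add_mul, Finset.sum_mul, one_mul]
    refine add_le_add (Real.le_sqrt_of_sq_le ?_) (Finset.sum_le_sum fun a _ => ?_)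
    · nlinarith [one_le_gW d k, one_le_gW d (k + 2)]
    rw [Finset.sum_mul]
    refine Finset.sum_le_sum fun b _ => (h k _ (smoothNear_metric d a b)).trans
      (mul_le_mul_of_nonneg_left (Real.sqrt_le_sqrt ?_) (hC k))
    exact mul_le_mul (ckNorm_metric_le_gW d a b k) (ckNorm_metric_le_gW d a b _)
      (ckNorm_nonneg _ _) (gW_nonneg d _)
  refine (pow_le_pow_left₀ (gW_nonneg d _) h1 2).trans (le_of_eq ?_)
  rw [mul_pow, Real.sq_sqrt hG]

lemma weightMul_raise_gW {m : ℕ} (hm : m ≤ 2) :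
    WeightMul (raise m gW) (raise m gW) (raise m (gW : DirichletData n c₁ M → ℕ → ℝ)) := by
  intro j l
  obtain ⟨B, hB, hb⟩ := exists_gW_two_le n c₁ M
  obtain ⟨C, hC⟩ := exists_logConvexUpTo_gW n c₁ M
  have hs : ∀ m, ∃ C' : ℕ → ℝ, ∀ d : DirichletData n c₁ M, LogConvexUpTo C' (raise m gW d) :=
    fun m => ⟨fun k => C (k + m), fun d => ⟨fun k => gW_nonneg d _, fun k => by
      simpa only [raise, add_right_comm] using (hC d).2 (k + m)⟩⟩
  obtain ⟨C', hC'⟩ := hs m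
  obtain ⟨E, hE, he⟩ := exists_interp_mul_le C' C' j l
  refine ⟨E * (B + B), by positivity, fun d => (he _ _ (hC' d) (hC' d)).trans ?_⟩
  have h1 : raise m gW d 0 ≤ B := (monotone_gW d (by lia)).trans (hb d)
  have h2 : 0 ≤ raise m gW d (j + l) := gW_nonneg d _
  rw [mul_assoc]
  refine mul_le_mul_of_nonneg_left ?_ hE
  nlinarith

lemma weightLE_raise {I : Type*} {w : I → ℕ → ℝ} (hw : ∀ i, Monotone (w i)) (m : ℕ) :
    WeightLE w (raise m w) := WeightLE.of_le fun i _ => hw i (Nat.le_add_right _ _)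

lemma weightMul_gW : WeightMul gW gW (gW : DirichletData n c₁ M → ℕ → ℝ) :=
  weightMul_raise_gW (m := 0) (by norm_num)

lemma raise_one_gW_nonneg (d : DirichletData n c₁ M) (k : ℕ) : 0 ≤ raise 1 gW d k := gW_nonneg _ _

lemma tame_invJac (a i : Fin n) : Tame ⊤ gW fun d : DirichletData n c₁ M => invJac d.x a i := by
  refine tame_of_pderiv_closed (ι := Fin n × Fin n)
    (h := fun p (d : DirichletData n c₁ M) => invJac d.x p.1 p.2) monotone_gW (fun p => ?_)
    (fun r hr p b => ?_) (a, i)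
  · refine ⟨fun d => d.smoothNear_invJac _ _, fun k hk => ⟨|c₁|, abs_nonneg _, fun d => ?_⟩⟩
    have hk : k = 0 := by simpa using hk
    subst hk
    refine (ckNorm_zero_le (abs_nonneg c₁) fun y hy => d.abs_invJac_le hy _ _).trans ?_
    exact le_mul_of_one_le_right (abs_nonneg _) (one_le_gW d 0)
  · have hr' : ∀ a i, Tame r (raise 1 gW) fun d : DirichletData n c₁ M => invJac d.x a i :=
      fun a i => (hr (a, i)).mono (weightLE_raise monotone_gW 1)
    have hmul := weightMul_raise_gW (n := n) (c₁ := c₁) (M := M) (m := 1) (by norm_num)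
    have hg : ∀ a b c, Tame r (raise 1 gW) fun d : DirichletData n c₁ M => pd c (metric d.x a b) :=
      fun a b c => ((tame_metric a b).pderiv c).of_le le_top
    have hmono : ∀ d : DirichletData n c₁ M, Monotone (raise 1 gW d) :=
      fun d => monotone_raise (monotone_gW d) 1
    have hΓ : ∀ c a b, Tame r (raise 1 gW) fun (d : DirichletData n c₁ M) y =>
        ∑ e, ∑ i, invJac d.x c i y * invJac d.x e i y * ((1 / 2 : ℝ) *
          (pd a (metric d.x b e) y + pd b (metric d.x a e) y - pd e (metric d.x a b) y)) :=
      fun c a b => Tame.sum raise_one_gW_nonneg fun e _ => Tame.sum raise_one_gW_nonneg fun i _ =>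
        ((hr' c i).mul (hr' e i) hmul).mul
          ((((hg b e a).add (hg a e b)).sub (hg a b e) hmono).const_mul _ hmono) hmul
    refine ((Tame.sum (s := Finset.univ) raise_one_gW_nonneg fun e _ =>
      (hΓ p.1 b e).mul (hr' e p.2) hmul).const_mul (-1) hmono).congr fun d y hy => ?_
    filter_upwards [eventually_det_ne_zero d.contDiff_x (d.det_ne_zero y hy)] with z hz
    rw [pd_invJac d.contDiff_x hz]
    simp only [christoffel_eq d.contDiff_x hz, neg_one_mul]

end Coefficients

section VectorFields

open scoped ContDiff Topology

variable {x : E' n → E' n} {c : Fin n → E' n → ℝ} {u v : E' n → ℝ} {y : E' n}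

lemma vf_congr (h : u =ᶠ[𝓝 y] v) : vf c u y = vf c v y := by
  simp only [vf, pd_congr h]

lemma vf_const (r : ℝ) (y : E' n) : vf c (fun _ => r) y = 0 := by
  simp [vf, pd_const]

lemma vf_add (hu : DifferentiableAt ℝ u y) (hv : DifferentiableAt ℝ v y) :
    vf c (fun z => u z + v z) y = vf c u y + vf c v y := by
  simp only [vf, pd_add hu hv, mul_add, Finset.sum_add_distrib]

lemma vf_mul (hu : DifferentiableAt ℝ u y) (hv : DifferentiableAt ℝ v y) :
    vf c (fun z => u z * v z) y = vf c u y * v y + u y * vf c v y := by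
  simp only [vf, pd_mul hu hv, mul_add, Finset.sum_add_distrib, Finset.sum_mul, Finset.mul_sum]
  congr 1
  · exact Finset.sum_congr rfl fun _ _ => by ring
  · exact Finset.sum_congr rfl fun _ _ => by ring

lemma epd_const (i : Fin n) (r : ℝ) (y : E' n) : epd x i (fun _ => r) y = 0 := by
  rw [epd_eq_vf, vf_const]

lemma epd_add (i : Fin n) (hu : DifferentiableAt ℝ u y) (hv : DifferentiableAt ℝ v y) :
    epd x i (fun z => u z + v z) y = epd x i u y + epd x i v y := by
  simp only [epd_eq_vf, vf_add hu hv]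

lemma epd_mul (i : Fin n) (hu : DifferentiableAt ℝ u y) (hv : DifferentiableAt ℝ v y) :
    epd x i (fun z => u z * v z) y = epd x i u y * v y + u y * epd x i v y := by
  simp only [epd_eq_vf, vf_mul hu hv]

lemma contDiffAt_epd (hx : ContDiff ℝ ∞ x) (h : (jacM x y).det ≠ 0) (hu : ContDiffAt ℝ ∞ u y)
    (i : Fin n) : ContDiffAt ℝ ∞ (epd x i u) y :=
  contDiffAt_vf (fun a => contDiffAt_invJac hx h a i) hu

lemma ContDiff.differentiableAt_top {u : E' n → F} (hu : ContDiff ℝ ∞ u) : DifferentiableAt ℝ u y :=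
  hu.contDiffAt.differentiableAt (by simp)

lemma ContDiffAt.differentiableAt_top {u : E' n → F} (hu : ContDiffAt ℝ ∞ u y) :
    DifferentiableAt ℝ u y := hu.differentiableAt (by simp)

lemma lapl_add (hx : ContDiff ℝ ∞ x) (h : (jacM x y).det ≠ 0) (hu : ContDiff ℝ ∞ u)
    (hv : ContDiff ℝ ∞ v) : lapl x (fun z => u z + v z) y = lapl x u y + lapl x v y := by
  rw [lapl_eq_sum_epd hx h (hu.add hv).contDiffAt, lapl_eq_sum_epd hx h hu.contDiffAt,
    lapl_eq_sum_epd hx h hv.contDiffAt, ← Finset.sum_add_distrib]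
  refine Finset.sum_congr rfl fun i _ => ?_
  have : epd x i (fun z => u z + v z) = fun z => epd x i u z + epd x i v z :=
    funext fun z => epd_add i hu.differentiableAt_top hv.differentiableAt_top
  rw [this]
  exact epd_add i (contDiffAt_epd hx h hu.contDiffAt i).differentiableAt_top
    (contDiffAt_epd hx h hv.contDiffAt i).differentiableAt_top

lemma lapl_mul (hx : ContDiff ℝ ∞ x) (h : (jacM x y).det ≠ 0) (hu : ContDiff ℝ ∞ u)
    (hv : ContDiff ℝ ∞ v) : lapl x (fun z => u z * v z) y =
      lapl x u y * v y + 2 * ∑ i, epd x i u y * epd x i v y + u y * lapl x v y := by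
  rw [lapl_eq_sum_epd hx h (hu.mul hv).contDiffAt, lapl_eq_sum_epd hx h hu.contDiffAt,
    lapl_eq_sum_epd hx h hv.contDiffAt, Finset.sum_mul, Finset.mul_sum, Finset.mul_sum,
    ← Finset.sum_add_distrib, ← Finset.sum_add_distrib]
  refine Finset.sum_congr rfl fun i _ => ?_
  have : epd x i (fun z => u z * v z) = fun z => epd x i u z * v z + u z * epd x i v z :=
    funext fun z => epd_mul i hu.differentiableAt_top hv.differentiableAt_top
  have hdu := (contDiffAt_epd hx h hu.contDiffAt i).differentiableAt_top
  have hdv := (contDiffAt_epd hx h hv.contDiffAt i).differentiableAt_top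
  rw [this, epd_add i (hdu.fun_mul (hv.differentiableAt_top (y := y)))
    ((hu.differentiableAt_top (y := y)).fun_mul hdv),
    epd_mul i hdu hv.differentiableAt_top, epd_mul i hu.differentiableAt_top hdv]
  ring

lemma lapl_const (hx : ContDiff ℝ ∞ x) (h : (jacM x y).det ≠ 0) (r : ℝ) :
    lapl x (fun _ => r) y = 0 := by
  rw [lapl_eq_sum_epd hx h contDiffAt_const]
  refine Finset.sum_eq_zero fun i _ => ?_
  have : epd x i (fun _ => r) = fun _ => 0 := funext fun z => epd_const i r z
  rw [this]
  exact epd_const i 0 y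

lemma lapl_const_mul (hx : ContDiff ℝ ∞ x) (h : (jacM x y).det ≠ 0) (r : ℝ) (hu : ContDiff ℝ ∞ u) :
    lapl x (fun z => r * u z) y = r * lapl x u y := by
  rw [lapl_mul hx h contDiff_const hu, lapl_const hx h]
  have : ∀ i, epd x i (fun _ => r) y = 0 := fun i => epd_const i r y
  simp [this]

lemma epd_coord {y : E' n} (h : (jacM x y).det ≠ 0) (i k : Fin n) :
    epd x k (fun z => x z i) y = if i = k then 1 else 0 := by
  rw [← sum_jac_mul_invJac h]
  exact Finset.sum_congr rfl fun a _ => mul_comm _ _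

lemma lapl_coord_sq (hx : ContDiff ℝ ∞ x) (h : (jacM x y).det ≠ 0) (i : Fin n) :
    lapl x (fun z => x z i * x z i) y = 2 := by
  have hi := contDiff_comp_apply hx i
  have h0 : lapl x (fun z => x z i) y = 0 := by
    rw [lapl_eq_sum_epd hx h hi.contDiffAt]
    refine Finset.sum_eq_zero fun k _ => ?_
    have : epd x k (fun z => x z i) =ᶠ[𝓝 y] fun _ => if i = k then 1 else 0 :=
      (eventually_det_ne_zero hx h).mono fun z hz => epd_coord hz i k
    rw [epd_eq_vf, vf_congr this, vf_const]
  rw [lapl_mul hx h hi hi, h0]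
  simp [epd_coord h]

lemma eqNear_lapl (hx : ContDiff ℝ ∞ x) (h : ∀ y ∈ Ball n, (jacM x y).det ≠ 0)
    (hu : ContDiff ℝ ∞ u) : EqNear (lapl x u) fun y => ∑ i, epd x i (epd x i u) y := fun y hy =>
  (eventually_det_ne_zero hx (h y hy)).mono fun _ hz => lapl_eq_sum_epd hx hz hu.contDiffAt

lemma smoothNear_epd (hx : ContDiff ℝ ∞ x) (h : ∀ y ∈ Ball n, (jacM x y).det ≠ 0)
    (hu : SmoothNear u) (i : Fin n) : SmoothNear (epd x i u) :=
  fun y hy => contDiffAt_epd hx (h y hy) (hu y hy) i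

lemma smoothNear_lapl (hx : ContDiff ℝ ∞ x) (h : ∀ y ∈ Ball n, (jacM x y).det ≠ 0)
    (hu : ContDiff ℝ ∞ u) : SmoothNear (lapl x u) :=
  (SmoothNear.sum fun i _ => smoothNear_epd hx h (smoothNear_epd hx h hu.smoothNear i) i).congr
    (eqNear_lapl hx h hu).symm

/-- Comparison principle on a compact set `{ρ ≤ η}`. -/
lemma nonpos_of_lapl_pos (hx : ContDiff ℝ ∞ x) (h : ∀ y ∈ Ball n, (jacM x y).det ≠ 0)
    (hu : ContDiff ℝ ∞ u) {φ : E' n → ℝ} (hφ : Continuous φ) {η : ℝ}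
    (hs : ∀ y ∈ Sphere' n, u y ≤ 0) (hη : ∀ y ∈ Ball n, φ y = η → u y ≤ 0)
    (hl : ∀ y ∈ Ball n, φ y < η → 0 < lapl x u y) {y : E' n} (hy : y ∈ Ball n) (hyη : φ y ≤ η) :
    u y ≤ 0 := by
  have hK : IsCompact (Ball n ∩ {y | φ y ≤ η}) :=
    isCompact_unitBall.inter_right (isClosed_le hφ continuous_const)
  obtain ⟨z, ⟨hzB, hzη⟩, hz⟩ := hK.exists_isMaxOn ⟨y, hy, hyη⟩ hu.continuous.continuousOn
  refine (hz ⟨hy, hyη⟩ : u y ≤ u z).trans ?_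
  rcases (show φ z ≤ η from hzη).eq_or_lt with he | hlt
  · exact hη z hzB he
  by_cases hzs : z ∈ Sphere' n
  · exact hs z hzs
  have hzb : z ∈ Metric.ball (0 : E' n) 1 := by
    simp only [Sphere', Ball, mem_sphere_iff_norm, sub_zero, Metric.mem_closedBall,
      dist_zero_right, mem_ball_zero_iff] at hzs hzB ⊢
    exact lt_of_le_of_ne hzB hzs
  have hm : IsLocalMax u z := by
    filter_upwards [Metric.isOpen_ball.mem_nhds hzb,
      (isOpen_lt hφ continuous_const).mem_nhds hlt] with w hw1 hw2
    exact hz ⟨ball_subset_unitBall hw1, le_of_lt hw2⟩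
  exact absurd (lapl_nonpos_of_isLocalMax hx (h z hzB) hu.contDiffAt hm) (hl z hzB hlt).not_ge

lemma DirichletData.norm_x_le {c₁ M : ℝ} (d : DirichletData n c₁ M) {y : E' n} (hy : y ∈ Ball n) :
    ‖d.x y‖ ≤ M :=
  (d.contDiff_x.smoothNear.norm_le hy).trans ((ckNorm_mono (by norm_num) _).trans d.ckNorm_x_le)

lemma DirichletData.le_of_lapl_lt {c₁ M : ℝ} (d : DirichletData n c₁ M) (i : Fin n)
    (hu : ContDiff ℝ ∞ u) (hs : ∀ y ∈ Sphere' n, u y = 0) {f : ℝ}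
    (hf : ∀ y ∈ Ball n, |lapl d.x u y| < f) {y : E' n} (hy : y ∈ Ball n) :
    u y ≤ M ^ 2 * f := by
  have hf0 : 0 < f := (abs_nonneg _).trans_lt (hf 0 zero_mem_unitBall)
  have hi := contDiff_comp_apply d.contDiff_x i
  have hb : ∀ z ∈ Ball n, d.x z i * d.x z i ≤ M ^ 2 := fun z hz => by
    rw [← sq]
    refine sq_le_sq' (neg_le_of_abs_le ?_) (le_of_abs_le ?_) <;>
    exact (PiLp.norm_apply_le (d.x z) i).trans (d.norm_x_le hz)
  have := nonpos_of_lapl_pos (u := fun z => u z + (f / 2 * (d.x z i * d.x z i) + -(f / 2 * M ^ 2)))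
    (φ := fun _ => 0) (η := 1) d.contDiff_x d.det_ne_zero
    (hu.add ((contDiff_const.mul (hi.mul hi)).add contDiff_const)) continuous_const
    (fun z hz => ?_) (fun _ _ h => by simp at h) (fun z hz _ => ?_) hy zero_le_one
  · have := mul_self_nonneg (d.x y i)
    nlinarith
  · have := hb z (Metric.sphere_subset_closedBall hz)
    have h0 := hs z hz
    nlinarith
  · have hd := d.det_ne_zero z hz
    rw [lapl_add d.contDiff_x hd hu ((contDiff_const.mul (hi.mul hi)).add contDiff_const),
      lapl_add d.contDiff_x hd (contDiff_const.mul (hi.mul hi)) contDiff_const,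
      lapl_const_mul d.contDiff_x hd _ (hi.mul hi), lapl_coord_sq d.contDiff_x hd,
      lapl_const d.contDiff_x hd]
    linarith [(abs_lt.1 (hf z hz)).1]

lemma lapl_neg (hx : ContDiff ℝ ∞ x) (h : (jacM x y).det ≠ 0) (hu : ContDiff ℝ ∞ u) :
    lapl x (fun z => -u z) y = -lapl x u y := by
  simpa using lapl_const_mul hx h (-1) hu

lemma DirichletData.ckNorm_zero_le_lapl {c₁ M : ℝ} (d : DirichletData n c₁ M) (hn : 0 < n)
    (hu : ContDiff ℝ ∞ u) (hs : ∀ y ∈ Sphere' n, u y = 0) :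
    ckNorm 0 u ≤ M ^ 2 * ckNorm 0 (lapl d.x u) := by
  have hsm := smoothNear_lapl d.contDiff_x d.det_ne_zero hu
  refine ckNorm_zero_le (mul_nonneg (sq_nonneg M) (ckNorm_nonneg _ _)) fun y hy => ?_
  refine le_of_forall_pos_le_add fun ε hε => ?_
  have hδ : 0 < ε / (M ^ 2 + 1) := by positivity
  have hlt : ∀ z ∈ Ball n, |lapl d.x u z| < ckNorm 0 (lapl d.x u) + ε / (M ^ 2 + 1) := fun z hz =>
    (hsm.abs_le_ckNorm 0 hz).trans_lt (lt_add_of_pos_right _ hδ)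
  have hle : M ^ 2 * (ε / (M ^ 2 + 1)) ≤ ε := by
    rw [← mul_div_assoc, div_le_iff₀ (by positivity)]
    nlinarith
  have h1 := d.le_of_lapl_lt ⟨0, hn⟩ hu hs hlt hy
  have h2 := d.le_of_lapl_lt (u := fun z => -u z) ⟨0, hn⟩ hu.neg (fun z hz => by simp [hs z hz])
    (fun z hz => by
      rw [lapl_neg d.contDiff_x (d.det_ne_zero z hz) hu, abs_neg]
      exact hlt z hz) hy
  rw [Real.norm_eq_abs]
  exact abs_le.2 ⟨by linarith, by linarith⟩

end VectorFields

section Barrier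

open scoped ContDiff Topology

variable {c₁ M : ℝ}

lemma Tame.vf {I : Type*} {N : ℕ∞} {w w' w'' : I → ℕ → ℝ} {c : Fin n → I → E' n → ℝ}
    {v : I → E' n → ℝ} (hc : ∀ a, Tame N w (c a)) (hv : ∀ a, Tame N w' fun i => pd a (v i))
    (hw : WeightMul w w' w'') (h0 : ∀ i k, 0 ≤ w'' i k) :
    Tame N w'' fun i => vf (fun a => c a i) (v i) :=
  Tame.sum h0 fun a _ => (hc a).mul (hv a) hw

lemma WeightMul.mono_left {I : Type*} {v w w' w'' : I → ℕ → ℝ} (h : WeightMul w w' w'')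
    (hv : WeightLE v w) (h0 : ∀ i k, 0 ≤ w' i k) : WeightMul v w' w'' := fun j l => by
  obtain ⟨C, hC, hb⟩ := h j l
  obtain ⟨D, hD, hd⟩ := hv j
  refine ⟨D * C, mul_nonneg hD hC, fun i => ?_⟩
  calc v i j * w' i l ≤ D * w i j * w' i l := mul_le_mul_of_nonneg_right (hd i) (h0 i l)
    _ ≤ D * (C * w'' i (j + l)) := by
      rw [mul_assoc]; exact mul_le_mul_of_nonneg_left (hb i) hD
    _ = _ := by ring

lemma weightMul_gW_raise {m : ℕ} (hm : m ≤ 2) :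
    WeightMul gW (raise m gW) (raise m (gW : DirichletData n c₁ M → ℕ → ℝ)) :=
  (weightMul_raise_gW hm).mono_left (weightLE_raise monotone_gW m) fun d _ => gW_nonneg d _

lemma raise_gW_nonneg (m : ℕ) (d : DirichletData n c₁ M) (k : ℕ) : 0 ≤ raise m gW d k := gW_nonneg _ _

lemma tame_epd_of_smoothNear {φ : E' n → ℝ} (hφ : SmoothNear φ) (i : Fin n) :
    Tame ⊤ gW fun d : DirichletData n c₁ M => epd d.x i φ :=
  Tame.vf (fun a => tame_invJac a i) (fun a => tame_of_forall_ckNorm_le (hφ.pderiv a) one_le_gW)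
    weightMul_gW gW_nonneg

lemma tame_lapl_of_contDiff {φ : E' n → ℝ} (hφ : ContDiff ℝ ∞ φ) :
    Tame ⊤ (raise 1 gW) fun d : DirichletData n c₁ M => lapl d.x φ := by
  refine (Tame.sum (s := Finset.univ) (raise_gW_nonneg 1) fun i _ => ?_).congr fun d =>
    (eqNear_lapl d.contDiff_x d.det_ne_zero hφ).symm
  exact Tame.vf (fun a => tame_invJac a i)
    (fun a => (tame_epd_of_smoothNear hφ.smoothNear i).pderiv a) (weightMul_gW_raise (by norm_num))
    (raise_gW_nonneg 1)

/-- The defining function `1 - |y|²` of the unit ball. -/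
def rho (y : E' n) : ℝ := 1 - ∑ a, y a * y a

lemma rho_eq (y : E' n) : rho y = 1 - ‖y‖ ^ 2 := by
  rw [EuclideanSpace.norm_sq_eq]
  simp [rho, sq]

lemma contDiff_rho : ContDiff ℝ ∞ (rho : E' n → ℝ) :=
  contDiff_const.sub (ContDiff.sum fun a _ =>
    (contDiff_comp_apply contDiff_id a).mul (contDiff_comp_apply contDiff_id a))

lemma rho_nonneg {y : E' n} (hy : y ∈ Ball n) : 0 ≤ rho y := by
  have : ‖y‖ ≤ 1 := by simpa [Ball] using hy
  rw [rho_eq]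
  nlinarith [norm_nonneg y]

lemma rho_eq_zero {y : E' n} (hy : y ∈ Sphere' n) : rho y = 0 := by
  have : ‖y‖ = 1 := by simpa [Sphere'] using hy
  rw [rho_eq, this]
  norm_num

lemma rho_le_dist {y z : E' n} (hy : y ∈ Ball n) (hz : z ∈ Sphere' n) : rho y ≤ 2 * ‖y - z‖ := by
  have h1 : ‖y‖ ≤ 1 := by simpa [Ball] using hy
  have h2 : ‖z‖ = 1 := by simpa [Sphere'] using hz
  have h3 : ‖z‖ ≤ ‖y‖ + ‖y - z‖ := by
    have := norm_sub_le y (y - z)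
    simpa using this
  rw [rho_eq]
  nlinarith [norm_nonneg y, norm_nonneg (y - z)]

lemma pd_rho (a : Fin n) (y : E' n) : pd a rho y = -(2 * y a) := by
  have h1 : ∀ b, DifferentiableAt ℝ (fun z : E' n => z b) y := fun b => differentiableAt_coord b y
  have h2 : rho = fun z : E' n => 1 + ∑ b, (-1 * z b) * z b := by
    funext z; simp [rho, sub_eq_add_neg]
  have h3 : ∀ b, DifferentiableAt ℝ (fun z : E' n => -1 * z b) y := fun b => (h1 b).const_mul _
  rw [h2, pd_add (differentiableAt_const _) (DifferentiableAt.fun_sum fun b _ => (h3 b).fun_mul (h1 b)),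
    pd_const, pd_sum fun b _ => (h3 b).fun_mul (h1 b)]
  have : ∀ b, pd a (fun z : E' n => -1 * z b * z b) y = if b = a then -(2 * y a) else 0 := fun b => by
    rw [pd_mul (h3 b) (h1 b), pd_mul (differentiableAt_const _) (h1 b), pd_const, pd_coord]
    split_ifs with h
    · subst h; ring
    · ring
  simp only [this, Finset.sum_ite_eq', Finset.mem_univ, if_true, zero_add]

/-- The squared length of the conormal `Σ_a K_{ai} y_a`. -/
def conormSq (x : E' n → E' n) (y : E' n) : ℝ := ∑ i, (∑ a, invJac x a i y * y a) ^ 2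

lemma epd_rho (x : E' n → E' n) (i : Fin n) (y : E' n) :
    epd x i rho y = -2 * ∑ a, invJac x a i y * y a := by
  simp only [epd_eq_vf, vf, pd_rho, Finset.mul_sum]
  exact Finset.sum_congr rfl fun _ _ => by ring

lemma DirichletData.norm_sq_le (d : DirichletData n c₁ M) {y : E' n} (hy : y ∈ Ball n) :
    ‖y‖ ^ 2 ≤ c₁ ^ 2 * conormSq d.x y := by
  have h0 : 0 ≤ conormSq d.x y := Finset.sum_nonneg fun _ _ => sq_nonneg _
  have h1 : ∀ b, y b ^ 2 ≤ (∑ i, jac d.x i b y ^ 2) * conormSq d.x y := fun b => by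
    have : y b = ∑ i, jac d.x i b y * ∑ a, invJac d.x a i y * y a := by
      simp only [Finset.mul_sum]
      rw [Finset.sum_comm]
      have : ∀ a, ∑ i, jac d.x i b y * (invJac d.x a i y * y a) = if a = b then y a else 0 := by
        intro a
        have h2 := congrArg (· * y a) (sum_invJac_mul_jac (d.det_ne_zero y hy) a b)
        simp only [ite_mul, one_mul, zero_mul, Finset.sum_mul] at h2
        rw [← h2]
        exact Finset.sum_congr rfl fun _ _ => by ring
      simp [this]
    rw [this]
    exact Finset.sum_mul_sq_le_sq_mul_sq _ _ _
  calc ‖y‖ ^ 2 = ∑ b, y b ^ 2 := by simp [EuclideanSpace.norm_sq_eq]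
    _ ≤ ∑ b, (∑ i, jac d.x i b y ^ 2) * conormSq d.x y := Finset.sum_le_sum fun b _ => h1 b
    _ = (∑ i, ∑ b, jac d.x i b y ^ 2) * conormSq d.x y := by
      rw [← Finset.sum_mul, Finset.sum_comm]
    _ ≤ _ := mul_le_mul_of_nonneg_right (d.sum_jac_sq_le hy) h0

lemma exists_abs_lapl_rho_le (n : ℕ) (c₁ M : ℝ) : ∃ C, 0 ≤ C ∧ ∀ d : DirichletData n c₁ M,
    ∀ y ∈ Ball n, |lapl d.x rho y| ≤ C := by
  obtain ⟨C, hC, h⟩ := (tame_lapl_of_contDiff (c₁ := c₁) (M := M) (contDiff_rho (n := n))).2 0 le_top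
  obtain ⟨B, hB, hb⟩ := exists_gW_two_le n c₁ M
  refine ⟨C * B, mul_nonneg hC hB, fun d y hy => ?_⟩
  refine ((smoothNear_lapl d.contDiff_x d.det_ne_zero contDiff_rho).abs_le_ckNorm 0 hy).trans
    ((h d).trans (mul_le_mul_of_nonneg_left ((monotone_gW d ?_).trans (hb d)) hC))
  norm_num

/-- The barrier estimate near the boundary. -/
lemma exists_le_mul_rho (n : ℕ) (c₁ M : ℝ) : ∃ η₀, 0 < η₀ ∧ η₀ ≤ 1 ∧ ∀ d : DirichletData n c₁ M,
    ∀ u : E' n → ℝ, ContDiff ℝ ∞ u → (∀ y ∈ Sphere' n, u y = 0) →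
    ∀ S f : ℝ, (∀ y ∈ Ball n, |u y| ≤ S) → (∀ y ∈ Ball n, |lapl d.x u y| < f) →
    ∀ η, 0 < η → η ≤ η₀ → ∀ y ∈ Ball n, u y ≤ (2 * S / η + η * (c₁ ^ 2 + 1) * f) * rho y := by
  obtain ⟨C, hC, hρ⟩ := exists_abs_lapl_rho_le n c₁ M
  have hc : 0 < c₁ ^ 2 + 1 := by positivity
  refine ⟨1 / (C * (c₁ ^ 2 + 1) + 2), by positivity, ?_, ?_⟩
  · rw [div_le_one (by positivity)]; nlinarith [mul_nonneg hC hc.le]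
  intro d u hu hs S f hS hf η hη hη₀ y hy
  have hS0 : 0 ≤ S := (abs_nonneg _).trans (hS 0 zero_mem_unitBall)
  have hf0 : 0 < f := (abs_nonneg _).trans_lt (hf 0 zero_mem_unitBall)
  set A := 2 * S / η + η * (c₁ ^ 2 + 1) * f with hA
  have hA0 : 0 < A := by positivity
  have hAη : A * η = 2 * S + η ^ 2 * (c₁ ^ 2 + 1) * f := by rw [hA]; field_simp
  have hSA : S ≤ A * η / 2 := by rw [hAη]; nlinarith [mul_pos (mul_pos (sq_pos_of_pos hη) hc) hf0]
  rw [le_div_iff₀ (by positivity)] at hη₀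
  rcases lt_or_ge η (rho y) with hlt | hle
  · refine (le_of_abs_le (hS y hy)).trans (hSA.trans ?_)
    nlinarith [mul_pos hA0 hη]
  set B := A / (2 * η) with hB
  have hBη : B * (2 * η) = A := by rw [hB]; field_simp
  have hB0 : 0 < B := by positivity
  have hcr : ContDiff ℝ ∞ fun z : E' n => -A * rho z := contDiff_const.mul contDiff_rho
  have hcr2 : ContDiff ℝ ∞ fun z : E' n => B * (rho z * rho z) :=
    contDiff_const.mul (contDiff_rho.mul contDiff_rho)
  have := nonpos_of_lapl_pos (u := fun z => u z + (-A * rho z + B * (rho z * rho z)))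
    (φ := rho) (η := η) d.contDiff_x d.det_ne_zero (hu.add (hcr.add hcr2)) contDiff_rho.continuous
    (fun z hz => ?_) (fun z hz h => ?_) (fun z hz hz' => ?_) hy hle
  · nlinarith [mul_nonneg hB0.le (mul_self_nonneg (rho y))]
  · simp [hs z hz, rho_eq_zero hz]
  · have := (le_of_abs_le (hS z hz)).trans hSA
    have h2 : B * (η * η) = A * η / 2 := by rw [← hBη]; ring
    rw [h]
    linarith
  · have hd := d.det_ne_zero z hz
    rw [lapl_add d.contDiff_x hd hu (hcr.add hcr2), lapl_add d.contDiff_x hd hcr hcr2,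
      lapl_const_mul d.contDiff_x hd _ contDiff_rho,
      lapl_const_mul d.contDiff_x hd _ (contDiff_rho.mul contDiff_rho),
      lapl_mul d.contDiff_x hd contDiff_rho contDiff_rho]
    have h1 : ∑ i, epd d.x i rho z * epd d.x i rho z = 4 * conormSq d.x z := by
      simp only [epd_rho, conormSq, Finset.mul_sum]
      exact Finset.sum_congr rfl fun _ _ => by simp only [← Finset.mul_sum]; ring
    rw [h1]
    have h2 := d.norm_sq_le hz
    have h3 := rho_eq z
    have h4 := rho_nonneg hz
    have h5 := abs_le.1 (hρ d z hz)
    have h6 := (abs_lt.1 (hf z hz)).1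
    have h0 : 0 ≤ conormSq d.x z := Finset.sum_nonneg fun _ _ => sq_nonneg _
    have hη2 : η ≤ 1 / 2 := by nlinarith [mul_nonneg (mul_nonneg hη.le hC) hc.le]
    have h7 : 1 / 2 ≤ (c₁ ^ 2 + 1) * conormSq d.x z := by nlinarith
    have h8 : -(A * C) ≤ (-A + 2 * B * rho z) * lapl d.x rho z := by
      have : |(-A + 2 * B * rho z) * lapl d.x rho z| ≤ A * C := by
        rw [abs_mul]
        refine mul_le_mul (abs_le.2 ⟨by nlinarith [mul_nonneg hB0.le h4], ?_⟩) (hρ d z hz)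
          (abs_nonneg _) hA0.le
        nlinarith [mul_le_mul_of_nonneg_left hz'.le hB0.le]
      exact (abs_le.1 this).1
    have h9 : f ≤ 8 * B * conormSq d.x z - A * C := by
      have e1 : A * C * ((c₁ ^ 2 + 1) * η) ≤ A * (1 - 2 * η) := by
        linarith [mul_le_mul_of_nonneg_left hη₀ hA0.le]
      have e2 : f * ((c₁ ^ 2 + 1) * η) ≤ A := by
        linarith [div_nonneg (mul_nonneg zero_le_two hS0) hη.le]
      have e3 : 8 * B * conormSq d.x z * ((c₁ ^ 2 + 1) * η) ≥ 2 * A := by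
        have : 8 * B * conormSq d.x z * ((c₁ ^ 2 + 1) * η) =
          4 * A * ((c₁ ^ 2 + 1) * conormSq d.x z) := by rw [← hBη]; ring
        rw [this]; linarith [mul_le_mul_of_nonneg_left h7 hA0.le]
      have hp : 0 < (c₁ ^ 2 + 1) * η := by positivity
      refine le_of_mul_le_mul_right ?_ hp
      rw [sub_mul]
      linarith [mul_pos hA0 hη]
    linarith

end Barrier

section GradientEstimate

open scoped ContDiff Topology

variable {c₁ M : ℝ}

lemma DirichletData.norm_fderiv_x_le (d : DirichletData n c₁ M) {y : E' n} (hy : y ∈ Ball n)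
    (w : E' n) : ‖fderiv ℝ d.x y w‖ ≤ |c₁| * ‖w‖ := by
  refine abs_le_of_sq_le_sq' ?_ (by positivity) |>.2
  rw [EuclideanSpace.norm_sq_eq, mul_pow, sq_abs, EuclideanSpace.norm_sq_eq]
  simp only [fderiv_apply_coord d.contDiff_x, Real.norm_eq_abs, sq_abs]
  calc ∑ i, (∑ a, jac d.x i a y * w a) ^ 2
      ≤ ∑ i, (∑ a, jac d.x i a y ^ 2) * ∑ a, w a ^ 2 :=
        Finset.sum_le_sum fun i _ => Finset.sum_mul_sq_le_sq_mul_sq _ _ _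
    _ ≤ _ := by
      rw [← Finset.sum_mul]
      exact mul_le_mul_of_nonneg_right (d.sum_jac_sq_le hy) (Finset.sum_nonneg fun _ _ => sq_nonneg _)

lemma DirichletData.norm_le_norm_fderiv_x (d : DirichletData n c₁ M) {y : E' n} (hy : y ∈ Ball n)
    (w : E' n) : ‖w‖ ≤ |c₁| * ‖fderiv ℝ d.x y w‖ := by
  refine abs_le_of_sq_le_sq' ?_ (by positivity) |>.2
  rw [EuclideanSpace.norm_sq_eq, mul_pow, sq_abs, EuclideanSpace.norm_sq_eq]
  simp only [Real.norm_eq_abs, sq_abs]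
  have h1 : ∀ b, w b = ∑ i, invJac d.x b i y * fderiv ℝ d.x y w i := fun b => by
    simp only [fderiv_apply_coord d.contDiff_x, Finset.mul_sum, ← mul_assoc]
    rw [Finset.sum_comm]
    simp [← Finset.sum_mul, sum_invJac_mul_jac (d.det_ne_zero y hy)]
  calc ∑ b, w b ^ 2 ≤ ∑ b, (∑ i, invJac d.x b i y ^ 2) * ∑ i, fderiv ℝ d.x y w i ^ 2 :=
        Finset.sum_le_sum fun b _ => by
          rw [h1 b]
          exact Finset.sum_mul_sq_le_sq_mul_sq _ _ _
    _ ≤ _ := by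
      rw [← Finset.sum_mul]
      exact mul_le_mul_of_nonneg_right (d.sum_invJac_sq_le hy)
        (Finset.sum_nonneg fun _ _ => sq_nonneg _)

lemma DirichletData.norm_x_sub_le (d : DirichletData n c₁ M) {y z : E' n} (hy : y ∈ Ball n)
    (hz : z ∈ Ball n) : ‖d.x y - d.x z‖ ≤ |c₁| * ‖y - z‖ :=
  convex_unitBall.norm_image_sub_le_of_norm_fderiv_le (𝕜 := ℝ)
    (fun _ _ => d.contDiff_x.differentiableAt_top)
    (fun _ hw => ContinuousLinearMap.opNorm_le_bound _ (abs_nonneg _) fun v =>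
      d.norm_fderiv_x_le hw v) hz hy

lemma DirichletData.norm_sub_le (d : DirichletData n c₁ M) {y z : E' n} (hy : y ∈ Ball n)
    (hz : z ∈ Ball n) {h : ℝ} (hh : 2 * ((|c₁| + 1) * M) * h ≤ 1) (hyz : ‖y - z‖ ≤ h) :
    ‖y - z‖ ≤ 2 * (|c₁| + 1) * ‖d.x y - d.x z‖ := by
  have h1 := d.contDiff_x.smoothNear.norm_taylor_le hz hy
  have h2 := d.norm_le_norm_fderiv_x hz (y - z)
  have h3 := (ckNorm_mono (by norm_num : 2 ≤ 3) d.x).trans d.ckNorm_x_le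
  have h4 := norm_sub_norm_le (fderiv ℝ d.x z (y - z)) (d.x y - d.x z)
  rw [norm_sub_rev (fderiv ℝ d.x z (y - z)) (d.x y - d.x z)] at h4
  have hM : 0 ≤ M := (ckNorm_nonneg _ _).trans d.ckNorm_x_le
  have hc := abs_nonneg c₁
  have hδ := norm_nonneg (y - z)
  have h5 : ckNorm 2 d.x * ‖y - z‖ ^ 2 ≤ M * (h * ‖y - z‖) := by
    refine mul_le_mul h3 ?_ (by positivity) hM
    rw [sq]
    exact mul_le_mul_of_nonneg_right hyz hδ
  have h6 : ‖fderiv ℝ d.x z (y - z)‖ ≤ ‖d.x y - d.x z‖ + M * (h * ‖y - z‖) := by linarith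
  have h7 : ‖y - z‖ ≤ (|c₁| + 1) * (‖d.x y - d.x z‖ + M * (h * ‖y - z‖)) := by
    refine h2.trans (mul_le_mul (by linarith) h6 (norm_nonneg _) (by linarith))
  nlinarith [mul_le_mul_of_nonneg_right hh hδ]

lemma abs_pd_le_of_lipschitz {u : E' n → ℝ} (hu : ContDiff ℝ ∞ u) {L h : ℝ} (hL : 0 ≤ L) (hh : 0 < h)
    (hlip : ∀ y ∈ Ball n, ∀ z ∈ Ball n, ‖y - z‖ ≤ h → u y - u z ≤ L * ‖y - z‖) (a : Fin n)
    {y : E' n} (hy : y ∈ Ball n) : |pd a u y| ≤ L := by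
  have hcont : Continuous (pd a u) :=
    (hu.continuous_fderiv (by simp)).clm_apply continuous_const
  have hcl : IsClosed {y : E' n | |pd a u y| ≤ L} := isClosed_le hcont.abs continuous_const
  have hsub : Metric.ball (0 : E' n) 1 ⊆ {y : E' n | |pd a u y| ≤ L} := by
    intro y hy
    have h1 : ‖fderiv ℝ u y‖ ≤ L := by
      refine (hu.differentiableAt_top (y := y)).hasFDerivAt.le_of_lip' hL ?_
      filter_upwards [Metric.isOpen_ball.mem_nhds hy, Metric.closedBall_mem_nhds y hh] with z hz hzh
      have hz' := ball_subset_unitBall hz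
      have hy' := ball_subset_unitBall hy
      rw [Metric.mem_closedBall, dist_eq_norm] at hzh
      have h1 := hlip z hz' y hy' hzh
      have h2 := hlip y hy' z hz' (by rwa [norm_sub_rev])
      rw [norm_sub_rev y z] at h2
      rw [Real.norm_eq_abs]
      exact abs_le.2 ⟨by linarith, by linarith⟩
    have h2 := (fderiv ℝ u y).le_opNorm (EuclideanSpace.single a 1)
    rw [PiLp.norm_single, norm_one, mul_one, Real.norm_eq_abs] at h2
    exact h2.trans h1
  have := hcl.closure_subset_iff.2 hsub
  rw [closure_ball 0 one_ne_zero] at this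
  exact this hy

lemma mem_ball_of_notMem_sphere {y : E' n} (hy : y ∈ Ball n) (hs : y ∉ Sphere' n) :
    y ∈ Metric.ball (0 : E' n) 1 := by
  simp only [Sphere', Ball, mem_sphere_iff_norm, sub_zero, Metric.mem_closedBall,
    dist_zero_right, mem_ball_zero_iff] at hs hy ⊢
  exact lt_of_le_of_ne hy hs

/-- Lipschitz estimate by doubling of variables. -/
lemma DirichletData.sub_le_of_barrier (d : DirichletData n c₁ M) {u : E' n → ℝ}
    (hu : ContDiff ℝ ∞ u) (hs : ∀ y ∈ Sphere' n, u y = 0) {S f A h : ℝ}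
    (hS : ∀ y ∈ Ball n, |u y| ≤ S) (hf : ∀ y ∈ Ball n, |lapl d.x u y| < f)
    (hA : ∀ y ∈ Ball n, |u y| ≤ A * rho y) (hA0 : 0 ≤ A) (hh0 : 0 < h)
    (hh : 2 * ((|c₁| + 1) * M) * h ≤ 1) :
    ∀ y ∈ Ball n, ∀ z ∈ Ball n, ‖y - z‖ ≤ h → u y - u z ≤
      (8 * (|c₁| + 1) * S / h + 8 * (|c₁| + 1) * A + (|c₁| + 1) * f * h) * ‖d.x y - d.x z‖ := by
  set c := |c₁| + 1 with hc
  have hc1 : 1 ≤ c := by linarith [abs_nonneg c₁]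
  have hS0 : 0 ≤ S := (abs_nonneg _).trans (hS 0 zero_mem_unitBall)
  have hf0 : 0 < f := (abs_nonneg _).trans_lt (hf 0 zero_mem_unitBall)
  set L := 8 * c * S / h + 8 * c * A + c * f * h with hL
  have hL0 : 0 ≤ L := by positivity
  set ψ : E' n × E' n → ℝ := fun p =>
    u p.1 - u p.2 - (L * ‖d.x p.1 - d.x p.2‖ - f / 4 * ‖d.x p.1 - d.x p.2‖ ^ 2) with hψ
  have hxc := d.contDiff_x.continuous
  have huc := hu.continuous
  have hψc : Continuous ψ := by fun_prop
  have hK : IsCompact ((Ball n ×ˢ Ball n) ∩ {p : E' n × E' n | ‖p.1 - p.2‖ ≤ h}) :=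
    (isCompact_unitBall.prod isCompact_unitBall).inter_right
      (isClosed_le (by fun_prop) continuous_const)
  obtain ⟨⟨y, z⟩, ⟨⟨hy, hz⟩, hyz⟩, hmax⟩ := hK.exists_isMaxOn
    ⟨((0 : E' n), (0 : E' n)), ⟨zero_mem_unitBall, zero_mem_unitBall⟩, by simpa using hh0.le⟩
    hψc.continuousOn
  simp only at hy hz hyz
  have main : ψ (y, z) ≤ 0 := by
    by_contra! hpos
    have hne : d.x y ≠ d.x z := by
      intro he
      have h1 := d.norm_sub_le hy hz hh hyz
      rw [he, sub_self, norm_zero, mul_zero] at h1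
      have h2 : y = z := by simpa [sub_eq_zero] using h1
      subst h2
      simp [hψ] at hpos
    have hδσ := d.norm_sub_le hy hz hh hyz
    have hσδ : ‖d.x y - d.x z‖ ≤ c * ‖y - z‖ :=
      (d.norm_x_sub_le hy hz).trans (mul_le_mul_of_nonneg_right (by linarith) (norm_nonneg _))
    rw [← hc] at hδσ
    have hσ0 := norm_nonneg (d.x y - d.x z)
    have hσh : ‖d.x y - d.x z‖ ≤ c * h := hσδ.trans (mul_le_mul_of_nonneg_left hyz (by linarith))
    have hlow : L / 2 * ‖d.x y - d.x z‖ ≤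
        L * ‖d.x y - d.x z‖ - f / 4 * ‖d.x y - d.x z‖ ^ 2 := by
      have h1 : f / 4 * ‖d.x y - d.x z‖ ≤ L / 2 := by
        have h2 : f / 4 * ‖d.x y - d.x z‖ ≤ f / 4 * (c * h) :=
          mul_le_mul_of_nonneg_left hσh (by linarith)
        have h3 : 0 ≤ 8 * c * S / h + 8 * c * A := by positivity
        have h4 : 0 ≤ c * f * h := by positivity
        nlinarith
      nlinarith [mul_le_mul_of_nonneg_right h1 hσ0]
    have hbad : L / (4 * c) * ‖y - z‖ < u y - u z := by
      have h1 : L / (4 * c) * ‖y - z‖ ≤ L / 2 * ‖d.x y - d.x z‖ := by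
        calc L / (4 * c) * ‖y - z‖ ≤ L / (4 * c) * (2 * c * ‖d.x y - d.x z‖) :=
              mul_le_mul_of_nonneg_left hδσ (by positivity)
          _ = _ := by field_simp; ring
      simp only [hψ] at hpos
      linarith
    have hL4 : 2 * S / h + 2 * A ≤ L / (4 * c) := by
      have : L / (4 * c) = 2 * S / h + 2 * A + f * h / 4 := by rw [hL]; field_simp; ring
      rw [this]
      linarith [mul_pos hf0 hh0]
    have hSh : 0 ≤ 2 * S / h := by positivity
    have hL4A : 2 * A ≤ L / (4 * c) := by linarith
    have hδ := norm_nonneg (y - z)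
    have hAδ := mul_le_mul_of_nonneg_right hL4A hδ
    have hlt : ‖y - z‖ < h := by
      refine lt_of_le_of_ne hyz fun he => ?_
      rw [he] at hbad
      have h1 := abs_le.1 (hS y hy)
      have h2 := abs_le.1 (hS z hz)
      have h3 : 2 * S / h * h = 2 * S := by field_simp
      have h4 : 2 * S / h * h ≤ L / (4 * c) * h :=
        mul_le_mul_of_nonneg_right (by linarith) hh0.le
      linarith
    have hys : y ∉ Sphere' n := fun hys => by
      have h1 := rho_le_dist hz hys
      rw [norm_sub_rev] at h1
      have h2 := abs_le.1 (hA z hz)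
      have h3 := hs y hys
      linarith [mul_le_mul_of_nonneg_left h1 hA0]
    have hzs : z ∉ Sphere' n := fun hzs => by
      have h1 := rho_le_dist hy hzs
      have h2 := abs_le.1 (hA y hy)
      have h3 := hs z hzs
      linarith [mul_le_mul_of_nonneg_left h1 hA0]
    have hloc : ∀ᶠ p in 𝓝 (y, z), ψ p ≤ ψ (y, z) := by
      filter_upwards [(Metric.isOpen_ball.prod Metric.isOpen_ball).mem_nhds
        (⟨mem_ball_of_notMem_sphere hy hys, mem_ball_of_notMem_sphere hz hzs⟩ :
          (y, z) ∈ Metric.ball (0 : E' n) 1 ×ˢ Metric.ball (0 : E' n) 1),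
        (isOpen_lt (f := fun p : E' n × E' n => ‖p.1 - p.2‖) (by fun_prop)
          continuous_const).mem_nhds hlt] with p hp1 hp2
      exact hmax ⟨⟨ball_subset_unitBall hp1.1, ball_subset_unitBall hp1.2⟩, le_of_lt hp2⟩
    have hfin := lapl_sub_lapl_le d.contDiff_x (d.det_ne_zero y hy) (d.det_ne_zero z hz)
      hu.contDiffAt hu.contDiffAt hne hloc
    have h1 := abs_lt.1 (hf y hy)
    have h2 := abs_lt.1 (hf z hz)
    linarith
  intro y' hy' z' hz' hyz'
  have h1 : ψ (y', z') ≤ 0 :=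
    (show ψ (y', z') ≤ ψ (y, z) from hmax ⟨⟨hy', hz'⟩, hyz'⟩).trans main
  simp only [hψ] at h1
  nlinarith [mul_nonneg hf0.le (sq_nonneg ‖d.x y' - d.x z'‖)]

lemma exists_abs_pd_le_of_lapl_lt (n : ℕ) (c₁ M : ℝ) : ∃ C, 0 ≤ C ∧ ∀ d : DirichletData n c₁ M,
    ∀ u : E' n → ℝ, ContDiff ℝ ∞ u → (∀ y ∈ Sphere' n, u y = 0) →
    ∀ S f : ℝ, (∀ y ∈ Ball n, |u y| ≤ S) → (∀ y ∈ Ball n, |lapl d.x u y| < f) →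
    ∀ ε, 0 < ε → ε ≤ 1 → ∀ a, ∀ y ∈ Ball n, |pd a u y| ≤ C * (S / ε + ε * f) := by
  obtain ⟨η₀, hη₀, hη₁, hbar⟩ := exists_le_mul_rho n c₁ M
  set c := |c₁| + 1 with hc
  have hc1 : 1 ≤ c := by linarith [abs_nonneg c₁]
  set κ := min η₀ (1 / (2 * (c * |M|) + 1)) with hκ
  have hκ0 : 0 < κ := lt_min hη₀ (by positivity)
  have hκη : κ ≤ η₀ := min_le_left _ _
  have hκM : κ * (2 * (c * |M|) + 1) ≤ 1 := by
    rw [← le_div_iff₀ (by positivity)]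
    exact min_le_right _ _
  refine ⟨c * (24 * c / κ + 8 * c * (c₁ ^ 2 + 1) * κ + c * κ), by positivity, ?_⟩
  intro d u hu hs S f hS hf ε hε hε1 a y hy
  have hS0 : 0 ≤ S := (abs_nonneg _).trans (hS 0 zero_mem_unitBall)
  have hf0 : 0 < f := (abs_nonneg _).trans_lt (hf 0 zero_mem_unitBall)
  have hM : 0 ≤ M := (ckNorm_nonneg _ _).trans d.ckNorm_x_le
  have hh0 : 0 < κ * ε := mul_pos hκ0 hε
  have hhκ : κ * ε ≤ κ := mul_le_of_le_one_right hκ0.le hε1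
  set A := 2 * S / (κ * ε) + (κ * ε) * (c₁ ^ 2 + 1) * f with hA
  have hA0 : 0 ≤ A := by positivity
  have hAr : ∀ y ∈ Ball n, |u y| ≤ A * rho y := fun y hy => by
    refine abs_le.2 ⟨?_, hbar d u hu hs S f hS hf _ hh0 (hhκ.trans hκη) y hy⟩
    have := hbar d (fun z => -u z) hu.neg (fun z hz => by simp [hs z hz]) S f
      (fun z hz => by simpa using hS z hz) (fun z hz => by
        rw [lapl_neg d.contDiff_x (d.det_ne_zero z hz) hu, abs_neg]
        exact hf z hz) _ hh0 (hhκ.trans hκη) y hy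
    linarith
  have hh : 2 * ((|c₁| + 1) * M) * (κ * ε) ≤ 1 := by
    rw [abs_of_nonneg hM] at hκM
    rw [← hc]
    have : 2 * (c * M) * (κ * ε) ≤ 2 * (c * M) * κ := mul_le_mul_of_nonneg_left hhκ (by positivity)
    linarith
  have hlip := d.sub_le_of_barrier hu hs hS hf hAr hA0 hh0 hh
  rw [← hc] at hlip
  set L := 8 * c * S / (κ * ε) + 8 * c * A + c * f * (κ * ε) with hL
  have hL0 : 0 ≤ L := by positivity
  refine (abs_pd_le_of_lipschitz hu (mul_nonneg hL0 (by positivity)) hh0 (L := L * c)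
    (fun y hy z hz h => (hlip y hy z hz h).trans ?_) a hy).trans ?_
  · rw [mul_assoc]
    refine mul_le_mul_of_nonneg_left ((d.norm_x_sub_le hy hz).trans ?_) hL0
    exact mul_le_mul_of_nonneg_right (by linarith) (norm_nonneg _)
  · have e : L * c = c * (24 * c / κ * (S / ε)
        + (8 * c * (c₁ ^ 2 + 1) * κ + c * κ) * (ε * f)) := by
      rw [hL, hA]; field_simp; ring
    rw [e, mul_assoc c (24 * c / κ + _ + _)]
    refine mul_le_mul_of_nonneg_left ?_ (by linarith)
    have p1 : 0 ≤ 24 * c / κ * (ε * f) := by positivity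
    have p2 : 0 ≤ (8 * c * (c₁ ^ 2 + 1) * κ + c * κ) * (S / ε) := by positivity
    linarith

/-- The interpolated gradient estimate for the Dirichlet problem. -/
lemma exists_abs_pd_le (n : ℕ) (c₁ M : ℝ) : ∃ C, 0 ≤ C ∧ ∀ d : DirichletData n c₁ M,
    ∀ u : E' n → ℝ, ContDiff ℝ ∞ u → (∀ y ∈ Sphere' n, u y = 0) →
    ∀ ε, 0 < ε → ε ≤ 1 → ∀ a,
      ckNorm 0 (pd a u) ≤ C * (ckNorm 0 u / ε + ε * ckNorm 0 (lapl d.x u)) := by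
  obtain ⟨C, hC, h⟩ := exists_abs_pd_le_of_lapl_lt n c₁ M
  refine ⟨C, hC, fun d u hu hs ε hε hε1 a => ckNorm_zero_le ?_ fun y hy => ?_⟩
  · exact mul_nonneg hC (add_nonneg (div_nonneg (ckNorm_nonneg _ _) hε.le)
      (mul_nonneg hε.le (ckNorm_nonneg _ _)))
  rw [Real.norm_eq_abs]
  refine le_of_forall_pos_le_add fun δ hδ => ?_
  have hδ' : 0 < δ / (C + 1) := by positivity
  have h1 := h d u hu hs (ckNorm 0 u) (ckNorm 0 (lapl d.x u) + δ / (C + 1))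
    (fun z hz => hu.smoothNear.abs_le_ckNorm 0 hz)
    (fun z hz => ((smoothNear_lapl d.contDiff_x d.det_ne_zero hu).abs_le_ckNorm 0 hz).trans_lt
      (lt_add_of_pos_right _ hδ')) ε hε hε1 a y hy
  have h2 : C * (ε * (δ / (C + 1))) ≤ δ := by
    have : C * (δ / (C + 1)) ≤ δ := by
      rw [← mul_div_assoc, div_le_iff₀ (by positivity)]
      nlinarith
    calc C * (ε * (δ / (C + 1))) = ε * (C * (δ / (C + 1))) := by ring
      _ ≤ 1 * (C * (δ / (C + 1))) := mul_le_mul_of_nonneg_right hε1 (by positivity)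
      _ ≤ δ := by linarith
  linarith

end GradientEstimate

section Commutators

open scoped ContDiff Topology

variable {x : E' n → E' n} {c e : Fin n → E' n → ℝ} {u v : E' n → ℝ} {y : E' n}

lemma vf_vf (he : ∀ b, DifferentiableAt ℝ (e b) y) (hv : ContDiffAt ℝ ∞ v y) :
    vf c (vf e v) y = ∑ a, ∑ b, c a y * (pd a (e b) y * pd b v y + e b y * pd a (pd b v) y) := by
  refine Finset.sum_congr rfl fun a _ => ?_
  have h := fun b => (hv.pderiv b).differentiableAt_top
  rw [show vf e v = fun z => ∑ b, e b z * pd b v z from rfl,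
    pd_sum fun b _ => (he b).fun_mul (h b), Finset.mul_sum]
  exact Finset.sum_congr rfl fun b _ => by rw [pd_mul (he b) (h b)]

lemma vf_commutator (hc : ∀ b, DifferentiableAt ℝ (c b) y) (he : ∀ b, DifferentiableAt ℝ (e b) y)
    (hv : ContDiffAt ℝ ∞ v y) :
    vf c (vf e v) y = vf e (vf c v) y + vf (fun a z => vf c (e a) z - vf e (c a) z) v y := by
  have h2 : ContDiffAt ℝ 2 v y := hv.of_le (WithTop.coe_le_coe.2 le_top)
  rw [vf_vf he hv, vf_vf hc hv]
  simp only [vf, sub_mul, mul_add, Finset.sum_add_distrib, Finset.sum_sub_distrib, Finset.sum_mul]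
  have h3 : ∑ a, ∑ b, c a y * (e b y * pd a (pd b v) y) =
      ∑ a, ∑ b, e a y * (c b y * pd a (pd b v) y) := by
    rw [Finset.sum_comm]
    refine Finset.sum_congr rfl fun a _ => Finset.sum_congr rfl fun b _ => ?_
    rw [pd_comm h2 b a]
    ring
  rw [h3, Finset.sum_comm (f := fun a b => c a y * (pd a (e b) y * pd b v y)),
    Finset.sum_comm (f := fun a b => e a y * (pd a (c b) y * pd b v y))]
  simp only [← mul_assoc]
  ring

lemma vf_sum {ι : Type*} {s : Finset ι} {f : ι → E' n → ℝ}
    (hf : ∀ i ∈ s, DifferentiableAt ℝ (f i) y) :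
    vf c (fun z => ∑ i ∈ s, f i z) y = ∑ i ∈ s, vf c (f i) y := by
  simp only [vf, pd_sum hf, Finset.mul_sum]
  exact Finset.sum_comm

lemma contDiff_pd (hv : ContDiff ℝ ∞ v) (a : Fin n) : ContDiff ℝ ∞ (pd a v) :=
  contDiff_iff_contDiffAt.2 fun _ => hv.contDiffAt.pderiv a

lemma contDiff_vf (hc : ∀ a, ContDiff ℝ ∞ (c a)) (hv : ContDiff ℝ ∞ v) : ContDiff ℝ ∞ (vf c v) :=
  contDiff_iff_contDiffAt.2 fun _ => contDiffAt_vf (fun a => (hc a).contDiffAt) hv.contDiffAt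

/-- The coefficients of the commutator of `∂_i` with the vector field `e`. -/
def commCoef (x : E' n → E' n) (e : Fin n → E' n → ℝ) (i a : Fin n) (y : E' n) : ℝ :=
  epd x i (e a) y - vf e (invJac x a i) y

lemma epd_vf (hx : ContDiff ℝ ∞ x) (h : (jacM x y).det ≠ 0) (he : ∀ b, ContDiff ℝ ∞ (e b))
    (hv : ContDiffAt ℝ ∞ v y) (i : Fin n) :
    epd x i (vf e v) y = vf e (epd x i v) y + vf (commCoef x e i) v y :=
  vf_commutator (fun b => (contDiffAt_invJac hx h b i).differentiableAt_top)
    (fun b => (he b).differentiableAt_top) hv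

lemma contDiffAt_commCoef (hx : ContDiff ℝ ∞ x) (h : (jacM x y).det ≠ 0)
    (he : ∀ b, ContDiff ℝ ∞ (e b)) (i a : Fin n) : ContDiffAt ℝ ∞ (commCoef x e i a) y :=
  (contDiffAt_epd hx h (he a).contDiffAt i).sub
    (contDiffAt_vf (fun b => (he b).contDiffAt) (contDiffAt_invJac hx h a i))

lemma lapl_vf (hx : ContDiff ℝ ∞ x) (h : (jacM x y).det ≠ 0) (he : ∀ b, ContDiff ℝ ∞ (e b))
    (hv : ContDiff ℝ ∞ v) : lapl x (vf e v) y = vf e (lapl x v) y +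
      ∑ i, (vf (commCoef x e i) (epd x i v) y + epd x i (vf (commCoef x e i) v) y) := by
  have hE := fun i => contDiffAt_epd hx h hv.contDiffAt i
  have hl : lapl x v =ᶠ[𝓝 y] fun z => ∑ i, epd x i (epd x i v) z :=
    (eventually_det_ne_zero hx h).mono fun z hz => lapl_eq_sum_epd hx hz hv.contDiffAt
  rw [lapl_eq_sum_epd hx h (contDiff_vf he hv).contDiffAt, vf_congr hl,
    vf_sum fun i _ => (contDiffAt_epd hx h (hE i) i).differentiableAt_top, ← Finset.sum_add_distrib]
  refine Finset.sum_congr rfl fun i _ => ?_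
  have h1 : epd x i (vf e v) =ᶠ[𝓝 y] fun z => vf e (epd x i v) z + vf (commCoef x e i) v z :=
    (eventually_det_ne_zero hx h).mono fun z hz => epd_vf hx hz he hv.contDiffAt i
  have h2 : epd x i (epd x i (vf e v)) y =
      epd x i (fun z => vf e (epd x i v) z + vf (commCoef x e i) v z) y := by
    simp only [epd_eq_vf] at h1 ⊢
    exact vf_congr h1
  rw [h2, epd_add i (contDiffAt_vf (fun b => (he b).contDiffAt) (hE i)).differentiableAt_top
    (contDiffAt_vf (contDiffAt_commCoef hx h he i) hv.contDiffAt).differentiableAt_top,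
    epd_vf hx h he (hE i)]
  ring

/-- The coefficients of the tangential vector field `∂_b - y_b Σ_c y_c ∂_c`. -/
def tangCoef (b c : Fin n) (y : E' n) : ℝ := (if c = b then 1 else 0) - y b * y c

/-- The tangential derivatives. -/
def tang (b : Fin n) (v : E' n → ℝ) : E' n → ℝ := vf (tangCoef b) v

/-- Iterated tangential derivatives. -/
def tangWord (α : List (Fin n)) (v : E' n → ℝ) : E' n → ℝ := α.foldr tang v

lemma contDiff_coord (b : Fin n) : ContDiff ℝ ∞ fun z : E' n => z b :=
  contDiff_comp_apply contDiff_id b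

lemma contDiff_tangCoef (b c : Fin n) : ContDiff ℝ ∞ (tangCoef b c) :=
  contDiff_const.sub ((contDiff_coord b).mul (contDiff_coord c))

lemma contDiff_tang (hv : ContDiff ℝ ∞ v) (b : Fin n) : ContDiff ℝ ∞ (tang b v) :=
  contDiff_vf (contDiff_tangCoef b) hv

lemma contDiff_tangWord (hv : ContDiff ℝ ∞ v) (α : List (Fin n)) : ContDiff ℝ ∞ (tangWord α v) := by
  induction α with
  | nil => exact hv
  | cons b α ih => exact contDiff_tang ih b

lemma tang_eq_zero (hv : ContDiff ℝ ∞ v) (hs : ∀ y ∈ Sphere' n, v y = 0) (b : Fin n)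
    (hy : y ∈ Sphere' n) : tang b v y = 0 := by
  have hy1 : ‖y‖ = 1 := by simpa [Sphere'] using hy
  set t : E' n := WithLp.toLp 2 fun c => tangCoef b c y with ht
  have hsq : ∑ c, y c * y c = 1 := by
    have := rho_eq_zero hy
    rw [rho] at this
    linarith
  have horth : inner ℝ y t = 0 := by
    have : ∀ c, y c * tangCoef b c y = (if c = b then y b else 0) - y b * (y c * y c) := fun c => by
      simp only [tangCoef]
      split_ifs with h
      · subst h; ring
      · ring
    simp [PiLp.inner_apply, ht, this, mul_comm (tangCoef b _ y), Finset.sum_sub_distrib,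
      ← Finset.mul_sum, hsq]
  have hns : ∀ s : ℝ, ‖y + s • t‖ ^ 2 = 1 + s ^ 2 * ‖t‖ ^ 2 := fun s => by
    rw [norm_add_sq_real, real_inner_smul_right, horth, norm_smul, hy1, mul_pow, Real.norm_eq_abs,
      sq_abs]
    ring
  set r : ℝ → ℝ := fun s => (√(1 + s ^ 2 * ‖t‖ ^ 2))⁻¹ with hr
  have hr0 : HasDerivAt r 0 0 := by
    have h1 : HasDerivAt (fun s : ℝ => 1 + s ^ 2 * ‖t‖ ^ 2) 0 0 :=
      ((((hasDerivAt_id (0 : ℝ)).fun_pow 2).mul_const (‖t‖ ^ 2)).const_add 1).congr_deriv (by simp)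
    exact ((h1.sqrt (by simp)).fun_inv (by simp)).congr_deriv (by simp)
  have hγ : HasDerivAt (fun s => r s • (y + s • t)) t 0 := by
    have h1 : HasDerivAt (fun s : ℝ => y + s • t) t 0 :=
      (((hasDerivAt_id (0 : ℝ)).smul_const t).const_add y).congr_deriv (by simp)
    exact (hr0.fun_smul h1).congr_deriv (by simp [hr])
  have hγ0 : (fun s => r s • (y + s • t)) 0 = y := by simp [hr]
  have hv0 : HasFDerivAt v (fderiv ℝ v y) ((fun s => r s • (y + s • t)) 0) := by
    rw [hγ0]; exact hv.differentiableAt_top.hasFDerivAt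
  have hcomp := hv0.comp_hasDerivAt 0 hγ
  have hzero : (v ∘ fun s => r s • (y + s • t)) = fun _ => 0 := by
    funext s
    refine hs _ ?_
    have hp : 0 < 1 + s ^ 2 * ‖t‖ ^ 2 := by positivity
    have h1 : ‖y + s • t‖ = √(1 + s ^ 2 * ‖t‖ ^ 2) := by
      rw [← hns, Real.sqrt_sq (norm_nonneg _)]
    simp only [Sphere', mem_sphere_iff_norm, sub_zero, norm_smul, hr, h1, norm_inv, Real.norm_eq_abs,
      abs_of_nonneg (Real.sqrt_nonneg _)]
    exact inv_mul_cancel₀ (Real.sqrt_pos.2 hp).ne'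
  rw [hzero] at hcomp
  have := hcomp.unique (hasDerivAt_const 0 (0 : ℝ))
  rwa [fderiv_apply_eq_sum_pd] at this

lemma tangWord_eq_zero (hv : ContDiff ℝ ∞ v) (hs : ∀ y ∈ Sphere' n, v y = 0) (α : List (Fin n)) :
    ∀ y ∈ Sphere' n, tangWord α v y = 0 := by
  induction α with
  | nil => exact hs
  | cons b α ih => exact fun y hy => tang_eq_zero (contDiff_tangWord hv α) ih b hy

end Commutators

section CommutatorEstimates

open scoped ContDiff Topology

variable {c₁ M : ℝ}

/-- `‖Δq‖_{k,∞} + ‖q‖_{k+1,∞}`. -/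
def dataW (d : DirichletData n c₁ M) (k : ℕ) : ℝ := ckNorm k (lapl d.x d.q) + ckNorm (k + 1) d.q

/-- The weight `Σ_{j+l=k} ‖g‖_{j+1,∞} (‖Δq‖_{l,∞} + ‖q‖_{l+1,∞})`. -/
def bW (d : DirichletData n c₁ M) (k : ℕ) : ℝ :=
  ∑ p ∈ Finset.HasAntidiagonal.antidiagonal k, gW d (p.1 + 1) * dataW d p.2

lemma dataW_nonneg (d : DirichletData n c₁ M) (k : ℕ) : 0 ≤ dataW d k :=
  add_nonneg (ckNorm_nonneg _ _) (ckNorm_nonneg _ _)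

lemma bW_nonneg (d : DirichletData n c₁ M) (k : ℕ) : 0 ≤ bW d k :=
  Finset.sum_nonneg fun _ _ => mul_nonneg (gW_nonneg d _) (dataW_nonneg d _)

lemma monotone_bW (d : DirichletData n c₁ M) : Monotone (bW d) := by
  refine monotone_nat_of_le_succ fun k => ?_
  unfold bW
  rw [Finset.Nat.sum_antidiagonal_succ]
  refine le_add_of_nonneg_of_le (mul_nonneg (gW_nonneg d _) (dataW_nonneg d _))
    (Finset.sum_le_sum fun p _ => ?_)
  exact mul_le_mul_of_nonneg_right (monotone_gW d (by lia)) (dataW_nonneg d _)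

lemma dataW_le_bW (d : DirichletData n c₁ M) (k : ℕ) : dataW d k ≤ bW d k := by
  have h := Finset.single_le_sum (s := Finset.HasAntidiagonal.antidiagonal k)
    (f := fun p => gW d (p.1 + 1) * dataW d p.2)
    (fun _ _ => mul_nonneg (gW_nonneg d _) (dataW_nonneg d _))
    (show (0, k) ∈ _ by simp)
  exact (le_mul_of_one_le_left (dataW_nonneg d k) (one_le_gW d _)).trans h

lemma WeightMul.raise {I : Type*} {w w' : I → ℕ → ℝ} (h : WeightMul w w' w') (m : ℕ) :
    WeightMul w (raise m w') (raise m w') := fun j l => by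
  simpa only [_root_.raise, add_assoc] using h j (l + m)

lemma weightMul_bW : WeightMul (raise 1 gW) bW (bW : DirichletData n c₁ M → ℕ → ℝ) := by
  intro j l
  choose C hC h using weightMul_raise_gW (n := n) (c₁ := c₁) (M := M) (m := 1) (by norm_num) j
  refine ⟨∑ k ∈ Finset.range (l + 1), C k, Finset.sum_nonneg fun k _ => hC k, fun d => ?_⟩
  have hsub : ∑ p ∈ Finset.HasAntidiagonal.antidiagonal l, gW d (p.1 + j + 1) * dataW d p.2 ≤
      bW d (j + l) := by
    unfold bW
    rw [← Finset.sum_image (s := Finset.HasAntidiagonal.antidiagonal l)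
      (g := fun p : ℕ × ℕ => (p.1 + j, p.2)) (f := fun p => gW d (p.1 + 1) * dataW d p.2)
      (fun p _ q _ h => by
        simp only [Prod.mk.injEq, add_left_inj] at h
        exact Prod.ext h.1 h.2)]
    refine Finset.sum_le_sum_of_subset_of_nonneg (fun p hp => ?_)
      fun _ _ _ => mul_nonneg (gW_nonneg d _) (dataW_nonneg d _)
    simp only [Finset.mem_image, Finset.HasAntidiagonal.mem_antidiagonal] at hp ⊢
    obtain ⟨q, hq, rfl⟩ := hp
    lia
  refine le_trans ?_ (mul_le_mul_of_nonneg_left hsub (Finset.sum_nonneg fun k _ => hC k))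
  rw [bW, Finset.mul_sum, Finset.mul_sum]
  refine Finset.sum_le_sum fun p hp => ?_
  have hp1 : p.1 ∈ Finset.range (l + 1) := by
    rw [Finset.HasAntidiagonal.mem_antidiagonal] at hp
    simp only [Finset.mem_range]
    lia
  have h1 := h p.1 d
  simp only [raise] at h1
  calc raise 1 gW d j * (gW d (p.1 + 1) * dataW d p.2)
      = gW d (j + 1) * gW d (p.1 + 1) * dataW d p.2 := by rw [raise, mul_assoc]
    _ ≤ C p.1 * gW d (j + p.1 + 1) * dataW d p.2 :=
      mul_le_mul_of_nonneg_right h1 (dataW_nonneg d _)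
    _ ≤ (∑ k ∈ Finset.range (l + 1), C k) * gW d (j + p.1 + 1) * dataW d p.2 := by
      refine mul_le_mul_of_nonneg_right (mul_le_mul_of_nonneg_right ?_ (gW_nonneg d _))
        (dataW_nonneg d _)
      exact Finset.single_le_sum (fun k _ => hC k) hp1
    _ = _ := by rw [add_comm j p.1, mul_assoc]

lemma raise_raise {I : Type*} (a b : ℕ) (w : I → ℕ → ℝ) : raise a (raise b w) = raise (a + b) w := by
  funext i k
  simp only [raise]
  congr 1
  lia

lemma raise_nonneg {I : Type*} {w : I → ℕ → ℝ} (hw : ∀ i k, 0 ≤ w i k) (m : ℕ) (i : I) (k : ℕ) :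
    0 ≤ raise m w i k := hw i _

lemma weightMul_gW_bW (m : ℕ) :
    WeightMul gW (raise m bW) (raise m (bW : DirichletData n c₁ M → ℕ → ℝ)) :=
  (weightMul_bW.raise m).mono_left (weightLE_raise monotone_gW 1) (raise_nonneg bW_nonneg m)

lemma monotone_raise_bW (m : ℕ) (d : DirichletData n c₁ M) : Monotone (raise m bW d) :=
  monotone_raise (monotone_bW d) m

lemma Tame.vf_fixed {I : Type*} {w : I → ℕ → ℝ} {t : Fin n → E' n → ℝ}
    {v : I → E' n → ℝ} (ht : ∀ a, SmoothNear (t a)) (hv : ∀ a, Tame ⊤ w fun i => pd a (v i))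
    (hw : ∀ i, Monotone (w i)) (h0 : ∀ i k, 0 ≤ w i k) : Tame ⊤ w fun i => _root_.vf t (v i) :=
  Tame.sum h0 fun a _ => (hv a).fixed_mul (ht a) hw

lemma tame_commCoef {t : Fin n → E' n → ℝ} (ht : ∀ a, ContDiff ℝ ∞ (t a)) (i a : Fin n) :
    Tame ⊤ (raise 1 gW) fun d : DirichletData n c₁ M => commCoef d.x t i a := by
  refine Tame.sub ((tame_epd_of_smoothNear (ht a).smoothNear i).mono (weightLE_raise monotone_gW 1))
    ?_ fun d => monotone_raise (monotone_gW d) 1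
  exact Tame.vf_fixed (fun b => (ht b).smoothNear) (fun b => (tame_invJac a i).pderiv b)
    (fun d => monotone_raise (monotone_gW d) 1) (raise_gW_nonneg 1)

lemma tame_epd {m : ℕ} {v : DirichletData n c₁ M → E' n → ℝ}
    (hv : ∀ a, Tame ⊤ (raise m bW) fun d => pd a (v d)) (i : Fin n) :
    Tame ⊤ (raise m bW) fun d => epd d.x i (v d) :=
  Tame.vf (fun a => tame_invJac a i) hv (weightMul_gW_bW m) (raise_nonneg bW_nonneg m)

lemma tame_vf_step {m : ℕ} {v : DirichletData n c₁ M → E' n → ℝ} (hs : ∀ d, ContDiff ℝ ∞ (v d))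
    (h1 : ∀ a, Tame ⊤ (raise m bW) fun d => pd a (v d))
    (h2 : Tame ⊤ (raise m bW) fun d => lapl d.x (v d)) {t : Fin n → E' n → ℝ}
    (ht : ∀ a, ContDiff ℝ ∞ (t a)) :
    (∀ a, Tame ⊤ (raise (m + 1) bW) fun d => pd a (vf t (v d))) ∧
      Tame ⊤ (raise (m + 1) bW) fun d => lapl d.x (vf t (v d)) := by
  have hr : raise 1 (raise m (bW : DirichletData n c₁ M → ℕ → ℝ)) = raise (m + 1) bW := by
    rw [raise_raise, add_comm]
  have htn := fun a => (ht a).smoothNear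
  refine ⟨fun a => ?_, ?_⟩
  · rw [← hr]
    exact (Tame.vf_fixed htn h1 (monotone_raise_bW m) (raise_nonneg bW_nonneg m)).pderiv a
  have hd : ∀ {u : DirichletData n c₁ M → E' n → ℝ}, Tame ⊤ (raise m bW) u →
      ∀ a, Tame ⊤ (raise (m + 1) bW) fun d => pd a (u d) := fun hu a => hr ▸ hu.pderiv a
  have hc : ∀ i, Tame ⊤ (raise m bW) fun d => vf (commCoef d.x t i) (v d) := fun i =>
    Tame.vf (fun a => tame_commCoef ht i a) h1 (weightMul_bW.raise m) (raise_nonneg bW_nonneg m)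
  refine Tame.congr (h := fun d y => vf t (lapl d.x (v d)) y + ∑ i,
      (vf (commCoef d.x t i) (epd d.x i (v d)) y + epd d.x i (vf (commCoef d.x t i) (v d)) y))
    ?_ fun d y hy => (eventually_det_ne_zero d.contDiff_x (d.det_ne_zero y hy)).mono fun z hz =>
      (lapl_vf d.contDiff_x hz ht (hs d)).symm
  refine Tame.add (Tame.vf_fixed htn (hd h2) (monotone_raise_bW _) (raise_nonneg bW_nonneg _))
    (Tame.sum (raise_nonneg bW_nonneg _) fun i _ => Tame.add ?_ ?_)
  · exact Tame.vf (fun a => tame_commCoef ht i a) (hd (tame_epd h1 i)) (weightMul_bW.raise _)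
      (raise_nonneg bW_nonneg _)
  · exact tame_epd (hd (hc i)) i

lemma tame_tangWord (α : List (Fin n)) :
    (∀ a, Tame ⊤ (raise α.length bW) fun d : DirichletData n c₁ M => pd a (tangWord α d.q)) ∧
      Tame ⊤ (raise α.length bW) fun d : DirichletData n c₁ M => lapl d.x (tangWord α d.q) := by
  induction α with
  | nil =>
    refine ⟨fun a => ⟨fun d => d.contDiff_q.smoothNear.pderiv a, fun k _ => ⟨1, zero_le_one,
      fun d => ?_⟩⟩, ⟨fun d => smoothNear_lapl d.contDiff_x d.det_ne_zero d.contDiff_q,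
      fun k _ => ⟨1, zero_le_one, fun d => ?_⟩⟩⟩
    · rw [one_mul]
      refine (d.contDiff_q.smoothNear.ckNorm_pd_le a k).trans (le_trans ?_ (dataW_le_bW d k))
      exact le_add_of_nonneg_left (ckNorm_nonneg _ _)
    · rw [one_mul]
      exact le_trans (le_add_of_nonneg_right (ckNorm_nonneg _ _)) (dataW_le_bW d k)
  | cons b α ih =>
    exact tame_vf_step (fun d => contDiff_tangWord d.contDiff_q α) ih.1 ih.2 (contDiff_tangCoef b)

lemma exists_ckNorm_zero_tangWord_cons_le (c₁ M : ℝ) (b : Fin n) (α : List (Fin n)) : ∃ C, 0 ≤ C ∧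
    ∀ d : DirichletData n c₁ M, ckNorm 0 (tangWord (b :: α) d.q) ≤ C * bW d α.length := by
  obtain ⟨C, hC, h⟩ := (Tame.vf_fixed (fun a => (contDiff_tangCoef b a).smoothNear)
    (tame_tangWord (c₁ := c₁) (M := M) α).1 (monotone_raise_bW _) (raise_nonneg bW_nonneg _)).2 0 le_top
  refine ⟨C, hC, fun d => ?_⟩
  have h1 := h d
  simp only [raise, zero_add] at h1
  exact h1

lemma exists_ckNorm_zero_tangWord_le (c₁ M : ℝ) (α : List (Fin n)) : ∃ C, 0 ≤ C ∧
    ∀ d : DirichletData n c₁ M, ckNorm 0 (tangWord α d.q) ≤ C * bW d α.length := by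
  cases α with
  | nil =>
    refine ⟨1, zero_le_one, fun d => ?_⟩
    rw [one_mul]
    refine (ckNorm_mono zero_le_one _).trans (le_trans ?_ (dataW_le_bW d 0))
    exact le_add_of_nonneg_left (ckNorm_nonneg _ _)
  | cons b α =>
    obtain ⟨C, hC, h⟩ := exists_ckNorm_zero_tangWord_cons_le c₁ M b α
    exact ⟨C, hC, fun d => (h d).trans (mul_le_mul_of_nonneg_left
      (monotone_bW d (by simp)) hC)⟩

lemma Tame.inv {I : Type*} {w : I → ℕ → ℝ} {h : I → E' n → ℝ} (hh : Tame ⊤ w h) {δ : ℝ} (hδ : 0 < δ)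
    (hb : ∀ i, ∀ y ∈ Ball n, δ ≤ h i y) (h1 : ∀ i k, 1 ≤ w i k) (hw : ∀ i, Monotone (w i))
    (hmul : WeightMul (raise 1 w) (raise 1 w) (raise 1 w)) :
    Tame ⊤ w fun i y => (h i y)⁻¹ := by
  have hne : ∀ i, ∀ y ∈ Ball n, h i y ≠ 0 := fun i y hy => (hδ.trans_le (hb i y hy)).ne'
  refine tame_of_pderiv_closed (ι := Unit) (h := fun _ i y => (h i y)⁻¹) hw (fun _ => ?_)
    (fun r hr _ a => ?_) ()
  · refine ⟨fun i y hy => (hh.1 i y hy).inv (hne i y hy), fun k hk => ⟨δ⁻¹, by positivity, fun i => ?_⟩⟩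
    have hk : k = 0 := by simpa using hk
    subst hk
    refine (ckNorm_zero_le (by positivity) fun y hy => ?_).trans
      (le_mul_of_one_le_right (by positivity) (h1 i 0))
    have := hb i y hy
    rw [Real.norm_eq_abs, abs_of_pos (inv_pos.2 (hδ.trans_le this))]
    exact inv_anti₀ hδ this
  · have hr' := (hr ()).mono (weightLE_raise hw 1)
    refine (((hr'.mul hr' hmul).mul ((hh.pderiv a).of_le le_top) hmul).const_mul (-1)
      fun i => monotone_raise (hw i) 1).congr fun i y hy => ?_
    filter_upwards [(hh.1 i).eventually_differentiableAt hy,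
      (hh.1 i y hy).continuousAt.eventually_ne (hne i y hy)] with z hz hz0
    rw [pd, pd, show (fun y => (h i y)⁻¹) = (fun t : ℝ => t⁻¹) ∘ h i from rfl,
      ((hasDerivAt_inv hz0).comp_hasFDerivAt z hz.hasFDerivAt).fderiv]
    simp only [_root_.smul_apply, smul_eq_mul]
    field_simp

end CommutatorEstimates

section HessianRecovery

open scoped ContDiff Topology

variable {c₁ M : ℝ} {x : E' n → E' n} {v : E' n → ℝ} {y : E' n}

/-- The part `∂_a∂_b v - y_b Σ_c y_c ∂_a∂_c v` of the Hessian, expressed through tangential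
derivatives. -/
def tangHess (a b : Fin n) (v : E' n → ℝ) (y : E' n) : ℝ :=
  pd a (tang b v) y + ((if a = b then 1 else 0) * (∑ c, y c * pd c v y) + y b * pd a v y)

/-- The difference of `∂_a∂_b v` and `y_a y_b Σ_{cd} y_c y_d ∂_c∂_d v`. -/
def tangPart (a b : Fin n) (v : E' n → ℝ) (y : E' n) : ℝ :=
  tangHess a b v y + y b * ∑ c, y c * tangHess c a v y

/-- The radial second derivative `Σ_{cd} y_c y_d ∂_c∂_d v`. -/
def normalHess (v : E' n → ℝ) (y : E' n) : ℝ := ∑ c, y c * ∑ d, y d * pd c (pd d v) y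

lemma pd_tangCoef (a b c : Fin n) (y : E' n) :
    pd a (tangCoef b c) y = -((if b = a then 1 else 0) * y c + y b * (if c = a then 1 else 0)) := by
  have h : tangCoef b c = fun y : E' n => (if c = b then 1 else 0) + (-1) * (y b * y c) := by
    funext y; simp only [tangCoef]; ring
  have hm : DifferentiableAt ℝ (fun y : E' n => y b * y c) y :=
    (differentiableAt_coord b y).mul (differentiableAt_coord c y)
  rw [h, pd_add (differentiableAt_const _) (hm.const_mul _), pd_const,
    pd_mul (differentiableAt_const _) hm, pd_const,
    pd_mul (differentiableAt_coord b y) (differentiableAt_coord c y), pd_coord, pd_coord]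
  ring

lemma tangHess_eq (hv : ContDiff ℝ ∞ v) (a b : Fin n) (y : E' n) :
    tangHess a b v y = pd a (pd b v) y - y b * ∑ c, y c * pd a (pd c v) y := by
  have h : pd a (tang b v) y =
      ∑ c, (pd a (tangCoef b c) y * pd c v y + tangCoef b c y * pd a (pd c v) y) := by
    have h1 : ∀ c, DifferentiableAt ℝ (tangCoef b c) y := fun c =>
      (contDiff_tangCoef b c).differentiableAt_top
    have h2 : ∀ c, DifferentiableAt ℝ (pd c v) y := fun c => (contDiff_pd hv c).differentiableAt_top
    rw [show tang b v = fun z => ∑ c, tangCoef b c z * pd c v z from rfl,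
      pd_sum fun c _ => (h1 c).fun_mul (h2 c)]
    exact Finset.sum_congr rfl fun c _ => pd_mul (h1 c) (h2 c) a
  rw [tangHess, h]
  simp only [pd_tangCoef, tangCoef, Finset.sum_add_distrib, sub_mul, neg_mul, add_mul,
    Finset.sum_sub_distrib, Finset.sum_neg_distrib, mul_assoc, ite_mul, one_mul, zero_mul,
    Finset.sum_ite_eq', Finset.mem_univ, if_true, mul_ite, mul_zero, ← Finset.mul_sum, eq_comm (a := a)]
  by_cases hab : b = a
  · simp [hab]; ring
  · simp [hab]

lemma sum_mul_tangHess (hv : ContDiff ℝ ∞ v) (a : Fin n) (y : E' n) :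
    ∑ c, y c * tangHess c a v y = ∑ c, y c * pd a (pd c v) y - y a * normalHess v y := by
  simp only [tangHess_eq hv, mul_sub, Finset.sum_sub_distrib, normalHess, Finset.mul_sum]
  congr 1
  · exact Finset.sum_congr rfl fun c _ => by
      rw [pd_comm (hv.contDiffAt.of_le (WithTop.coe_le_coe.2 le_top))]
  · exact Finset.sum_congr rfl fun c _ => Finset.sum_congr rfl fun e _ => by ring

lemma pd_pd_eq (hv : ContDiff ℝ ∞ v) (a b : Fin n) (y : E' n) :
    pd a (pd b v) y = tangPart a b v y + y b * (y a * normalHess v y) := by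
  rw [tangPart, sum_mul_tangHess hv, tangHess_eq hv]
  ring

lemma rho_mul_normalHess (hv : ContDiff ℝ ∞ v) (y : E' n) :
    rho y * normalHess v y = ∑ a, y a * ∑ c, y c * tangHess c a v y := by
  simp only [sum_mul_tangHess hv, mul_sub, Finset.sum_sub_distrib, ← mul_assoc]
  rw [← Finset.sum_mul, rho, sub_mul, one_mul]
  simp only [normalHess]

/-- The contribution to the Laplacian of the derivatives of the frame. -/
def frameTerm (x : E' n → E' n) (v : E' n → ℝ) (y : E' n) : ℝ :=
  ∑ i, ∑ a, invJac x a i y * vf (fun b => pd a (invJac x b i)) v y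

/-- The contribution to the Laplacian of the tangential part of the Hessian. -/
def tangTerm (x : E' n → E' n) (v : E' n → ℝ) (y : E' n) : ℝ :=
  ∑ i, ∑ a, invJac x a i y * ∑ b, invJac x b i y * tangPart a b v y

lemma lapl_eq_conormSq_mul (hx : ContDiff ℝ ∞ x) (h : (jacM x y).det ≠ 0) (hv : ContDiff ℝ ∞ v) :
    lapl x v y = frameTerm x v y + (tangTerm x v y + conormSq x y * normalHess v y) := by
  rw [lapl_eq_sum_epd hx h hv.contDiffAt, frameTerm, tangTerm, conormSq, Finset.sum_mul,
    ← Finset.sum_add_distrib, ← Finset.sum_add_distrib]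
  refine Finset.sum_congr rfl fun i _ => ?_
  rw [epd_eq_vf, epd_eq_vf, vf_vf (fun b => (contDiffAt_invJac hx h b i).differentiableAt_top)
    hv.contDiffAt, pow_two, Finset.sum_mul, Finset.sum_mul, ← Finset.sum_add_distrib,
    ← Finset.sum_add_distrib]
  refine Finset.sum_congr rfl fun a _ => ?_
  simp only [vf, pd_pd_eq hv a, mul_add, Finset.sum_add_distrib, Finset.mul_sum]
  congr 2
  simp only [Finset.sum_mul]
  exact Finset.sum_congr rfl fun b _ => by ring

lemma normalHess_eq (hx : ContDiff ℝ ∞ x) (h : (jacM x y).det ≠ 0) (hv : ContDiff ℝ ∞ v)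
    (h0 : conormSq x y + rho y ≠ 0) :
    normalHess v y = (conormSq x y + rho y)⁻¹ * (lapl x v y - frameTerm x v y - tangTerm x v y +
      ∑ a, y a * ∑ c, y c * tangHess c a v y) := by
  rw [← rho_mul_normalHess hv, lapl_eq_conormSq_mul hx h hv]
  field_simp
  ring

end HessianRecovery

section RecoveryEstimates

open scoped ContDiff Topology

variable {c₁ M : ℝ}

/-- The weight controlling the Hessian of `tangWord α q`. -/
def hessW (α : List (Fin n)) (d : DirichletData n c₁ M) (k : ℕ) : ℝ :=
  ∑ b, ckNorm (k + 1) (tang b (tangWord α d.q)) + bW d (k + α.length)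

lemma hessW_nonneg (α : List (Fin n)) (d : DirichletData n c₁ M) (k : ℕ) : 0 ≤ hessW α d k :=
  add_nonneg (Finset.sum_nonneg fun _ _ => ckNorm_nonneg _ _) (bW_nonneg d _)

lemma monotone_hessW (α : List (Fin n)) (d : DirichletData n c₁ M) : Monotone (hessW α d) :=
  fun _ _ h => add_le_add (Finset.sum_le_sum fun _ _ => ckNorm_mono (by lia) _)
    (monotone_bW d (by lia))

lemma weightLE_bW_hessW (α : List (Fin n)) :
    WeightLE (raise α.length bW) (hessW α : DirichletData n c₁ M → ℕ → ℝ) :=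
  WeightLE.of_le fun _ _ =>
    le_add_of_nonneg_left (Finset.sum_nonneg fun _ _ => ckNorm_nonneg _ _)

lemma tame_tang (α : List (Fin n)) (b : Fin n) :
    Tame ⊤ (raise α.length bW) fun d : DirichletData n c₁ M => tang b (tangWord α d.q) :=
  Tame.vf_fixed (fun a => (contDiff_tangCoef b a).smoothNear) (tame_tangWord α).1
    (monotone_raise_bW _) (raise_nonneg bW_nonneg _)

lemma weightMul_gW_hessW (α : List (Fin n)) :
    WeightMul gW (hessW α) (hessW α : DirichletData n c₁ M → ℕ → ℝ) := by
  rintro (_ | j) l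
  · obtain ⟨B, hB, hb⟩ := exists_gW_two_le n c₁ M
    refine ⟨B, hB, fun d => ?_⟩
    rw [zero_add]
    exact mul_le_mul_of_nonneg_right ((monotone_gW d (by lia)).trans (hb d)) (hessW_nonneg α d l)
  · choose C hC h using fun b => (tame_tang (c₁ := c₁) (M := M) α b).2 (l + 1) le_top
    obtain ⟨E, hE, he⟩ := weightMul_bW (c₁ := c₁) (M := M) (n := n) j (l + 1 + α.length)
    refine ⟨(∑ b, C b + 1) * E, mul_nonneg (add_nonneg (Finset.sum_nonneg fun b _ => hC b)
      zero_le_one) hE, fun d => ?_⟩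
    have h1 : hessW α d l ≤ (∑ b, C b + 1) * bW d (l + 1 + α.length) := by
      rw [add_mul, one_mul, Finset.sum_mul]
      exact add_le_add (Finset.sum_le_sum fun b _ => h b d) (monotone_bW d (by lia))
    have h2 : bW d (j + (l + 1 + α.length)) ≤ hessW α d (j + 1 + l) := by
      rw [show j + (l + 1 + α.length) = j + 1 + l + α.length by lia]
      exact le_add_of_nonneg_left (Finset.sum_nonneg fun _ _ => ckNorm_nonneg _ _)
    have h3 : 0 ≤ ∑ b, C b + 1 := add_nonneg (Finset.sum_nonneg fun b _ => hC b) zero_le_one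
    calc gW d (j + 1) * hessW α d l
        ≤ gW d (j + 1) * ((∑ b, C b + 1) * bW d (l + 1 + α.length)) :=
          mul_le_mul_of_nonneg_left h1 (gW_nonneg d _)
      _ = (∑ b, C b + 1) * (raise 1 gW d j * bW d (l + 1 + α.length)) := by rw [raise]; ring
      _ ≤ (∑ b, C b + 1) * (E * hessW α d (j + 1 + l)) :=
          mul_le_mul_of_nonneg_left ((he d).trans (mul_le_mul_of_nonneg_left h2 hE)) h3
      _ = _ := by ring

lemma tame_tangHess (α : List (Fin n)) (a b : Fin n) :
    Tame ⊤ (hessW α) fun d : DirichletData n c₁ M => tangHess a b (tangWord α d.q) := by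
  have h1 := fun c => ((tame_tangWord (c₁ := c₁) (M := M) α).1 c).mono (weightLE_bW_hessW α)
  refine Tame.add ⟨fun d => (contDiff_tang (contDiff_tangWord d.contDiff_q α) b).smoothNear.pderiv a,
    fun k _ => ⟨1, zero_le_one, fun d => ?_⟩⟩ (Tame.add (Tame.const_mul _ (Tame.sum (hessW_nonneg α)
      fun c _ => (h1 c).fixed_mul (smoothNear_coord c) (monotone_hessW α)) (monotone_hessW α))
      ((h1 a).fixed_mul (smoothNear_coord b) (monotone_hessW α)))
  rw [one_mul]
  refine ((contDiff_tang (contDiff_tangWord d.contDiff_q α) b).smoothNear.ckNorm_pd_le a k).trans ?_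
  exact le_add_of_le_of_nonneg (Finset.single_le_sum
    (f := fun b => ckNorm (k + 1) (tang b (tangWord α d.q))) (fun _ _ => ckNorm_nonneg _ _)
    (Finset.mem_univ b)) (bW_nonneg d _)

lemma tame_sum_mul_tangHess (α : List (Fin n)) (a : Fin n) :
    Tame ⊤ (hessW α) fun (d : DirichletData n c₁ M) y =>
      ∑ c, y c * tangHess c a (tangWord α d.q) y :=
  Tame.sum (hessW_nonneg α) fun c _ =>
    (tame_tangHess α c a).fixed_mul (smoothNear_coord c) (monotone_hessW α)

lemma tame_tangPart (α : List (Fin n)) (a b : Fin n) :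
    Tame ⊤ (hessW α) fun d : DirichletData n c₁ M => tangPart a b (tangWord α d.q) :=
  (tame_tangHess α a b).add
    ((tame_sum_mul_tangHess α a).fixed_mul (smoothNear_coord b) (monotone_hessW α))

lemma tame_frameTerm (α : List (Fin n)) :
    Tame ⊤ (hessW α) fun d : DirichletData n c₁ M => frameTerm d.x (tangWord α d.q) :=
  Tame.sum (hessW_nonneg α) fun i _ => Tame.sum (hessW_nonneg α) fun a _ =>
    (tame_invJac a i).mul ((Tame.vf (fun b => (tame_invJac b i).pderiv a) (tame_tangWord α).1
      (weightMul_bW.raise _) (raise_nonneg bW_nonneg _)).mono (weightLE_bW_hessW α))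
      (weightMul_gW_hessW α)

lemma tame_tangTerm (α : List (Fin n)) :
    Tame ⊤ (hessW α) fun d : DirichletData n c₁ M => tangTerm d.x (tangWord α d.q) :=
  Tame.sum (hessW_nonneg α) fun i _ => Tame.sum (hessW_nonneg α) fun a _ =>
    (tame_invJac a i).mul (Tame.sum (hessW_nonneg α) fun b _ =>
      (tame_invJac b i).mul (tame_tangPart α a b) (weightMul_gW_hessW α)) (weightMul_gW_hessW α)

lemma DirichletData.le_conormSq_add_rho (d : DirichletData n c₁ M) {y : E' n} (hy : y ∈ Ball n) :
    (c₁ ^ 2 + 1)⁻¹ ≤ conormSq d.x y + rho y := by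
  have h := d.norm_sq_le hy
  have h0 := rho_nonneg hy
  have h1 : 0 ≤ conormSq d.x y := Finset.sum_nonneg fun _ _ => sq_nonneg _
  rw [inv_le_iff_one_le_mul₀ (by positivity)]
  have h2 := rho_eq y
  nlinarith [mul_nonneg (sq_nonneg c₁) h0]

lemma tame_inv_conormSq_add_rho :
    Tame ⊤ gW fun (d : DirichletData n c₁ M) y => (conormSq d.x y + rho y)⁻¹ := by
  refine Tame.inv ?_ (by positivity) (fun d y hy => d.le_conormSq_add_rho hy) one_le_gW monotone_gW
    (weightMul_raise_gW (by norm_num))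
  refine Tame.add (Tame.sum gW_nonneg fun i _ => ?_)
    (tame_of_forall_ckNorm_le contDiff_rho.smoothNear one_le_gW)
  have h : Tame ⊤ gW fun (d : DirichletData n c₁ M) y => ∑ a, invJac d.x a i y * y a :=
    Tame.sum gW_nonneg fun a _ => by
      simpa only [mul_comm] using (tame_invJac a i).fixed_mul (smoothNear_coord a) monotone_gW
  simpa only [pow_two] using h.mul h weightMul_gW

lemma tame_normalHess (α : List (Fin n)) :
    Tame ⊤ (hessW α) fun d : DirichletData n c₁ M => normalHess (tangWord α d.q) := by
  refine Tame.congr (tame_inv_conormSq_add_rho.mul (w' := hessW α) (Tame.add (Tame.sub (Tame.sub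
    ((tame_tangWord α).2.mono (weightLE_bW_hessW α)) (tame_frameTerm α) (monotone_hessW α))
    (tame_tangTerm α) (monotone_hessW α)) (Tame.sum (s := Finset.univ) (hessW_nonneg α) fun a _ =>
    (tame_sum_mul_tangHess α a).fixed_mul (smoothNear_coord a) (monotone_hessW α)))
    (weightMul_gW_hessW α)) fun d y hy => ?_
  have hs : ContDiffAt ℝ ∞ (conormSq d.x) y := ContDiffAt.sum fun i _ => (ContDiffAt.sum fun a _ =>
    (d.smoothNear_invJac a i y hy).mul (contDiff_coord a).contDiffAt).pow 2
  have hc : ContinuousAt (fun y => conormSq d.x y + rho y) y :=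
    hs.continuousAt.add contDiff_rho.continuous.continuousAt
  have h0 : conormSq d.x y + rho y ≠ 0 :=
    ((show (0 : ℝ) < (c₁ ^ 2 + 1)⁻¹ by positivity).trans_le (d.le_conormSq_add_rho hy)).ne'
  filter_upwards [hc.eventually_ne h0, eventually_det_ne_zero d.contDiff_x (d.det_ne_zero y hy)]
    with z hz hz'
  exact (normalHess_eq d.contDiff_x hz' (contDiff_tangWord d.contDiff_q α) hz).symm

lemma tame_pd_pd_tangWord (α : List (Fin n)) (a b : Fin n) :
    Tame ⊤ (hessW α) fun d : DirichletData n c₁ M => pd a (pd b (tangWord α d.q)) := by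
  have h := (tame_tangPart (c₁ := c₁) (M := M) α a b).add
    (((tame_normalHess α).fixed_mul (smoothNear_coord a) (monotone_hessW α)).fixed_mul
      (smoothNear_coord b) (monotone_hessW α))
  refine h.congr fun d y _ => Filter.Eventually.of_forall fun z => ?_
  exact (pd_pd_eq (contDiff_tangWord d.contDiff_q α) a b z).symm

lemma exists_ckNorm_tangWord_add_two_le (c₁ M : ℝ) (α : List (Fin n)) (m : ℕ) : ∃ C, 0 ≤ C ∧
    ∀ d : DirichletData n c₁ M, ckNorm (m + 2) (tangWord α d.q) ≤
      C * (∑ b, ckNorm (m + 1) (tangWord (b :: α) d.q) + bW d (m + α.length)) := by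
  choose C hC h using fun p : Fin n × Fin n =>
    (tame_pd_pd_tangWord (c₁ := c₁) (M := M) α p.1 p.2).2 m le_top
  choose D hD h' using fun a => ((tame_tangWord (c₁ := c₁) (M := M) α).1 a).2 0 le_top
  obtain ⟨E, hE, he⟩ := exists_ckNorm_zero_tangWord_le c₁ M α
  have hS : ∀ {ι : Type} [Fintype ι] (f : ι → ℝ), (∀ i, 0 ≤ f i) → 0 ≤ ∑ i, f i :=
    fun f hf => Finset.sum_nonneg fun i _ => hf i
  refine ⟨E + ∑ b, (D b + ∑ a, C (a, b)), add_nonneg hE (hS _ fun b =>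
    add_nonneg (hD b) (hS _ fun a => hC _)), fun d => ?_⟩
  have hq := (contDiff_tangWord d.contDiff_q α)
  have hle : bW d α.length ≤ hessW α d m := (monotone_bW d (by lia)).trans
    (le_add_of_nonneg_left (hS _ fun _ => ckNorm_nonneg _ _))
  have key : ∀ b, ckNorm (m + 1) (pd b (tangWord α d.q)) ≤ (D b + ∑ a, C (a, b)) * hessW α d m := by
    intro b
    refine ((hq.smoothNear.pderiv b).ckNorm_succ_le m).trans ?_
    rw [add_mul, Finset.sum_mul]
    refine add_le_add ((h' b d).trans ?_) (Finset.sum_le_sum fun a _ => h (a, b) d)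
    rw [raise, zero_add]
    exact mul_le_mul_of_nonneg_left hle (hD b)
  refine (hq.smoothNear.ckNorm_succ_le (m + 1)).trans (le_trans (add_le_add ((he d).trans
    (mul_le_mul_of_nonneg_left hle hE)) (Finset.sum_le_sum fun b _ => key b)) (le_of_eq ?_))
  rw [← Finset.sum_mul, ← add_mul]
  rfl

end RecoveryEstimates

section TameEstimate

open scoped ContDiff Topology

variable {c₁ M : ℝ}

lemma exists_ckNorm_succ_tangWord_le (c₁ M : ℝ) (t m : ℕ) (α : List (Fin n))
    (ht : α.length + m = t + 1) : ∃ C, 0 ≤ C ∧ ∀ (d : DirichletData n c₁ M) (ε : ℝ), 0 < ε → ε ≤ 1 →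
      ckNorm (m + 1) (tangWord α d.q) ≤ C * (bW d t / ε + ε * bW d (t + 1)) := by
  have hb : ∀ (d : DirichletData n c₁ M) (ε : ℝ), 0 < ε → ε ≤ 1 →
      bW d t ≤ bW d t / ε + ε * bW d (t + 1) := fun d ε h0 h1 =>
    le_add_of_le_of_nonneg (le_div_self (bW_nonneg d t) h0 h1) (mul_nonneg h0.le (bW_nonneg d _))
  induction m generalizing α with
  | zero =>
    obtain _ | ⟨b, β⟩ := α
    · simp at ht
    have hβ : β.length = t := by simpa using ht
    obtain ⟨C, hC, h⟩ := exists_ckNorm_zero_tangWord_cons_le c₁ M b β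
    obtain ⟨D, hD, h'⟩ := exists_abs_pd_le n c₁ M
    obtain ⟨E, hE, he⟩ := (tame_tangWord (c₁ := c₁) (M := M) (b :: β)).2.2 0 le_top
    refine ⟨C + n * (D * (C + E)), by positivity, fun d ε h0 h1 => ?_⟩
    have hq := contDiff_tangWord d.contDiff_q (b :: β)
    have hC' := h d
    have he' := he d
    rw [hβ] at hC'
    rw [raise, List.length_cons, hβ, zero_add] at he'
    have hX := bW_nonneg d t
    have hY := bW_nonneg d (t + 1)
    have key : ∀ a, ckNorm 0 (pd a (tangWord (b :: β) d.q)) ≤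
        D * (C + E) * (bW d t / ε + ε * bW d (t + 1)) := fun a => by
      refine (h' d _ hq (tangWord_eq_zero d.contDiff_q d.eq_zero (b :: β)) ε h0 h1 a).trans ?_
      rw [mul_assoc]
      refine mul_le_mul_of_nonneg_left ?_ hD
      have h2 : ckNorm 0 (tangWord (b :: β) d.q) / ε ≤ C * (bW d t / ε) := by
        rw [← mul_div_assoc]
        exact div_le_div_of_nonneg_right hC' h0.le
      have h3 : ε * ckNorm 0 (lapl d.x (tangWord (b :: β) d.q)) ≤ E * (ε * bW d (t + 1)) :=
        (mul_le_mul_of_nonneg_left he' h0.le).trans_eq (by ring)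
      have h4 : 0 ≤ E * (bW d t / ε) := by positivity
      have h5 : 0 ≤ C * (ε * bW d (t + 1)) := by positivity
      nlinarith
    refine (hq.smoothNear.ckNorm_succ_le 0).trans (le_trans (add_le_add (hC'.trans
      (mul_le_mul_of_nonneg_left (hb d ε h0 h1) hC)) (Finset.sum_le_sum fun a _ => key a))
      (le_of_eq ?_))
    simp only [Finset.sum_const, Finset.card_univ, Fintype.card_fin, nsmul_eq_mul]
    ring
  | succ m ih =>
    obtain ⟨C, hC, h⟩ := exists_ckNorm_tangWord_add_two_le c₁ M α m
    choose D hD h' using fun b : Fin n => ih (b :: α) (by simp only [List.length_cons]; lia)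
    have hS : 0 ≤ ∑ b, D b := Finset.sum_nonneg fun b _ => hD b
    refine ⟨C * (∑ b, D b + 1), by positivity, fun d ε h0 h1 => (h d).trans ?_⟩
    rw [mul_assoc]
    refine mul_le_mul_of_nonneg_left ?_ hC
    rw [add_mul, one_mul, Finset.sum_mul]
    refine add_le_add (Finset.sum_le_sum fun b _ => h' b d ε h0 h1) ?_
    rw [show m + α.length = t by lia]
    exact hb d ε h0 h1

/-- The right hand side `‖Δq‖_{k,∞} + ‖g‖_{k+1,∞} ‖Δq‖_{0,∞}` of the tame estimate. -/
def tameRhs (d : DirichletData n c₁ M) (k : ℕ) : ℝ :=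
  ckNorm k (lapl d.x d.q) + gW d (k + 1) * ckNorm 0 (lapl d.x d.q)

lemma tameRhs_nonneg (d : DirichletData n c₁ M) (k : ℕ) : 0 ≤ tameRhs d k :=
  add_nonneg (ckNorm_nonneg _ _) (mul_nonneg (gW_nonneg d _) (ckNorm_nonneg _ _))

lemma monotone_tameRhs (d : DirichletData n c₁ M) : Monotone (tameRhs d) := fun _ _ h =>
  add_le_add (ckNorm_mono h _)
    (mul_le_mul_of_nonneg_right (monotone_gW d (by lia)) (ckNorm_nonneg _ _))

lemma weightMul_tameRhs :
    WeightMul (raise 1 gW) tameRhs (tameRhs : DirichletData n c₁ M → ℕ → ℝ) := by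
  intro j l
  obtain ⟨B, hB, hb⟩ := exists_gW_two_le n c₁ M
  obtain ⟨C, hC⟩ := exists_logConvexUpTo_gW n c₁ M
  obtain ⟨D, hD⟩ := exists_logConvexUpTo_ckNorm n
  obtain ⟨E, hE, he⟩ := exists_interp_mul_le (fun k => C (k + 1)) D j l
  obtain ⟨G, hG, hg⟩ := weightMul_raise_gW (n := n) (c₁ := c₁) (M := M) (m := 1) (by norm_num) j l
  refine ⟨E * (B + 1) + G, by positivity, fun d => ?_⟩
  have h1 : LogConvexUpTo (fun k => C (k + 1)) (raise 1 gW d) :=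
    ⟨fun k => gW_nonneg d _, fun k => by
      simpa only [raise, add_right_comm] using (hC d).2 (k + 1)⟩
  have h2 := he _ _ h1 (hD _ (smoothNear_lapl d.contDiff_x d.det_ne_zero d.contDiff_q))
  have h3 := hg d
  have h4 : raise 1 gW d 0 ≤ B := (monotone_gW d (by norm_num)).trans (hb d)
  simp only [raise, tameRhs] at h2 h3 h4 ⊢
  have hF := ckNorm_nonneg (j + l) (lapl d.x d.q)
  have hF0 := ckNorm_nonneg 0 (lapl d.x d.q)
  have hH := mul_nonneg (gW_nonneg d (j + l + 1)) hF0
  set F := ckNorm (j + l) (lapl d.x d.q)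
  set F0 := ckNorm 0 (lapl d.x d.q)
  have h5 : E * (gW d (0 + 1) * F + gW d (j + l + 1) * F0) ≤
      E * ((B + 1) * (F + gW d (j + l + 1) * F0)) :=
    mul_le_mul_of_nonneg_left (by nlinarith) hE
  have h6 : gW d (j + 1) * (gW d (l + 1) * F0) ≤ G * (F + gW d (j + l + 1) * F0) := by
    rw [← mul_assoc]
    refine (mul_le_mul_of_nonneg_right h3 hF0).trans ?_
    rw [mul_assoc]
    exact mul_le_mul_of_nonneg_left (by linarith) hG
  nlinarith

lemma exists_sum_gW_mul_dataW_le (c₁ M : ℝ) (t i : ℕ)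
    (h : ∀ k ≤ t, ∃ K, 0 ≤ K ∧ ∀ d : DirichletData n c₁ M, dataW d k ≤ K * tameRhs d k) :
    ∃ C, 0 ≤ C ∧ ∀ d : DirichletData n c₁ M,
      ∑ p ∈ Finset.HasAntidiagonal.antidiagonal t, gW d (p.1 + i + 1) * dataW d p.2 ≤
        C * tameRhs d (t + i) := by
  choose! K hK hk using h
  choose E hE he using fun p : ℕ × ℕ => weightMul_tameRhs (n := n) (c₁ := c₁) (M := M) (p.1 + i) p.2
  have hp : ∀ p ∈ Finset.HasAntidiagonal.antidiagonal t, p.1 + p.2 = t := fun p hp =>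
    Finset.HasAntidiagonal.mem_antidiagonal.1 hp
  refine ⟨∑ p ∈ Finset.HasAntidiagonal.antidiagonal t, K p.2 * E p, Finset.sum_nonneg fun p h =>
    mul_nonneg (hK _ (by have := hp p h; lia)) (hE p), fun d => ?_⟩
  rw [Finset.sum_mul]
  refine Finset.sum_le_sum fun p h => ?_
  have h1 := hp p h
  have h2 : p.2 ≤ t := by lia
  have h3 := he p d
  rw [show p.1 + i + p.2 = t + i by lia] at h3
  calc gW d (p.1 + i + 1) * dataW d p.2
      ≤ gW d (p.1 + i + 1) * (K p.2 * tameRhs d p.2) :=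
        mul_le_mul_of_nonneg_left (hk _ h2 d) (gW_nonneg d _)
    _ = K p.2 * (raise 1 gW d (p.1 + i) * tameRhs d p.2) := by rw [raise]; ring
    _ ≤ K p.2 * (E p * tameRhs d (t + i)) := mul_le_mul_of_nonneg_left h3 (hK _ h2)
    _ = _ := by ring

lemma exists_ckNorm_one_le (hn : 0 < n) (c₁ M : ℝ) : ∃ K, 0 ≤ K ∧ ∀ d : DirichletData n c₁ M,
    ckNorm 1 d.q ≤ K * ckNorm 0 (lapl d.x d.q) := by
  obtain ⟨D, hD, h⟩ := exists_abs_pd_le n c₁ M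
  refine ⟨M ^ 2 + n * (D * (M ^ 2 + 1)), by positivity, fun d => ?_⟩
  have h0 := d.ckNorm_zero_le_lapl hn d.contDiff_q d.eq_zero
  have key : ∀ a, ckNorm 0 (pd a d.q) ≤ D * (M ^ 2 + 1) * ckNorm 0 (lapl d.x d.q) := fun a => by
    refine (h d _ d.contDiff_q d.eq_zero 1 one_pos le_rfl a).trans ?_
    rw [mul_assoc]
    exact mul_le_mul_of_nonneg_left (by linarith) hD
  refine (d.contDiff_q.smoothNear.ckNorm_succ_le 0).trans
    ((add_le_add h0 (Finset.sum_le_sum fun a _ => key a)).trans_eq ?_)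
  simp only [Finset.sum_const, Finset.card_univ, Fintype.card_fin, nsmul_eq_mul]
  ring

lemma exists_ckNorm_succ_le_tameRhs (hn : 0 < n) (c₁ M : ℝ) (s : ℕ) : ∃ K, 0 ≤ K ∧
    ∀ d : DirichletData n c₁ M, ckNorm (s + 1) d.q ≤ K * tameRhs d s := by
  induction s using Nat.strong_induction_on with
  | _ s ih =>
  obtain _ | t := s
  · obtain ⟨K, hK, h⟩ := exists_ckNorm_one_le hn c₁ M
    refine ⟨K, hK, fun d => (h d).trans (mul_le_mul_of_nonneg_left ?_ hK)⟩
    exact le_add_of_nonneg_right (mul_nonneg (gW_nonneg d _) (ckNorm_nonneg _ _))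
  have hd : ∀ k ≤ t, ∃ K, 0 ≤ K ∧ ∀ d : DirichletData n c₁ M, dataW d k ≤ K * tameRhs d k := by
    intro k hk
    obtain ⟨K, hK, h⟩ := ih k (by lia)
    refine ⟨1 + K, by positivity, fun d => ?_⟩
    rw [add_mul, one_mul]
    exact add_le_add (le_add_of_nonneg_right (mul_nonneg (gW_nonneg d _) (ckNorm_nonneg _ _))) (h d)
  obtain ⟨C, hC, h⟩ := exists_ckNorm_succ_tangWord_le (n := n) c₁ M t (t + 1) [] (by simp)
  obtain ⟨A, hA, ha⟩ := exists_sum_gW_mul_dataW_le c₁ M t 0 hd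
  obtain ⟨A', hA', ha'⟩ := exists_sum_gW_mul_dataW_le c₁ M t 1 hd
  obtain ⟨B, hB, hb⟩ := exists_gW_two_le n c₁ M
  set ε : ℝ := (2 * (C * B) + 1)⁻¹ with hε
  have hCB : 0 ≤ C * B := by positivity
  have hε0 : 0 < ε := by positivity
  have hε1 : ε ≤ 1 := inv_le_one_of_one_le₀ (by linarith)
  have hεB : ε * (2 * (C * B)) ≤ 1 := by
    have : ε * (2 * (C * B) + 1) = 1 := inv_mul_cancel₀ (by positivity)
    linarith
  refine ⟨2 * (C * (A / ε + (A' + B))), by positivity, fun d => ?_⟩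
  have hR := tameRhs_nonneg d (t + 1)
  have h1 : bW d t ≤ A * tameRhs d (t + 1) := (ha d).trans
    (mul_le_mul_of_nonneg_left (monotone_tameRhs d (by lia)) hA)
  have h2 : bW d (t + 1) ≤ (A' + B) * tameRhs d (t + 1) + B * ckNorm (t + 1 + 1) d.q := by
    have h3 : gW d (0 + 1) * dataW d (t + 1) ≤
        B * (tameRhs d (t + 1) + ckNorm (t + 1 + 1) d.q) := by
      refine mul_le_mul ((monotone_gW d (by norm_num)).trans (hb d)) (add_le_add_left ?_ _)
        (dataW_nonneg d _) hB
      exact le_add_of_nonneg_right (mul_nonneg (gW_nonneg d _) (ckNorm_nonneg _ _))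
    rw [bW, Finset.Nat.sum_antidiagonal_succ]
    have := ha' d
    linarith
  have h4 : ckNorm (t + 1 + 1) d.q ≤ C * (bW d t / ε + ε * bW d (t + 1)) := h d ε hε0 hε1
  have h5 : bW d t / ε ≤ A / ε * tameRhs d (t + 1) := by
    rw [div_mul_eq_mul_div]
    exact div_le_div_of_nonneg_right h1 hε0.le
  have h6 : ε * bW d (t + 1) ≤
      (A' + B) * tameRhs d (t + 1) + ε * (B * ckNorm (t + 1 + 1) d.q) := by
    refine (mul_le_mul_of_nonneg_left h2 hε0.le).trans ?_
    rw [mul_add]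
    exact add_le_add_left (mul_le_of_le_one_left (by positivity) hε1) _
  have h7 := mul_le_mul_of_nonneg_left (add_le_add h5 h6) hC
  have h8 := mul_le_mul_of_nonneg_right hεB (ckNorm_nonneg (t + 1 + 1) d.q)
  nlinarith

end TameEstimate

/-- tame `C^k` estimate for the Dirichlet problem (Proposition 7.1). -/
theorem stmt11 (n : ℕ) (hn : 2 ≤ n) (r : ℕ) (hr : 1 ≤ r) (c₁ M : ℝ) :
    ∃ K > 0, ∀ (x : E' n → E' n) (q : E' n → ℝ),
      ContDiff ℝ (⊤ : ℕ∞) x → ContDiff ℝ (⊤ : ℕ∞) q →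
      (∀ y ∈ Ball n, (jacM x y).det ≠ 0) →
      (∀ y ∈ Ball n, coordCond x c₁ y) →
      ckNorm 3 x ≤ M →
      (∀ y ∈ Sphere' n, q y = 0) →
      ckNorm r q ≤ K * (ckNorm (r - 1) (lapl x q)
        + (∑ a, ∑ b, ckNorm r (fun y => gMet x y a b)) * ckNorm 0 (lapl x q)) := by
  obtain ⟨s, rfl⟩ : ∃ s, r = s + 1 := ⟨r - 1, by lia⟩
  obtain ⟨K, hK, h⟩ := exists_ckNorm_succ_le_tameRhs (n := n) (by lia) c₁ M s
  refine ⟨2 * K + 1, by positivity, fun x q hx hq hdet hc hM h0 => ?_⟩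
  have h1 := h ⟨x, q, hx, hq, hdet, hc, hM, h0⟩
  simp only [tameRhs, gW, add_mul, one_mul] at h1
  rw [Nat.add_sub_cancel]
  have hF : ckNorm 0 (lapl x q) ≤ ckNorm s (lapl x q) := ckNorm_mono (Nat.zero_le s) _
  have hF0 : 0 ≤ ckNorm 0 (lapl x q) := ckNorm_nonneg _ _
  have hG : 0 ≤ ∑ a, ∑ b, ckNorm (s + 1) (fun y => gMet x y a b) :=
    Finset.sum_nonneg fun _ _ => Finset.sum_nonneg fun _ _ => ckNorm_nonneg _ _
  change _ ≤ K * (_ + (_ + (∑ a, ∑ b, ckNorm (s + 1) (fun y => gMet x y a b)) * _)) at h1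
  have hGF := mul_nonneg hG hF0
  nlinarith [mul_le_mul_of_nonneg_left hF hK, mul_nonneg hK hGF]

end
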